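/- arXiv:2002.09942 — 2 statements merged into one kernel-verified Lean document; each statement's English description precedes it below -/
import Mathlib

section
/- Let G = (𝒢, Ω, v₀) be a game with Nature played on a finite arena with an ω-regular winning condition Ω, where each Nature vertex v ∈ V_N carries a probability distribution d_v over its successors with d_v(w) > 0 for every w ∈ E(v). Then Éloïse has an almost-surely winning strategy (a strategy φ_E with inf over Abélard strategies φ_A of μ^{φ_E,φ_A}_{v₀}(Ω) = 1) if and only if she has a topologically-good strategy. -/
open Cardinal

/-- The three players: Éloïse, Abélard and Nature. -/
inductive Player : Type
  | E
  | A
  | N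
  deriving DecidableEq

/-- An arena: a directed graph without dead-ends whose vertices are
partitioned among the three players (via the `owner` function). -/
structure Arena (V : Type) where
  Edge : V → V → Prop
  owner : V → Player
  no_dead : ∀ v, ∃ w, Edge v w

/-- The history `[p 0, …, p i]` of a play `p` up to time `i`. -/
def histUpTo {V : Type} (p : ℕ → V) (i : ℕ) : List V :=
  List.ofFn (fun j : Fin (i + 1) => p j.1)

/-- A play from `v0`: an infinite sequence following edges. -/
def IsPlay {V : Type} (A : Arena V) (v0 : V) (p : ℕ → V) : Prop :=
  p 0 = v0 ∧ ∀ i, A.Edge (p i) (p (i + 1))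

/-- The player `P` respects the strategy `φ` along the play `p`. -/
def Respects {V : Type} (A : Arena V) (P : Player) (φ : List V → V) (p : ℕ → V) : Prop :=
  ∀ i, A.owner (p i) = P → p (i + 1) = φ (histUpTo p i)

/-- `φ` is a strategy for player `P`: on every history ending in a vertex of `P`
it prescribes a successor of that vertex. -/
def IsStrategyFor {V : Type} (A : Arena V) (P : Player) (φ : List V → V) : Prop :=
  ∀ (l : List V) (v : V), A.owner v = P → A.Edge v (φ (l ++ [v]))

/-- The set of plays from `v0` in which Éloïse respects `φE` and Abélard respects `φA`
(Nature is unconstrained). -/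
def Outcomes {V : Type} (A : Arena V) (v0 : V) (φE φA : List V → V) : Set (ℕ → V) :=
  {p | IsPlay A v0 p ∧ Respects A Player.E φE p ∧ Respects A Player.A φA p}

/-- `l` is a (finite) prefix of the infinite word `p`. -/
def BPrefix {X : Type} (p : ℕ → X) (l : List X) : Prop :=
  ∀ i : Fin l.length, p i.1 = l.get i
/-- The type of Abélard strategies. -/
def AStrat {V : Type} (A : Arena V) : Type :=
  {φ : List V → V // IsStrategyFor A Player.A φ}

/-- The type of Éloïse strategies. -/
def EStrat {V : Type} (A : Arena V) : Type :=
  {φ : List V → V // IsStrategyFor A Player.E φ}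

/-- The cardinality leaking of an Éloïse strategy: the supremum, over Abélard
strategies, of the cardinality of the set of losing plays. -/
noncomputable def CL {V : Type} (A : Arena V) (v0 : V) (Ω : Set (ℕ → V))
    (φE : List V → V) : Cardinal :=
  ⨆ φA : AStrat A, Cardinal.mk ↥(Outcomes A v0 φE φA.1 \ Ω)

/-- The leaking value of a game: the infimum over Éloïse strategies of the
cardinality leaking. -/
noncomputable def LVal {V : Type} (A : Arena V) (v0 : V) (Ω : Set (ℕ → V)) : Cardinal :=
  ⨅ φE : EStrat A, CL A v0 Ω φE.1
/-- The nodes of the tree of finite prefixes of a set `P` of infinite words. -/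
def PrefixesOf {X : Type} (P : Set (ℕ → X)) : Set (List X) :=
  {l | ∃ p ∈ P, BPrefix p l}

/-- `B` is nowhere dense in the tree whose set of branches is `P`:
below every node there is a node through which no branch of `B` passes. -/
def NowhereDenseIn {X : Type} (P B : Set (ℕ → X)) : Prop :=
  ∀ u ∈ PrefixesOf P, ∃ v ∈ PrefixesOf P, u <+: v ∧ ∀ b ∈ B, ¬ BPrefix b v

/-- `B` is meager in the tree whose set of branches is `P`:
a countable union of nowhere dense sets. -/
def MeagerIn {X : Type} (P B : Set (ℕ → X)) : Prop :=
  ∃ f : ℕ → Set (ℕ → X), (∀ n, NowhereDenseIn P (f n)) ∧ B ⊆ ⋃ n, f n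

/-- An Éloïse strategy is topologically-good if, against every Abélard strategy,
the set of plays she loses is meager in the tree of outcomes. -/
def TopGood {V : Type} (A : Arena V) (v0 : V) (Ω : Set (ℕ → V)) (φE : List V → V) : Prop :=
  ∀ φA, IsStrategyFor A Player.A φA →
    MeagerIn (Outcomes A v0 φE φA) (Outcomes A v0 φE φA \ Ω)
/-- `L ⊆ α^ω` is ω-regular: recognized by a nondeterministic Büchi automaton with
finitely many states. -/
def IsOmegaRegular {α : Type} (L : Set (ℕ → α)) : Prop :=
  ∃ (Q : Type) (_ : Finite Q) (init : Set Q) (δ : Q → α → Set Q) (F : Set Q),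
    L = {w | ∃ ρ : ℕ → Q, ρ 0 ∈ init ∧ (∀ n, ρ (n + 1) ∈ δ (ρ n) (w n)) ∧
      {n | ρ n ∈ F}.Infinite}

/-- `Ω` is an ω-regular winning condition: given by a map `τ : V → α` into a finite
alphabet and an ω-regular language `L ⊆ α^ω`. -/
def OmegaRegularWC {V : Type} (Ω : Set (ℕ → V)) : Prop :=
  ∃ (α : Type) (_ : Finite α) (τ : V → α) (L : Set (ℕ → α)),
    IsOmegaRegular L ∧ Ω = {p | (fun n => τ (p n)) ∈ L}
/-- The measure of the cone of plays extending the partial play `l`: the product of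
`d (l i) (l (i+1))` over those `i` for which `l i` is a Nature vertex. -/
noncomputable def coneWeight {V : Type} (A : Arena V) (d : V → V → ENNReal) (dflt : V)
    (l : List V) : ENNReal :=
  ∏ i ∈ Finset.range (l.length - 1),
    if A.owner (l.getD i dflt) = Player.N then d (l.getD i dflt) (l.getD (i + 1) dflt)
    else 1
/-! Part 1: determinization into a parity automaton. -/
section Det
open Filter

def dval {α M : Type} (one : M) (op : M → α → M) (w : ℕ → α) (a : ℕ) : ℕ → M
  | 0 => one
  | b + 1 => if b < a then one else op (dval one op w a b) (w b)

theorem dval_le {α M : Type} (one : M) (op : M → α → M) (w : ℕ → α) (a b : ℕ) (h : b ≤ a) :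
    dval one op w a b = one := by
  cases b with
  | zero => rfl
  | succ b => simp [dval]; omega

theorem dval_succ {α M : Type} (one : M) (op : M → α → M) (w : ℕ → α) (a b : ℕ) (h : a ≤ b) :
    dval one op w a (b + 1) = op (dval one op w a b) (w b) := by
  simp [dval]; omega

theorem dval_congr {α M : Type} (one : M) (op : M → α → M) (w : ℕ → α) (a m k c : ℕ)
    (ha : a ≤ k) (hm : m ≤ k) (hk : k ≤ c) (h : dval one op w a k = dval one op w m k) :
    dval one op w a c = dval one op w m c := by
  induction c, hk using Nat.le_induction with
  | base => exact h
  | succ c hc ih => rw [dval_succ _ _ _ _ _ (by omega), dval_succ _ _ _ _ _ (by omega), ih]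

def DAcc {α M : Type} (one : M) (op : M → α → M) (L : Set (ℕ → α)) (s e : M) : Prop :=
  ∃ w ∈ L, ∃ m : ℕ → ℕ, StrictMono m ∧ dval one op w 0 (m 0) = s ∧
    ∀ i, dval one op w (m i) (m (i + 1)) = e

def skp (j i : ℕ) : ℕ := if i < j then i else i + 1

def extE {α M : Type} (one : M) (op : M → α → M) (x : ℕ × (ℕ → ℕ → M)) (a : α) (i j : ℕ) : M :=
  if x.1 < i then one else if j ≤ x.1 then x.2 i j else op (x.2 i x.1) a

def IsDup {α M : Type} (one : M) (op : M → α → M) (x : ℕ × (ℕ → ℕ → M)) (a : α) (ij : ℕ × ℕ) :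
    Prop :=
  ij.1 < ij.2 ∧ ij.2 ≤ x.1 ∧ extE one op x a ij.1 (x.1 + 1) = extE one op x a ij.2 (x.1 + 1)

open Classical in
noncomputable def dpick {α M : Type} (one : M) (op : M → α → M) (x : ℕ × (ℕ → ℕ → M)) (a : α) :
    ℕ × ℕ :=
  if h : ∃ ij, IsDup one op x a ij then h.choose else (0, x.1 + 2)

open Classical in
noncomputable def dupd {α M : Type} (one : M) (op : M → α → M) (x : ℕ × (ℕ → ℕ → M)) (a : α) :
    ℕ × (ℕ → ℕ → M) :=
  (if ∃ ij, IsDup one op x a ij then x.1 else x.1 + 1,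
   fun i j => extE one op x a (skp (dpick one op x a).2 i) (skp (dpick one op x a).2 j))

open Classical in
noncomputable def dcol {α M : Type} (one : M) (op : M → α → M) (L : Set (ℕ → α))
    (x : ℕ × (ℕ → ℕ → M)) (a : α) : ℕ :=
  if ∃ ij, IsDup one op x a ij then
    2 * (dpick one op x a).1 +
      (if DAcc one op L (extE one op x a 0 (dpick one op x a).1)
        (extE one op x a (dpick one op x a).1 (dpick one op x a).2) then 0 else 1)
  else 2 * Nat.card M + 2

theorem dpick_spec {α M : Type} (one : M) (op : M → α → M) (x : ℕ × (ℕ → ℕ → M)) (a : α)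
    (h : ∃ ij, IsDup one op x a ij) : IsDup one op x a (dpick one op x a) := by
  rw [dpick, dif_pos h]; exact h.choose_spec

theorem dpick_neg {α M : Type} (one : M) (op : M → α → M) (x : ℕ × (ℕ → ℕ → M)) (a : α)
    (h : ¬ ∃ ij, IsDup one op x a ij) : dpick one op x a = (0, x.1 + 2) := by
  rw [dpick, dif_neg h]

theorem dpick_bd {α M : Type} (one : M) (op : M → α → M) (x : ℕ × (ℕ → ℕ → M)) (a : α) :
    0 < (dpick one op x a).2 := by
  by_cases h : ∃ ij, IsDup one op x a ij
  · have := dpick_spec one op x a h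
    obtain ⟨h1, h2, -⟩ := this
    omega
  · rw [dpick_neg _ _ _ _ h]; simp

def DSet (M : Type) : Set (ℕ × (ℕ → ℕ → M)) :=
  {x | x.1 ≤ Nat.card M ∧ ∀ i j, x.2 i j = x.2 (min i x.1) (min j x.1)}

theorem DSet_finite (M : Type) [Finite M] : (DSet M).Finite := by
  let N := Nat.card M
  let f : ℕ × (ℕ → ℕ → M) → Fin (N + 1) × (Fin (N + 1) → Fin (N + 1) → M) :=
    fun x => (⟨min x.1 N, by omega⟩, fun i j => x.2 i.1 j.1)
  apply Set.Finite.of_finite_image (f := f) (Set.toFinite _)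
  rintro ⟨l, E⟩ ⟨h1, h2⟩ ⟨l', E'⟩ ⟨h1', h2'⟩ h
  simp only [f, Prod.mk.injEq, Fin.mk.injEq] at h h1 h2 h1' h2'
  obtain ⟨h3, h4⟩ := h
  have hl : l = l' := by omega
  subst hl
  congr 1
  funext i j
  rw [h2, h2']
  exact congrFun (congrFun h4 ⟨min i l, by omega⟩) ⟨min j l, by omega⟩

theorem dupd_fst {α M : Type} (one : M) (op : M → α → M) (x : ℕ × (ℕ → ℕ → M)) (a : α) :
    ((dupd one op x a).1 = x.1 ∧ (dpick one op x a).2 ≤ x.1) ∨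
    ((dupd one op x a).1 = x.1 + 1 ∧ (dpick one op x a).2 = x.1 + 2 ∧
      ¬ ∃ ij, IsDup one op x a ij) := by
  by_cases h : ∃ ij, IsDup one op x a ij
  · left; simp only [dupd]; rw [if_pos h]; exact ⟨rfl, (dpick_spec one op x a h).2.1⟩
  · right; simp only [dupd]; rw [if_neg h, dpick_neg _ _ _ _ h]; exact ⟨rfl, rfl, h⟩

theorem extE_min {α M : Type} (one : M) (op : M → α → M) (x : ℕ × (ℕ → ℕ → M)) (a : α)
    (i j i' j' : ℕ) (hi : min i (x.1 + 1) = min i' (x.1 + 1))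
    (hj : min j (x.1 + 1) = min j' (x.1 + 1)) :
    extE one op x a i j = extE one op x a i' j' := by
  unfold extE
  by_cases h1 : x.1 < i
  · rw [if_pos h1, if_pos (by omega)]
  · have : i = i' := by omega
    subst this
    rw [if_neg h1, if_neg h1]
    by_cases h2 : j ≤ x.1
    · have : j = j' := by omega
      subst this; rfl
    · rw [if_neg h2, if_neg (by omega)]

theorem dupd_mem {α M : Type} [Finite M] (one : M) (op : M → α → M) (x : ℕ × (ℕ → ℕ → M)) (a : α)
    (hx : x ∈ DSet M) : dupd one op x a ∈ DSet M := by
  constructor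
  · rcases dupd_fst one op x a with h | ⟨h, hn⟩
    · rw [h.1]; exact hx.1
    · rw [h]
      have hn := hn.2
      have : Function.Injective (fun i : Fin (x.1 + 1) => extE one op x a i (x.1 + 1)) := by
        intro i j hij
        by_contra hne
        rcases lt_or_gt_of_ne hne with h1 | h1
        · exact hn ⟨(i, j), h1, by simp; omega, hij⟩
        · exact hn ⟨(j, i), h1, by simp; omega, hij.symm⟩
      simpa using Nat.card_le_card_of_injective _ this
  · intro i j
    have hb := dpick_bd one op x a
    have hf := dupd_fst one op x a
    have key : ∀ i, min (skp (dpick one op x a).2 i) (x.1 + 1) =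
        min (skp (dpick one op x a).2 (min i (dupd one op x a).1)) (x.1 + 1) := by
      intro i
      rcases hf with ⟨h, hn⟩ | ⟨h, hn, -⟩
      · rw [h]
        simp only [skp]
        split_ifs <;> omega
      · rw [h, hn]
        simp only [skp]
        split_ifs <;> omega
    exact extE_min _ _ _ _ _ _ _ _ (key i) (key j)

noncomputable def drun {α M : Type} (one : M) (op : M → α → M) (w : ℕ → α) :
    ℕ → ℕ × (ℕ → ℕ → M)
  | 0 => (0, fun _ _ => one)
  | k + 1 => dupd one op (drun one op w k) (w k)

noncomputable def dg1 (l : ℕ) (n : ℕ → ℕ) (k : ℕ) (i : ℕ) : ℕ := if i ≤ l then n i else k + 1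

noncomputable def dgh {α M : Type} (one : M) (op : M → α → M) (w : ℕ → α) : ℕ → ℕ → ℕ
  | 0 => fun _ => 0
  | k + 1 => fun i => dg1 (drun one op w k).1 (dgh one op w k) k
      (skp (dpick one op (drun one op w k) (w k)).2 i)

structure DRep {α M : Type} (one : M) (op : M → α → M) (w : ℕ → α) (k : ℕ)
    (x : ℕ × (ℕ → ℕ → M)) (n : ℕ → ℕ) : Prop where
  mono : ∀ i j, i < j → j ≤ x.1 → n i < n j
  top : ∀ i, x.1 ≤ i → n i = k
  val : ∀ i j, x.2 i j = dval one op w (n i) (n j)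
  zero : n 0 = 0

theorem DRep.le {α M : Type} {one : M} {op : M → α → M} {w : ℕ → α} {k : ℕ}
    {x : ℕ × (ℕ → ℕ → M)} {n : ℕ → ℕ} (h : DRep one op w k x n) (i : ℕ) : n i ≤ k := by
  rcases lt_or_ge i x.1 with h1 | h1
  · have := h.mono i x.1 h1 le_rfl
    rw [h.top x.1 le_rfl] at this
    omega
  · rw [h.top i h1]

theorem DRep.ext {α M : Type} {one : M} {op : M → α → M} {w : ℕ → α} {k : ℕ}
    {x : ℕ × (ℕ → ℕ → M)} {n : ℕ → ℕ} (h : DRep one op w k x n) (i j : ℕ) :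
    extE one op x (w k) i j = dval one op w (dg1 x.1 n k i) (dg1 x.1 n k j) := by
  have hle := h.le
  unfold extE dg1
  by_cases h1 : x.1 < i
  · rw [if_pos h1, if_neg (show ¬ i ≤ x.1 by omega), dval_le]
    split_ifs
    · have := hle j; omega
    · omega
  · have h1' : i ≤ x.1 := by omega
    rw [if_neg h1, if_pos h1']
    by_cases h2 : j ≤ x.1
    · rw [if_pos h2, if_pos h2, h.val]
    · rw [if_neg h2, if_neg h2, dval_succ _ _ _ _ _ (hle i), h.val, h.top x.1 le_rfl]

theorem dg1_mono {α M : Type} {one : M} {op : M → α → M} {w : ℕ → α} {k : ℕ}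
    {x : ℕ × (ℕ → ℕ → M)} {n : ℕ → ℕ} (h : DRep one op w k x n) (i j : ℕ) (hij : i < j)
    (hj : j ≤ x.1 + 1) : dg1 x.1 n k i < dg1 x.1 n k j := by
  have hle := h.le i
  unfold dg1
  rw [if_pos (by omega)]
  split_ifs with h2
  · exact h.mono i j hij h2
  · omega

theorem drep {α M : Type} (one : M) (op : M → α → M) (w : ℕ → α) (k : ℕ) :
    DRep one op w k (drun one op w k) (dgh one op w k) := by
  induction k with
  | zero =>
    refine ⟨?_, ?_, ?_, rfl⟩
    · intro i j h1 h2; simp [drun] at h2; omega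
    · intro i _; rfl
    · intro i j; rfl
  | succ k ih =>
    have hb := dpick_bd one op (drun one op w k) (w k)
    have hf := dupd_fst one op (drun one op w k) (w k)
    refine ⟨?_, ?_, ?_, ?_⟩
    · intro i j h1 h2
      have h2' : j ≤ (dupd one op (drun one op w k) (w k)).1 := h2
      apply dg1_mono ih
      · unfold skp; split_ifs <;> omega
      · rcases hf with h | ⟨h, hn, -⟩
        · unfold skp; split_ifs <;> omega
        · unfold skp; split_ifs <;> omega
    · intro i h1
      have h1' : (dupd one op (drun one op w k) (w k)).1 ≤ i := h1
      change dg1 _ _ _ _ = _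
      unfold dg1
      rw [if_neg]
      unfold skp
      rcases hf with h | ⟨h, hn⟩ <;> split_ifs <;> omega
    · intro i j
      exact ih.ext _ _
    · change dg1 _ _ _ _ = _
      have : skp (dpick one op (drun one op w k) (w k)).2 0 = 0 := by
        unfold skp; rw [if_pos hb]
      rw [this, dg1, if_pos (Nat.zero_le _)]
      exact ih.zero

theorem drun_mem {α M : Type} [Finite M] (one : M) (op : M → α → M) (w : ℕ → α) (k : ℕ) :
    drun one op w k ∈ DSet M := by
  induction k with
  | zero => exact ⟨Nat.zero_le _, fun _ _ => rfl⟩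
  | succ k ih => exact dupd_mem one op _ _ ih

/-- token positions only shrink -/
theorem dgh_tok {α M : Type} (one : M) (op : M → α → M) (w : ℕ → α) (k k' m : ℕ) (hk : k ≤ k')
    (hm : m < k) (hn : ∀ i, dgh one op w k i ≠ m) : ∀ i, dgh one op w k' i ≠ m := by
  induction k', hk using Nat.le_induction with
  | base => exact hn
  | succ k' hk ih =>
    intro i
    change dg1 _ _ _ _ ≠ _
    unfold dg1
    split_ifs
    · exact ih _
    · omega

theorem dgh_removed {α M : Type} (one : M) (op : M → α → M) (w : ℕ → α) (k : ℕ)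
    (h : ∃ ij, IsDup one op (drun one op w k) (w k) ij) (i : ℕ) :
    dgh one op w (k + 1) i ≠ dgh one op w k (dpick one op (drun one op w k) (w k)).2 := by
  have hr := drep one op w k
  obtain ⟨h1, h2, -⟩ := dpick_spec one op _ _ h
  have hle := hr.le
  change dg1 _ _ _ _ ≠ _
  set j := (dpick one op (drun one op w k) (w k)).2
  unfold dg1
  split_ifs with h3
  · have : skp j i ≠ j := by unfold skp; split_ifs <;> omega
    rcases lt_or_gt_of_ne this with h4 | h4
    · have := hr.mono _ _ h4 h2; omega
    · have := hr.mono _ _ h4 h3; omega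
  · have := hle j; omega

theorem exists_chain (P : ℕ → ℕ → Prop) (h : ∀ B, ∃ m k, B < m ∧ m ≤ k ∧ P m k) (B : ℕ) :
    ∃ m k : ℕ → ℕ, B < m 0 ∧ (∀ i, k i < m (i + 1)) ∧ ∀ i, m i ≤ k i ∧ P (m i) (k i) := by
  choose f g h1 h2 h3 using h
  let r : ℕ → ℕ × ℕ := fun i => Nat.rec (f B, g B) (fun _ x => (f x.2, g x.2)) i
  refine ⟨fun i => (r i).1, fun i => (r i).2, h1 B, fun i => h1 _, fun i => ?_⟩
  cases i with
  | zero => exact ⟨h2 _, h3 _⟩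
  | succ i => exact ⟨h2 _, h3 _⟩

theorem det_core {α M : Type} [Finite M] (one : M) (op : M → α → M) (L : Set (ℕ → α))
    (sat : ∀ w w' : ℕ → α, ∀ m m' : ℕ → ℕ, StrictMono m → StrictMono m' →
      dval one op w 0 (m 0) = dval one op w' 0 (m' 0) →
      (∀ i, dval one op w (m i) (m (i + 1)) = dval one op w' (m' i) (m' (i + 1))) →
      w ∈ L → w' ∈ L) (w : ℕ → α) (n : ℕ)
    (h1 : ∃ᶠ k in atTop, dcol one op L (drun one op w k) (w k) = n)
    (h2 : ∀ᶠ k in atTop, n ≤ dcol one op L (drun one op w k) (w k)) : w ∈ L ↔ Even n := by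
  -- duplicates occur infinitely often
  have hinf : ∀ K, ∃ k ≥ K, ∃ ij, IsDup one op (drun one op w k) (w k) ij := by
    intro K
    by_contra hcon
    push Not at hcon
    have : ∀ t, (drun one op w (K + t)).1 = (drun one op w K).1 + t := by
      intro t
      induction t with
      | zero => rfl
      | succ t ih =>
        rcases dupd_fst one op (drun one op w (K + t)) (w (K + t)) with h | h
        · exfalso
          simp only [dupd] at h
          rw [if_neg (by push Not; exact hcon (K + t) (by omega))] at h
          omega
        · change (dupd one op (drun one op w (K + t)) (w (K + t))).1 = _
          omega
    have h3 := (drun_mem one op w (K + (Nat.card M + 1))).1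
    rw [this] at h3
    omega
  rw [eventually_atTop] at h2
  obtain ⟨K0, hK0⟩ := h2
  rw [frequently_atTop] at h1
  have hcolb : ∀ k, (∃ ij, IsDup one op (drun one op w k) (w k) ij) →
      dcol one op L (drun one op w k) (w k) < 2 * Nat.card M + 2 := by
    intro k hk
    unfold dcol
    rw [if_pos hk]
    obtain ⟨h3, h4, -⟩ := dpick_spec one op _ _ hk
    have := (drun_mem one op w k).1
    split_ifs <;> omega
  have hnb : n < 2 * Nat.card M + 2 := by
    obtain ⟨k, hk, hd⟩ := hinf K0
    exact lt_of_le_of_lt (hK0 k hk) (hcolb k hd)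
  have hev : ∀ K, ∃ k ≥ K, (∃ ij, IsDup one op (drun one op w k) (w k) ij) ∧
      dcol one op L (drun one op w k) (w k) = n := by
    intro K
    obtain ⟨k, hk, hd⟩ := h1 K
    refine ⟨k, hk, ?_, hd⟩
    by_contra hcon
    rw [dcol, if_neg hcon] at hd
    omega
  set I := n / 2 with hI
  have hpI : ∀ k ≥ K0, (∃ ij, IsDup one op (drun one op w k) (w k) ij) →
      I ≤ (dpick one op (drun one op w k) (w k)).1 := by
    intro k hk hd
    have := hK0 k hk
    rw [dcol, if_pos hd] at this
    split_ifs at this <;> omega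
  have hpI' : ∀ k, (∃ ij, IsDup one op (drun one op w k) (w k) ij) →
      dcol one op L (drun one op w k) (w k) = n →
      (dpick one op (drun one op w k) (w k)).1 = I ∧
      (DAcc one op L (extE one op (drun one op w k) (w k) 0 I)
        (extE one op (drun one op w k) (w k) I (dpick one op (drun one op w k) (w k)).2) ↔
        Even n) := by
    intro k hk hd
    rw [dcol, if_pos hk] at hd
    have h3 : (dpick one op (drun one op w k) (w k)).1 = I := by
      split_ifs at hd <;> omega
    refine ⟨h3, ?_⟩
    rw [h3] at hd
    split_ifs at hd with h4
    · simp only [h4, true_iff]; exact ⟨I, by omega⟩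
    · simp only [h4, false_iff, Nat.not_even_iff_odd]; exact ⟨I, by omega⟩
  -- first event
  obtain ⟨K1, hK1, hd1, hc1⟩ := hev K0
  have hl1 : I < (drun one op w K1).1 := by
    obtain ⟨h3, h4, -⟩ := dpick_spec one op _ _ hd1
    have := (hpI' K1 hd1 hc1).1
    omega
  have hstab : ∀ k, K1 ≤ k → I < (drun one op w k).1 ∧ dgh one op w k I = dgh one op w K1 I := by
    intro k hk
    induction k, hk using Nat.le_induction with
    | base => exact ⟨hl1, rfl⟩
    | succ k hk ih =>
      obtain ⟨ih1, ih2⟩ := ih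
      constructor
      · change I < (dupd one op (drun one op w k) (w k)).1
        rcases dupd_fst one op (drun one op w k) (w k) with h | h <;> omega
      · change dg1 _ _ _ _ = _
        have : skp (dpick one op (drun one op w k) (w k)).2 I = I := by
          unfold skp
          rw [if_pos]
          by_cases hd : ∃ ij, IsDup one op (drun one op w k) (w k) ij
          · have := hpI k (by omega) hd
            have := (dpick_spec one op _ _ hd).1
            omega
          · rw [dpick_neg _ _ _ _ hd]; simp; omega
        rw [this, dg1, if_pos (by omega), ih2]
  set a := dgh one op w K1 I with ha
  -- events
  let Ev : Set ℕ := {k | K1 ≤ k ∧ (∃ ij, IsDup one op (drun one op w k) (w k) ij) ∧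
      dcol one op L (drun one op w k) (w k) = n}
  let mm : ℕ → ℕ := fun k => dgh one op w k (dpick one op (drun one op w k) (w k)).2
  have hEvinf : Ev.Infinite := by
    rw [Set.infinite_iff_exists_gt]
    intro K
    obtain ⟨k, hk, hh⟩ := hev (max (K + 1) K1)
    exact ⟨k, ⟨by omega, hh⟩, by omega⟩
  have hmm : ∀ k ∈ Ev, a < mm k ∧ mm k ≤ k ∧ dval one op w a (k + 1) = dval one op w (mm k) (k + 1) ∧
      (DAcc one op L (dval one op w 0 a) (dval one op w a (mm k)) ↔ Even n) := by
    rintro k ⟨hk, hd, hc⟩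
    have hr := drep one op w k
    obtain ⟨h3, h4, h5⟩ := dpick_spec one op _ _ hd
    obtain ⟨h6, h7⟩ := hpI' k hd hc
    obtain ⟨h8, h9⟩ := hstab k hk
    rw [h6] at h3 h5
    rw [hr.ext, hr.ext] at h5 h7
    have e1 : dg1 (drun one op w k).1 (dgh one op w k) k I = a := by
      rw [dg1, if_pos (by omega), h9]
    have e2 : dg1 (drun one op w k).1 (dgh one op w k) k (dpick one op (drun one op w k) (w k)).2
        = mm k := by
      rw [dg1, if_pos (by omega)]
    have e3 : dg1 (drun one op w k).1 (dgh one op w k) k ((drun one op w k).1 + 1) = k + 1 := by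
      rw [dg1, if_neg (by omega)]
    have e4 : dg1 (drun one op w k).1 (dgh one op w k) k 0 = 0 := by
      rw [dg1, if_pos (by omega), hr.zero]
    rw [e1, e2, e3] at h5
    rw [e1, e2, e4] at h7
    refine ⟨?_, hr.le _, h5, h7⟩
    rw [← h9]
    exact hr.mono _ _ h3 h4
  have hinj : Set.InjOn mm Ev := by
    have key : ∀ k ∈ Ev, ∀ k' ∈ Ev, k < k' → mm k ≠ mm k' := by
      intro k hk k' hk' hlt heq
      have h3 := dgh_removed one op w k hk.2.1
      have h4 := dgh_tok one op w (k + 1) k' (mm k) hlt (by have := (hmm k hk).2.1; omega) h3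
      exact h4 _ heq.symm
    intro k hk k' hk' heq
    rcases lt_trichotomy k k' with h | h | h
    · exact absurd heq (key k hk k' hk' h)
    · exact h
    · exact absurd heq.symm (key k' hk' k hk h)
  obtain ⟨e, he⟩ : ∃ e, ({k ∈ Ev | dval one op w a (mm k) = e}).Infinite := by
    by_contra hcon
    push Not at hcon
    apply hEvinf
    apply (Set.finite_iUnion hcon).subset
    intro k hk
    exact Set.mem_iUnion.2 ⟨_, hk, rfl⟩
  have hch : ∀ B, ∃ m k, B < m ∧ m ≤ k ∧ (a < m ∧ dval one op w a (k + 1) = dval one op w m (k + 1) ∧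
      dval one op w a m = e) := by
    intro B
    have h3 : (mm '' {k ∈ Ev | dval one op w a (mm k) = e}).Infinite :=
      he.image (hinj.mono fun k hk => hk.1)
    obtain ⟨m, ⟨k, ⟨hk, hke⟩, rfl⟩, hm⟩ := h3.exists_gt B
    obtain ⟨h4, h5, h6, h7⟩ := hmm k hk
    exact ⟨mm k, k, hm, h5, h4, h6, hke⟩
  have hacc : DAcc one op L (dval one op w 0 a) e ↔ Even n := by
    obtain ⟨k, hk, hke⟩ := he.nonempty
    rw [← hke]
    exact (hmm k hk).2.2.2
  obtain ⟨m, k, hm0, hmk, hP⟩ := exists_chain _ hch a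
  let m' : ℕ → ℕ := fun i => match i with
    | 0 => a
    | i + 1 => m i
  have hm' : StrictMono m' := by
    apply strictMono_nat_of_lt_succ
    intro i
    cases i with
    | zero => exact hm0
    | succ i => exact lt_of_le_of_lt (hP i).1 (hmk i)
  have hv : ∀ i, dval one op w (m' i) (m' (i + 1)) = e := by
    intro i
    cases i with
    | zero => exact (hP 0).2.2.2
    | succ i =>
      obtain ⟨h3, h4, h5, h6⟩ := hP i
      rw [← (hP (i + 1)).2.2.2]
      exact (dval_congr one op w a (m i) (k i + 1) (m (i + 1)) (by omega) (by omega) (hmk i) h5).symm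
  rw [← hacc]
  constructor
  · intro hw
    exact ⟨w, hw, m', hm', rfl, hv⟩
  · rintro ⟨w', hw', q, hq, hq0, hqe⟩
    exact sat w' w q m' hq hm' hq0 (fun i => by rw [hqe, hv]) hw'

theorem det_exists {α M : Type} [Finite M] (one : M) (op : M → α → M) (L : Set (ℕ → α))
    (sat : ∀ w w' : ℕ → α, ∀ m m' : ℕ → ℕ, StrictMono m → StrictMono m' →
      dval one op w 0 (m 0) = dval one op w' 0 (m' 0) →
      (∀ i, dval one op w (m i) (m (i + 1)) = dval one op w' (m' i) (m' (i + 1))) →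
      w ∈ L → w' ∈ L) :
    ∃ (D : Type) (_ : Finite D) (d0 : D) (upd : D → α → D) (c : D → α → ℕ),
      ∀ (w : ℕ → α) (r : ℕ → D), r 0 = d0 → (∀ k, r (k + 1) = upd (r k) (w k)) → ∀ n : ℕ,
        (∃ᶠ k in atTop, c (r k) (w k) = n) → (∀ᶠ k in atTop, n ≤ c (r k) (w k)) →
        (w ∈ L ↔ Even n) := by
  refine ⟨DSet M, (DSet_finite M).to_subtype, ⟨(0, fun _ _ => one), Nat.zero_le _, fun _ _ => rfl⟩,
    fun x a => ⟨dupd one op x.1 a, dupd_mem one op _ _ x.2⟩, fun x a => dcol one op L x.1 a, ?_⟩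
  intro w r hr0 hr n h1 h2
  have : ∀ k, (r k).1 = drun one op w k := by
    intro k
    induction k with
    | zero => rw [hr0]; rfl
    | succ k ih => rw [hr, drun, ← ih]
  simp only [this] at h1 h2
  exact det_core one op L sat w n h1 h2

end Det
/-! Part 2: Büchi automata satisfy the saturation property. -/
section Buchi
open Filter

def bop {α Q : Type} (δ : Q → α → Set Q) (F : Set Q)
    (m : (Q → Q → Prop) × (Q → Q → Prop)) (a : α) : (Q → Q → Prop) × (Q → Q → Prop) :=
  (fun p q => ∃ r, m.1 p r ∧ q ∈ δ r a,
   fun p q => ∃ r, q ∈ δ r a ∧ (m.2 p r ∨ (m.1 p r ∧ q ∈ F)))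

def bone {Q : Type} : (Q → Q → Prop) × (Q → Q → Prop) := (fun p q => p = q, fun _ _ => False)

theorem bval_fst {α Q : Type} (δ : Q → α → Set Q) (F : Set Q) (w : ℕ → α) (a b : ℕ) (hab : a ≤ b)
    (p q : Q) : (dval bone (bop δ F) w a b).1 p q ↔
      ∃ f : ℕ → Q, f a = p ∧ f b = q ∧ ∀ k, a ≤ k → k < b → f (k + 1) ∈ δ (f k) (w k) := by
  induction b, hab using Nat.le_induction generalizing q with
  | base =>
    rw [dval_le _ _ _ _ _ le_rfl]
    constructor
    · intro h; exact ⟨fun _ => p, rfl, h, fun k h1 h2 => by omega⟩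
    · rintro ⟨f, h1, h2, -⟩; exact h1.symm.trans h2
  | succ b hb ih =>
    rw [dval_succ _ _ _ _ _ hb]
    constructor
    · rintro ⟨r, h1, h2⟩
      obtain ⟨f, hf1, hf2, hf3⟩ := (ih r).1 h1
      refine ⟨fun k => if k ≤ b then f k else q, by simp [hb, hf1], by simp, ?_⟩
      intro k h3 h4
      rcases Nat.lt_succ_iff_lt_or_eq.1 h4 with h5 | rfl
      · simp only [if_pos (show k + 1 ≤ b by omega), if_pos (show k ≤ b by omega)]
        exact hf3 k h3 h5
      · simp only [if_neg (show ¬ k + 1 ≤ k by omega), if_pos (le_refl k)]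
        rw [hf2]; exact h2
    · rintro ⟨f, hf1, hf2, hf3⟩
      refine ⟨f b, (ih _).2 ⟨f, hf1, rfl, fun k h1 h2 => hf3 k h1 (by omega)⟩, ?_⟩
      rw [← hf2]; exact hf3 b hb (by omega)

theorem bval_snd {α Q : Type} (δ : Q → α → Set Q) (F : Set Q) (w : ℕ → α) (a b : ℕ) (hab : a ≤ b)
    (p q : Q) : (dval bone (bop δ F) w a b).2 p q ↔
      ∃ f : ℕ → Q, f a = p ∧ f b = q ∧ (∀ k, a ≤ k → k < b → f (k + 1) ∈ δ (f k) (w k)) ∧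
        ∃ k, a < k ∧ k ≤ b ∧ f k ∈ F := by
  induction b, hab using Nat.le_induction generalizing q with
  | base =>
    rw [dval_le _ _ _ _ _ le_rfl]
    constructor
    · intro h; exact h.elim
    · rintro ⟨f, h1, h2, -, k, h3, h4, -⟩; omega
  | succ b hb ih =>
    rw [dval_succ _ _ _ _ _ hb]
    constructor
    · rintro ⟨r, h1, h2⟩
      have key : ∀ f : ℕ → Q, f a = p → f b = r →
          (∀ k, a ≤ k → k < b → f (k + 1) ∈ δ (f k) (w k)) →
          ∀ k, a ≤ k → k < b + 1 → (fun k => if k ≤ b then f k else q) (k + 1) ∈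
            δ ((fun k => if k ≤ b then f k else q) k) (w k) := by
        intro f hf1 hf2 hf3 k h3 h4
        rcases Nat.lt_succ_iff_lt_or_eq.1 h4 with h5 | rfl
        · simp only [if_pos (show k + 1 ≤ b by omega), if_pos (show k ≤ b by omega)]
          exact hf3 k h3 h5
        · simp only [if_neg (show ¬ k + 1 ≤ k by omega), if_pos (le_refl k)]
          rw [hf2]; exact h1
      rcases h2 with h2 | ⟨h2, h2F⟩
      · obtain ⟨f, hf1, hf2, hf3, k, hk1, hk2, hk3⟩ := (ih r).1 h2
        refine ⟨fun k => if k ≤ b then f k else q, by simp [hb, hf1], by simp,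
          key f hf1 hf2 hf3, k, hk1, by omega, ?_⟩
        simp only [if_pos hk2]; exact hk3
      · obtain ⟨f, hf1, hf2, hf3⟩ := (bval_fst δ F w a b hb p r).1 h2
        refine ⟨fun k => if k ≤ b then f k else q, by simp [hb, hf1], by simp,
          key f hf1 hf2 hf3, b + 1, by omega, le_rfl, ?_⟩
        simpa using h2F
    · rintro ⟨f, hf1, hf2, hf3, k, hk1, hk2, hk3⟩
      refine ⟨f b, ?_, ?_⟩
      · rw [← hf2]; exact hf3 b hb (by omega)
      rcases Nat.le_succ_iff.1 hk2 with h5 | rfl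
      · exact Or.inl ((ih _).2 ⟨f, hf1, rfl, fun k h1 h2 => hf3 k h1 (by omega), k, hk1, h5, hk3⟩)
      · refine Or.inr ⟨(bval_fst δ F w a b hb _ _).2
          ⟨f, hf1, rfl, fun k h1 h2 => hf3 k h1 (by omega)⟩, ?_⟩
        rw [← hf2]; exact hk3

theorem glue {Q : Type} (m : ℕ → ℕ) (h0 : m 0 = 0) (hm : Monotone m) (hu : ∀ t, ∃ i, t < m i)
    (f : ℕ → ℕ → Q) (hf : ∀ i, f i (m (i + 1)) = f (i + 1) (m (i + 1))) :
    ∃ ρ : ℕ → Q, ∀ i t, m i ≤ t → t ≤ m (i + 1) → ρ t = f i t := by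
  have hex : ∀ t, ∃ i, m i ≤ t ∧ t ≤ m (i + 1) := by
    intro t
    classical
    have h := hu t
    have h1 := Nat.find_spec h
    have h2 : Nat.find h ≠ 0 := by
      intro h3; rw [h3, h0] at h1; omega
    obtain ⟨j, hj⟩ := Nat.exists_eq_succ_of_ne_zero h2
    refine ⟨j, ?_, ?_⟩
    · have := Nat.find_min h (m := j) (by omega)
      omega
    · rw [hj] at h1; exact h1.le
  choose ix h1 h2 using hex
  have key : ∀ i j t, i ≤ j → m j ≤ t → t ≤ m (i + 1) → m i ≤ t → f i t = f j t := by
    intro i j t hij h3 h4 h5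
    induction j, hij using Nat.le_induction with
    | base => rfl
    | succ j hj ih =>
      have h6 : m (i + 1) ≤ m (j + 1) := hm (by omega)
      have h7 : m j ≤ m (j + 1) := hm (by omega)
      have h8 : t = m (j + 1) := by omega
      rw [ih (by omega), h8, hf]
  refine ⟨fun t => f (ix t) t, fun i t h3 h4 => ?_⟩
  rcases le_total (ix t) i with h5 | h5
  · exact key _ _ _ h5 h3 (h2 t) (h1 t)
  · exact (key _ _ _ h5 (h1 t) h4 h3).symm

theorem buchi_sat {α Q : Type} (init : Set Q) (δ : Q → α → Set Q) (F : Set Q) (w w' : ℕ → α)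
    (m m' : ℕ → ℕ) (hm : StrictMono m) (hm' : StrictMono m')
    (h0 : dval bone (bop δ F) w 0 (m 0) = dval bone (bop δ F) w' 0 (m' 0))
    (hi : ∀ i, dval bone (bop δ F) w (m i) (m (i + 1)) = dval bone (bop δ F) w' (m' i) (m' (i + 1)))
    (hw : ∃ ρ : ℕ → Q, ρ 0 ∈ init ∧ (∀ n, ρ (n + 1) ∈ δ (ρ n) (w n)) ∧ {n | ρ n ∈ F}.Infinite) :
    ∃ ρ : ℕ → Q, ρ 0 ∈ init ∧ (∀ n, ρ (n + 1) ∈ δ (ρ n) (w' n)) ∧ {n | ρ n ∈ F}.Infinite := by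
  obtain ⟨ρ, hρ0, hρs, hρF⟩ := hw
  let M : ℕ → ℕ := fun i => match i with | 0 => 0 | i + 1 => m i
  let M' : ℕ → ℕ := fun i => match i with | 0 => 0 | i + 1 => m' i
  have hM : ∀ i, M i ≤ M (i + 1) := by
    intro i; cases i with
    | zero => exact Nat.zero_le _
    | succ i => exact (hm (Nat.lt_succ_self i)).le
  have hM' : ∀ i, M' i ≤ M' (i + 1) := by
    intro i; cases i with
    | zero => exact Nat.zero_le _
    | succ i => exact (hm' (Nat.lt_succ_self i)).le
  have hMu : ∀ t, ∃ i, t < M i := fun t => ⟨t + 2, lt_of_lt_of_le (Nat.lt_succ_self t) (hm.id_le (t + 1))⟩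
  have hMu' : ∀ t, ∃ i, t < M' i :=
    fun t => ⟨t + 2, lt_of_lt_of_le (Nat.lt_succ_self t) (hm'.id_le (t + 1))⟩
  have hv : ∀ i, dval bone (bop δ F) w (M i) (M (i + 1)) =
      dval bone (bop δ F) w' (M' i) (M' (i + 1)) := by
    intro i; cases i with
    | zero => exact h0
    | succ i => exact hi i
  have hp : ∀ i, ∃ f : ℕ → Q, f (M' i) = ρ (M i) ∧ f (M' (i + 1)) = ρ (M (i + 1)) ∧
      (∀ k, M' i ≤ k → k < M' (i + 1) → f (k + 1) ∈ δ (f k) (w' k)) ∧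
      ((∃ k, M i < k ∧ k ≤ M (i + 1) ∧ ρ k ∈ F) → ∃ k, M' i < k ∧ k ≤ M' (i + 1) ∧ f k ∈ F) := by
    intro i
    by_cases hF : ∃ k, M i < k ∧ k ≤ M (i + 1) ∧ ρ k ∈ F
    · have h1 := (bval_snd δ F w (M i) (M (i + 1)) (hM i) (ρ (M i)) (ρ (M (i + 1)))).2
        ⟨ρ, rfl, rfl, fun k _ _ => hρs k, hF⟩
      rw [hv i] at h1
      obtain ⟨f, hf1, hf2, hf3, hf4⟩ := (bval_snd δ F w' _ _ (hM' i) _ _).1 h1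
      exact ⟨f, hf1, hf2, hf3, fun _ => hf4⟩
    · have h1 := (bval_fst δ F w (M i) (M (i + 1)) (hM i) (ρ (M i)) (ρ (M (i + 1)))).2
        ⟨ρ, rfl, rfl, fun k _ _ => hρs k⟩
      rw [hv i] at h1
      obtain ⟨f, hf1, hf2, hf3⟩ := (bval_fst δ F w' _ _ (hM' i) _ _).1 h1
      exact ⟨f, hf1, hf2, hf3, fun h => absurd h hF⟩
  choose f hf1 hf2 hf3 hf4 using hp
  obtain ⟨σ, hσ⟩ := glue M' rfl (monotone_nat_of_le_succ hM') hMu' f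
    (fun i => (hf2 i).trans (hf1 (i + 1)).symm)
  refine ⟨σ, ?_, ?_, ?_⟩
  · rw [hσ 0 0 le_rfl (Nat.zero_le _)]
    have := hf1 0
    exact this ▸ hρ0
  · intro t
    obtain ⟨i, hi1, hi2⟩ : ∃ i, M' i ≤ t ∧ t < M' (i + 1) := by
      classical
      have h := hMu' t
      have h1 := Nat.find_spec h
      have h2 : Nat.find h ≠ 0 := by
        intro h3; rw [h3] at h1; exact absurd h1 (Nat.not_lt_zero _)
      obtain ⟨j, hj⟩ := Nat.exists_eq_succ_of_ne_zero h2
      refine ⟨j, ?_, ?_⟩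
      · have := Nat.find_min h (m := j) (by omega)
        omega
      · rw [hj] at h1; exact h1
    rw [hσ i t hi1 hi2.le, hσ i (t + 1) (by omega) hi2]
    exact hf3 i t hi1 hi2
  · rw [Set.infinite_iff_exists_gt]
    intro B
    obtain ⟨i0, hi0⟩ := hMu' B
    obtain ⟨k, hk, hkB⟩ := hρF.exists_gt (M i0)
    obtain ⟨i, hi1, hi2⟩ : ∃ i, M i < k ∧ k ≤ M (i + 1) := by
      classical
      have h : ∃ i, k ≤ M i := (hMu k).imp fun _ h => h.le
      have h1 := Nat.find_spec h
      have h2 : Nat.find h ≠ 0 := by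
        intro h3; rw [h3] at h1
        have : k ≤ 0 := h1
        omega
      obtain ⟨j, hj⟩ := Nat.exists_eq_succ_of_ne_zero h2
      refine ⟨j, ?_, ?_⟩
      · have := Nat.find_min h (m := j) (by omega)
        omega
      · rw [hj] at h1; exact h1
    have hii : i0 ≤ i := by
      by_contra hlt
      have : M (i + 1) ≤ M i0 := monotone_nat_of_le_succ hM (show i + 1 ≤ i0 by omega)
      omega
    obtain ⟨k', hk1, hk2, hk3⟩ := hf4 i ⟨k, hi1, hi2, hk⟩
    refine ⟨k', ?_, ?_⟩
    · change σ k' ∈ F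
      rw [hσ i k' hk1.le hk2]; exact hk3
    · have : M' i0 ≤ M' i := monotone_nat_of_le_succ hM' hii
      omega

theorem wc_det {V : Type} (Ω : Set (ℕ → V)) (h : OmegaRegularWC Ω) :
    ∃ (D : Type) (_ : Finite D) (d0 : D) (upd : D → V → D) (c : D → V → ℕ),
      ∀ (w : ℕ → V) (r : ℕ → D), r 0 = d0 → (∀ k, r (k + 1) = upd (r k) (w k)) → ∀ n : ℕ,
        (∃ᶠ k in atTop, c (r k) (w k) = n) → (∀ᶠ k in atTop, n ≤ c (r k) (w k)) →
        (w ∈ Ω ↔ Even n) := by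
  obtain ⟨α, _, τ, L, ⟨Q, hQ, init, δ, F, rfl⟩, rfl⟩ := h
  obtain ⟨D, hD, d0, upd, c, H⟩ := det_exists bone (bop δ F) _
    (fun w w' m m' hm hm' h0 hi => buchi_sat init δ F w w' m m' hm hm' h0 hi)
  exact ⟨D, hD, d0, fun d v => upd d (τ v), fun d v => c d (τ v),
    fun w r h0 hr n => H (fun k => τ (w k)) r h0 hr n⟩

end Buchi

open Filter in
/-- Abstract frame: a set of branches with a null ideal and a quantitative notion
of not being full below a node. -/
structure Ctx {V : Type} (A : Arena V) where
  O : Set (ℕ → V)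
  edge : ∀ p ∈ O, ∀ k, A.Edge (p k) (p (k + 1))
  branch : ∀ p ∈ O, ∀ k, A.owner (p k) = Player.N → ∀ w, A.Edge (p k) w →
    ∃ q ∈ O, (∀ j ≤ k, q j = p j) ∧ q (k + 1) = w
  Null : Set (ℕ → V) → Prop
  NF : ℕ → Set (ℕ → V) → (ℕ → V) → ℕ → Prop
  null_mono : ∀ B B' : Set (ℕ → V), B ⊆ B' → Null B' → Null B
  null_iUnion : ∀ f : ℕ → Set (ℕ → V), (∀ i, Null (f i)) → Null (⋃ i, f i)
  density : ∀ n B, (∀ p ∈ B, p ∈ O ∧ ∃ᶠ k in atTop, NF n B p k) → Null B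
  nf_mono : ∀ n m B B' p k, p ∈ O → (∀ q ∈ O, (∀ j ≤ k, q j = p j) → q ∈ B → q ∈ B') → n ≤ m →
    NF n B' p k → NF m B p k
  nf_empty : ∀ B p k, p ∈ O → (∀ q ∈ O, (∀ j ≤ k, q j = p j) → q ∉ B) → NF 0 B p k
  nf_step : ∀ n B p q k, p ∈ O → q ∈ O → (∀ j ≤ k, q j = p j) → NF n B q (k + 1) →
    NF (n + 1) B p k
  nf_trans : ∀ n m B B1 p k, p ∈ O → NF n B1 p k →
    (∀ q ∈ O, (∀ j ≤ k, q j = p j) → q ∈ B → q ∉ B1 → ∃ k' ≥ k, NF m B q k') →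
    NF (n + m) B p k
  nf_null : ∀ B p k, p ∈ O → Null B → NF 0 B p k

def stOf {V S : Type} (s0 : V → S) (nxt : S → V → S) (p : ℕ → V) : ℕ → S
  | 0 => s0 (p 0)
  | k + 1 => nxt (stOf s0 nxt p k) (p (k + 1))

open Filter in
structure PGame (V S : Type) where
  A : Arena V
  s0 : V → S
  nxt : S → V → S
  lab : S → V
  lab_s0 : ∀ v, lab (s0 v) = v
  lab_nxt : ∀ s w, lab (nxt s w) = w
  col : S → ℕ
  Om : Set (ℕ → V)
  par : ∀ p n, (∃ᶠ k in atTop, col (stOf s0 nxt p k) = n) →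
    (∀ᶠ k in atTop, n ≤ col (stOf s0 nxt p k)) → (p ∈ Om ↔ Even n)

namespace PGame
open Filter

variable {V S : Type} (G : PGame V S)

def st (p : ℕ → V) (k : ℕ) : S := stOf G.s0 G.nxt p k

theorem st_succ (p : ℕ → V) (k : ℕ) : G.st p (k + 1) = G.nxt (G.st p k) (p (k + 1)) := rfl

theorem lab_st (p : ℕ → V) (k : ℕ) : G.lab (G.st p k) = p k := by
  cases k with
  | zero => exact G.lab_s0 _
  | succ k => exact G.lab_nxt _ _

theorem st_congr {p q : ℕ → V} {k : ℕ} (h : ∀ j ≤ k, q j = p j) : G.st q k = G.st p k := by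
  induction k with
  | zero => simp [st, stOf, h 0 le_rfl]
  | succ k ih => rw [st_succ, st_succ, ih (fun j hj => h j (by omega)), h (k + 1) le_rfl]

def ow (s : S) : Player := G.A.owner (G.lab s)
def Ed (s : S) (w : V) : Prop := G.A.Edge (G.lab s) w

def Sub (R : Set S) : Prop := ∀ s ∈ R, (G.ow s ≠ Player.N → ∃ w, G.Ed s w ∧ G.nxt s w ∈ R) ∧
  (G.ow s = Player.N → ∀ w, G.Ed s w → G.nxt s w ∈ R)

structure IsAttr (P : Player) (R D X : Set S) (rk : S → ℕ) (K : ℕ) (σ : S → V) : Prop where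
  dx : D ⊆ X
  xr : X ⊆ R
  bd : ∀ s, rk s ≤ K
  own : ∀ s ∈ X, s ∉ D → G.ow s = P →
    G.Ed s (σ s) ∧ G.nxt s (σ s) ∈ X ∧ rk (G.nxt s (σ s)) < rk s
  nat : ∀ s ∈ X, s ∉ D → G.ow s = Player.N →
    ∃ w, G.Ed s w ∧ G.nxt s w ∈ X ∧ rk (G.nxt s w) < rk s
  opp : ∀ s ∈ X, s ∉ D → G.ow s ≠ P → G.ow s ≠ Player.N →
    ∀ w, G.Ed s w → G.nxt s w ∈ R → G.nxt s w ∈ X ∧ rk (G.nxt s w) < rk s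
  out1 : ∀ s ∈ R, s ∉ X → (G.ow s = P ∨ G.ow s = Player.N) → ∀ w, G.Ed s w → G.nxt s w ∉ X
  out2 : ∀ s ∈ R, s ∉ X → G.ow s ≠ P → G.ow s ≠ Player.N →
    ∃ w, G.Ed s w ∧ G.nxt s w ∈ R ∧ G.nxt s w ∉ X

def att (P : Player) (R D : Set S) : ℕ → Set S
  | 0 => D
  | n + 1 => att P R D n ∪ {s | s ∈ R ∧
      (((G.ow s = P ∨ G.ow s = Player.N) ∧ ∃ w, G.Ed s w ∧ G.nxt s w ∈ att P R D n) ∨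
      (G.ow s ≠ P ∧ G.ow s ≠ Player.N ∧ ∀ w, G.Ed s w → G.nxt s w ∈ R → G.nxt s w ∈ att P R D n))}

theorem att_mono (P : Player) (R D : Set S) {m n : ℕ} (h : m ≤ n) :
    G.att P R D m ⊆ G.att P R D n :=
  monotone_nat_of_le_succ (f := G.att P R D) (fun n => by
    intro s hs; exact Or.inl hs) h

theorem attr_ex [Finite S] [Nonempty V] (P : Player) (R D : Set S) (hD : D ⊆ R) :
    ∃ X rk K σ, G.IsAttr P R D X rk K σ := by
  classical
  let X : Set S := {s | ∃ n, s ∈ G.att P R D n}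
  let rk : S → ℕ := fun s => if h : ∃ n, s ∈ G.att P R D n then Nat.find h else 0
  have hrk : ∀ s ∈ X, s ∈ G.att P R D (rk s) := by
    intro s hs
    have hs' : ∃ n, s ∈ G.att P R D n := hs
    simp only [rk, dif_pos hs']
    exact Nat.find_spec hs'
  have hrk2 : ∀ s n, s ∈ G.att P R D n → rk s ≤ n := by
    intro s n hn
    have hs' : ∃ n, s ∈ G.att P R D n := ⟨n, hn⟩
    simp only [rk, dif_pos hs']
    exact Nat.find_min' hs' hn
  obtain ⟨K, hK⟩ : ∃ K, ∀ s, rk s ≤ K := by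
    obtain ⟨K, hK⟩ := (Set.finite_range rk).bddAbove
    exact ⟨K, fun s => hK ⟨s, rfl⟩⟩
  have key : ∀ s ∈ X, s ∉ D → (((G.ow s = P ∨ G.ow s = Player.N) ∧
      ∃ w, G.Ed s w ∧ G.nxt s w ∈ X ∧ rk (G.nxt s w) < rk s) ∨
      (G.ow s ≠ P ∧ G.ow s ≠ Player.N ∧ ∀ w, G.Ed s w → G.nxt s w ∈ R →
        G.nxt s w ∈ X ∧ rk (G.nxt s w) < rk s)) := by
    intro s hs hsD
    have h1 := hrk s hs
    rcases hr : rk s with _ | m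
    · rw [hr] at h1; exact absurd h1 hsD
    · rw [hr] at h1
      rcases h1 with h1 | ⟨_, ⟨ho, w, hw, hw2⟩ | ⟨ho, ho2, hall⟩⟩
      · have := hrk2 s m h1; omega
      · exact Or.inl ⟨ho, w, hw, ⟨m, hw2⟩, Nat.lt_succ_of_le (hrk2 _ _ hw2)⟩
      · exact Or.inr ⟨ho, ho2, fun w hw hwR =>
          ⟨⟨m, hall w hw hwR⟩, Nat.lt_succ_of_le (hrk2 _ _ (hall w hw hwR))⟩⟩
  let σ : S → V := fun s => if h : ∃ w, G.Ed s w ∧ G.nxt s w ∈ X ∧ rk (G.nxt s w) < rk s then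
    h.choose else Classical.arbitrary V
  refine ⟨X, rk, K, σ, ?_⟩
  constructor
  · intro s hs; exact ⟨0, hs⟩
  · rintro s ⟨n, hn⟩
    induction n with
    | zero => exact hD hn
    | succ n ih =>
      rcases hn with hn | hn
      · exact ih hn
      · exact hn.1
  · exact hK
  · intro s hs hsD ho
    rcases key s hs hsD with ⟨_, h⟩ | ⟨h, _⟩
    · simp only [σ, dif_pos h]; exact h.choose_spec
    · exact absurd ho h
  · intro s hs hsD ho
    rcases key s hs hsD with ⟨_, h⟩ | ⟨_, h, _⟩
    · exact h
    · exact absurd ho h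
  · intro s hs hsD ho ho2
    rcases key s hs hsD with ⟨h, _⟩ | ⟨_, _, h⟩
    · tauto
    · exact h
  · rintro s hs hsX ho w hw ⟨n, hn⟩
    exact hsX ⟨n + 1, Or.inr ⟨hs, Or.inl ⟨ho, w, hw, hn⟩⟩⟩
  · intro s hs hsX ho ho2
    by_contra hcon
    push Not at hcon
    refine hsX ⟨K + 1, Or.inr ⟨hs, Or.inr ⟨ho, ho2, fun w hw hwR => ?_⟩⟩⟩
    exact G.att_mono P R D (hK _) (hrk _ (hcon w hw hwR))

variable {G}

theorem IsAttr.sub {P : Player} {R D X : Set S} {rk : S → ℕ} {K : ℕ} {σ : S → V}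
    (h : G.IsAttr P R D X rk K σ) (hR : G.Sub R) : G.Sub (R \ X) := by
  rintro s ⟨hs, hsX⟩
  refine ⟨fun ho => ?_, fun ho w hw => ⟨(hR s hs).2 ho w hw, h.out1 s hs hsX (Or.inr ho) w hw⟩⟩
  by_cases hoP : G.ow s = P
  · obtain ⟨w, hw, hwR⟩ := (hR s hs).1 ho
    exact ⟨w, hw, hwR, h.out1 s hs hsX (Or.inl hoP) w hw⟩
  · obtain ⟨w, hw, hwR, hwX⟩ := h.out2 s hs hsX hoP ho
    exact ⟨w, hw, hwR, hwX⟩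

theorem IsAttr.nf {P : Player} {R D X : Set S} {rk : S → ℕ} {K : ℕ} {σ : S → V}
    (h : G.IsAttr P R D X rk K σ) (C : Ctx G.A) (B : Set (ℕ → V)) (m k0 : ℕ)
    (hD : ∀ q ∈ C.O, ∀ k ≥ k0, (∀ j, k0 ≤ j → j < k → G.st q j ∈ X) → G.st q k ∈ D →
      C.NF m B q k)
    (hR : ∀ q ∈ C.O, ∀ k ≥ k0, (∀ j, k0 ≤ j → j < k → G.st q j ∈ X) → G.st q k ∉ R →
      C.NF m B q k)
    (hσ : ∀ q ∈ C.O, ∀ k ≥ k0, (∀ j, k0 ≤ j → j < k → G.st q j ∈ X) → G.st q k ∈ X →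
      G.st q k ∉ D → G.ow (G.st q k) = P → q (k + 1) ≠ σ (G.st q k) → C.NF m B q (k + 1))
    (p : ℕ → V) (hp : p ∈ C.O) (k : ℕ) (hk : k ≥ k0)
    (hX : ∀ j, k0 ≤ j → j ≤ k → G.st p j ∈ X) : C.NF (m + (K + 1)) B p k := by
  have main : ∀ r, ∀ p ∈ C.O, ∀ k ≥ k0, (∀ j, k0 ≤ j → j ≤ k → G.st p j ∈ X) →
      rk (G.st p k) < r → C.NF (m + r) B p k := by
    intro r
    induction r with
    | zero =>
      intro p hp k hk hX hr
      omega
    | succ r ih =>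
      intro p hp k hk hX hr
      have hXk := hX k hk le_rfl
      have hX' : ∀ j, k0 ≤ j → j < k → G.st p j ∈ X := fun j h1 h2 => hX j h1 h2.le
      by_cases hd : G.st p k ∈ D
      · exact C.nf_mono _ _ _ _ _ _ hp (fun q _ _ h => h) (by omega) (hD p hp k hk hX' hd)
      -- a step to a lower state
      have step : ∀ q ∈ C.O, (∀ j ≤ k, q j = p j) → G.st q (k + 1) ∈ X →
          rk (G.st q (k + 1)) < rk (G.st p k) → C.NF (m + (r + 1)) B p k := by
        intro q hq hag hqX hqr
        refine C.nf_step (m + r) B p q k hp hq hag (ih q hq (k + 1) (by omega) ?_ (by omega))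
        intro j h1 h2
        rcases Nat.lt_or_ge k j with h3 | h3
        · have : j = k + 1 := by omega
          subst this; exact hqX
        · rw [G.st_congr (fun i hi => hag i (by omega))]; exact hX j h1 h3
      have edg : ∀ q ∈ C.O, G.Ed (G.st q k) (q (k + 1)) := by
        intro q hq
        unfold Ed; rw [G.lab_st]; exact C.edge q hq k
      by_cases hN : G.ow (G.st p k) = Player.N
      · obtain ⟨w, hw, hwX, hwr⟩ := h.nat _ hXk hd hN
        obtain ⟨q, hq, hag, hqw⟩ := C.branch p hp k (by unfold ow at hN; rwa [G.lab_st] at hN) w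
          (by unfold Ed at hw; rwa [G.lab_st] at hw)
        have e : G.st q (k + 1) = G.nxt (G.st p k) w := by
          rw [st_succ, hqw, G.st_congr hag]
        exact step q hq hag (e ▸ hwX) (e ▸ hwr)
      · by_cases hPo : G.ow (G.st p k) = P
        · by_cases hc : p (k + 1) = σ (G.st p k)
          · obtain ⟨_, h2, h3⟩ := h.own _ hXk hd hPo
            refine step p hp (fun _ _ => rfl) ?_ ?_
            · rw [st_succ, hc]; exact h2
            · rw [st_succ, hc]; exact h3
          · have := C.nf_step m B p p k hp hp (fun _ _ => rfl) (hσ p hp k hk hX' hXk hd hPo hc)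
            exact C.nf_mono _ _ _ _ _ _ hp (fun q _ _ h => h) (by omega) this
        · by_cases hR' : G.st p (k + 1) ∈ R
          · obtain ⟨h2, h3⟩ := h.opp _ hXk hd hPo hN (p (k + 1)) (edg p hp) hR'
            exact step p hp (fun _ _ => rfl) h2 h3
          · have := C.nf_step m B p p k hp hp (fun _ _ => rfl)
              (hR p hp (k + 1) (by omega) (fun j h1 h2 => hX j h1 (by omega)) hR')
            exact C.nf_mono _ _ _ _ _ _ hp (fun q _ _ h => h) (by omega) this
  exact main (K + 1) p hp k hk hX (Nat.lt_succ_of_le (h.bd _))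

end PGame

namespace PGame
open Filter

variable {V S : Type} (G : PGame V S)

def BB (R Z : Set S) (k0 : ℕ) : Set (ℕ → V) :=
  {p | ((∀ k ≥ k0, G.st p k ∈ Z) ∧ p ∈ G.Om) ∨
    ∃ k ≥ k0, G.st p k ∈ R ∧ G.st p k ∉ Z ∧ ∀ j, k0 ≤ j → j < k → G.st p j ∈ Z}

/-- first exit -/
theorem first_exit (Z : Set S) (p : ℕ → V) (k0 : ℕ) (h : ¬ ∀ k ≥ k0, G.st p k ∈ Z) :
    ∃ k ≥ k0, G.st p k ∉ Z ∧ ∀ j, k0 ≤ j → j < k → G.st p j ∈ Z := by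
  classical
  push Not at h
  refine ⟨Nat.find h, (Nat.find_spec h).1, (Nat.find_spec h).2, fun j h1 h2 => ?_⟩
  by_contra h3
  exact Nat.find_min h h2 ⟨h1, h3⟩

theorem BB_sub {R Z Z0 : Set S} (h0 : Z0 ⊆ Z) (hZ : Z ⊆ R) {k0 k' : ℕ} (hk : k0 ≤ k')
    {p : ℕ → V} (hp : p ∈ G.BB R Z k0) (hj : ∀ j, k0 ≤ j → j < k' → G.st p j ∈ Z) :
    p ∈ G.BB R Z0 k' := by
  by_cases hall : ∀ k ≥ k', G.st p k ∈ Z0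
  · left
    refine ⟨hall, ?_⟩
    rcases hp with hp | ⟨k, hk0, hkR, hkZ, _⟩
    · exact hp.2
    · exfalso
      rcases Nat.lt_or_ge k k' with h | h
      · exact hkZ (hj k hk0 h)
      · exact hkZ (h0 (hall k h))
  · right
    obtain ⟨k1, hk1, hk1Z, hk1j⟩ := G.first_exit Z0 p k' hall
    refine ⟨k1, hk1, ?_, hk1Z, hk1j⟩
    rcases hp with hp | ⟨k, hk0, hkR, hkZ, hkj⟩
    · exact hZ (hp.1 k1 (by omega))
    · rcases lt_trichotomy k1 k with h | h | h
      · exact hZ (hkj k1 (by omega) h)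
      · subst h; exact hkR
      · exfalso
        rcases Nat.lt_or_ge k k' with h' | h'
        · exact hkZ (hj k hk0 h')
        · exact hkZ (h0 (hk1j k h' h))

def Conf (C : Ctx G.A) (W : Set S) (σ : S → V) : Prop :=
  ∀ p ∈ C.O, ∀ k, G.st p k ∈ W → G.ow (G.st p k) = Player.A → p (k + 1) = σ (G.st p k)

/-- Abélard certificate. -/
def Cert (R Z : Set S) (σ : S → V) (n : ℕ) : Prop :=
  ∀ C : Ctx G.A, G.Conf C Z σ → ∀ p ∈ C.O, ∀ k, G.st p k ∈ Z → C.NF n (G.BB R Z k) p k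

def badE (C : Ctx G.A) (W : Set S) (σ : S → V) : Set (ℕ → V) :=
  {p | p ∈ C.O ∧ (∃ N, ∀ k ≥ N, G.st p k ∈ W ∧
    (G.ow (G.st p k) = Player.E → p (k + 1) = σ (G.st p k))) ∧ p ∉ G.Om}

structure IsSol (R WE WA : Set S) (σE σA : S → V) (n : ℕ) : Prop where
  un : WE ∪ WA = R
  dj : ∀ s ∈ WE, s ∉ WA
  e1E : ∀ s ∈ WE, G.ow s = Player.E → G.Ed s (σE s) ∧ G.nxt s (σE s) ∈ WE
  e1A : ∀ s ∈ WE, G.ow s = Player.A → ∀ w, G.Ed s w → G.nxt s w ∈ R → G.nxt s w ∈ WE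
  e1N : ∀ s ∈ WE, G.ow s = Player.N → ∀ w, G.Ed s w → G.nxt s w ∈ WE
  e2 : ∀ C : Ctx G.A, C.Null (G.badE C WE σE)
  a1 : ∀ s ∈ WA, G.ow s = Player.A → G.Ed s (σA s) ∧ G.nxt s (σA s) ∈ WA
  a2 : G.Cert R WA σA n

def Solv (R : Set S) : Prop := ∃ WE WA σE σA n, G.IsSol R WE WA σE σA n

variable {G}

theorem null_empty (C : Ctx G.A) : C.Null ∅ := C.density 0 ∅ (fun p hp => absurd hp (by simp))

theorem null_union (C : Ctx G.A) {B B' : Set (ℕ → V)} (h : C.Null B) (h' : C.Null B') :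
    C.Null (B ∪ B') := by
  refine C.null_mono _ _ ?_ (C.null_iUnion (fun i => if i = 0 then B else B') ?_)
  · rintro p (hp | hp)
    · exact Set.mem_iUnion.2 ⟨0, by simpa using hp⟩
    · exact Set.mem_iUnion.2 ⟨1, by simpa using hp⟩
  · intro i
    by_cases hi : i = 0
    · simpa [hi] using h
    · simpa [hi] using h'

theorem ed_st (C : Ctx G.A) {p : ℕ → V} (hp : p ∈ C.O) (k : ℕ) : G.Ed (G.st p k) (p (k + 1)) := by
  unfold Ed; rw [G.lab_st]; exact C.edge p hp k

theorem ow_cases (s : S) : G.ow s = Player.E ∨ G.ow s = Player.A ∨ G.ow s = Player.N := by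
  cases G.ow s <;> simp

/-- choice of a successor inside R -/
theorem succ_ex [Nonempty V] {R : Set S} (hR : G.Sub R) :
    ∃ τ : S → V, ∀ s ∈ R, G.ow s ≠ Player.N → G.Ed s (τ s) ∧ G.nxt s (τ s) ∈ R := by
  classical
  refine ⟨fun s => if h : ∃ w, G.Ed s w ∧ G.nxt s w ∈ R then h.choose else Classical.arbitrary V, ?_⟩
  intro s hs ho
  have h := (hR s hs).1 ho
  simp only [dif_pos h]; exact h.choose_spec

/-- Éloïse wins everywhere. -/
theorem wholeE {R D X WE : Set S} {rk : S → ℕ} {K : ℕ} {σX σD σY σA : S → V} {n : ℕ}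
    (hR : G.Sub R) (hX : G.IsAttr Player.E R D X rk K σX)
    (hY : G.IsSol (R \ X) WE ∅ σY σA n)
    (hD1 : ∀ s ∈ D, G.ow s = Player.E → G.Ed s (σD s) ∧ G.nxt s (σD s) ∈ R)
    (hD2 : ∀ C : Ctx G.A, C.Null {p | p ∈ C.O ∧ (∃ N, ∀ k ≥ N, G.st p k ∈ R ∧
      (G.st p k ∈ D → G.ow (G.st p k) = Player.E → p (k + 1) = σD (G.st p k))) ∧
      (∃ᶠ k in atTop, G.st p k ∈ D) ∧ p ∉ G.Om}) : G.Solv R := by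
  classical
  have hWE : WE = R \ X := by rw [← hY.un]; simp
  subst hWE
  let σ : S → V := fun s => if s ∈ D then σD s else if s ∈ X then σX s else σY s
  have σ1 : ∀ s ∈ D, σ s = σD s := fun s hs => by simp [σ, hs]
  have σ2 : ∀ s, s ∉ D → s ∈ X → σ s = σX s := fun s hs hs' => by simp [σ, hs, hs']
  have σ3 : ∀ s, s ∉ X → σ s = σY s := fun s hs => by
    have : s ∉ D := fun h => hs (hX.dx h)
    simp [σ, hs, this]
  refine ⟨R, ∅, σ, σA, 0, by simp, by simp, ?_, ?_, ?_, ?_, by simp, ?_⟩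
  · intro s hs ho
    by_cases h1 : s ∈ D
    · rw [σ1 s h1]; exact hD1 s h1 ho
    · by_cases h2 : s ∈ X
      · rw [σ2 s h1 h2]
        have := hX.own s h2 h1 ho
        exact ⟨this.1, hX.xr this.2.1⟩
      · rw [σ3 s h2]
        have := hY.e1E s ⟨hs, h2⟩ ho
        exact ⟨this.1, this.2.1⟩
  · intro s _ _ w _ h; exact h
  · intro s hs ho w hw; exact (hR s hs).2 ho w hw
  · intro C
    let Bm : ℕ → Set (ℕ → V) := fun M => {p | p ∈ C.O ∧ (∀ k ≥ M, G.st p k ∈ R ∧ G.st p k ∉ D ∧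
      (G.ow (G.st p k) = Player.E → p (k + 1) = σ (G.st p k))) ∧ ∃ᶠ k in atTop, G.st p k ∈ X}
    have hBm : ∀ M, C.Null (Bm M) := by
      intro M
      apply C.density (0 + (K + 1))
      intro p hp
      refine ⟨hp.1, ?_⟩
      have hf := hp.2.2.and_eventually (eventually_ge_atTop M)
      refine hf.mono ?_
      rintro k ⟨hk, hkM⟩
      refine hX.nf C (Bm M) 0 k ?_ ?_ ?_ p hp.1 k le_rfl ?_
      · intro q hq k1 hk1 _ hqD
        apply C.nf_empty _ _ _ hq
        intro q' hq' hag hq'B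
        exact (hq'B.2.1 k1 (by omega)).2.1 (by rw [G.st_congr hag]; exact hqD)
      · intro q hq k1 hk1 _ hqD
        apply C.nf_empty _ _ _ hq
        intro q' hq' hag hq'B
        exact hqD (by rw [← G.st_congr hag]; exact (hq'B.2.1 k1 (by omega)).1)
      · intro q hq k1 hk1 _ hqX hqD ho hne
        apply C.nf_empty _ _ _ hq
        intro q' hq' hag hq'B
        have e : G.st q' k1 = G.st q k1 := G.st_congr (fun j hj => hag j (by omega))
        have := (hq'B.2.1 k1 (by omega)).2.2 (by rw [e]; exact ho)
        rw [e, hag (k1 + 1) le_rfl, σ2 _ hqD hqX] at this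
        exact hne this
      · intro j h1 h2
        have : j = k := by omega
        subst this; exact hk
    refine C.null_mono _ _ ?_ (null_union C (null_union C (hD2 C) (hY.e2 C)) (C.null_iUnion Bm hBm))
    rintro p ⟨hp, ⟨N, hN⟩, hΩ⟩
    by_cases hDio : ∃ᶠ k in atTop, G.st p k ∈ D
    · left; left
      refine ⟨hp, ⟨N, fun k hk => ⟨(hN k hk).1, fun h1 h2 => ?_⟩⟩, hDio, hΩ⟩
      rw [(hN k hk).2 h2, σ1 _ h1]
    · by_cases hXio : ∃ᶠ k in atTop, G.st p k ∈ X
      · right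
        rw [not_frequently, eventually_atTop] at hDio
        obtain ⟨M, hM⟩ := hDio
        refine Set.mem_iUnion.2 ⟨max M N, hp, fun k hk => ⟨(hN k ?_).1, hM k ?_, (hN k ?_).2⟩, hXio⟩
        · exact le_trans (le_max_right _ _) hk
        · exact le_trans (le_max_left _ _) hk
        · exact le_trans (le_max_right _ _) hk
      · left; right
        rw [not_frequently, eventually_atTop] at hXio
        obtain ⟨M, hM⟩ := hXio
        refine ⟨hp, ⟨max M N, fun k hk => ?_⟩, hΩ⟩
        have hk1 : M ≤ k := le_trans (le_max_left _ _) hk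
        have hk2 : N ≤ k := le_trans (le_max_right _ _) hk
        refine ⟨⟨(hN k hk2).1, hM k hk1⟩, fun ho => ?_⟩
        rw [(hN k hk2).2 ho, σ3 _ (hM k hk1)]
  · intro C _ p _ k hk; exact absurd hk (by simp)

/-- Abélard wins everywhere. -/
theorem wholeA [Nonempty V] {R T X WA : Set S} {rk : S → ℕ} {K : ℕ} {σX σY σE : S → V} {n : ℕ}
    (hR : G.Sub R) (hX : G.IsAttr Player.A R T X rk K σX)
    (hY : G.IsSol (R \ X) ∅ WA σE σY n)
    (hT : ∀ p, (∃ N, ∀ k ≥ N, G.st p k ∈ R) → (∃ᶠ k in atTop, G.st p k ∈ T) → p ∉ G.Om) :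
    G.Solv R := by
  classical
  have hWA : WA = R \ X := by rw [← hY.un]; simp
  subst hWA
  obtain ⟨τ, hτ⟩ := succ_ex hR
  let σ : S → V := fun s => if s ∈ T then τ s else if s ∈ X then σX s else σY s
  have σ1 : ∀ s ∈ T, σ s = τ s := fun s hs => by simp [σ, hs]
  have σ2 : ∀ s, s ∉ T → s ∈ X → σ s = σX s := fun s hs hs' => by simp [σ, hs, hs']
  have σ3 : ∀ s, s ∉ X → σ s = σY s := fun s hs => by
    have : s ∉ T := fun h => hs (hX.dx h)
    simp [σ, hs, this]
  refine ⟨∅, R, σE, σ, 0, by simp, by simp, by simp, by simp, by simp, ?_, ?_, ?_⟩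
  · intro C
    refine C.null_mono _ _ ?_ (null_empty C)
    rintro p ⟨_, ⟨N, hN⟩, _⟩
    exact absurd (hN N le_rfl).1 (by simp)
  · intro s hs ho
    by_cases h1 : s ∈ T
    · rw [σ1 s h1]; exact hτ s hs (by rw [ho]; decide)
    · by_cases h2 : s ∈ X
      · rw [σ2 s h1 h2]
        have := hX.own s h2 h1 ho
        exact ⟨this.1, hX.xr this.2.1⟩
      · rw [σ3 s h2]
        have := hY.a1 s ⟨hs, h2⟩ ho
        exact ⟨this.1, this.2.1⟩
  · intro C hC p0 hp0 k0 hk0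
    let Bm : ℕ → Set (ℕ → V) := fun M => {p | p ∈ C.O ∧ (∀ k ≥ M, G.st p k ∈ R ∧ G.st p k ∉ T) ∧
      p ∈ G.Om}
    have hBX : ∀ M, ∀ p ∈ C.O, ∀ k ≥ M, G.st p k ∈ X → C.NF (0 + (K + 1)) (Bm M) p k := by
      intro M p hp k hkM hk
      refine hX.nf C (Bm M) 0 k ?_ ?_ ?_ p hp k le_rfl ?_
      · intro q hq k1 hk1 _ hqD
        apply C.nf_empty _ _ _ hq
        intro q' hq' hag hq'B
        exact (hq'B.2.1 k1 (by omega)).2 (by rw [G.st_congr hag]; exact hqD)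
      · intro q hq k1 hk1 _ hqD
        apply C.nf_empty _ _ _ hq
        intro q' hq' hag hq'B
        exact hqD (by rw [← G.st_congr hag]; exact (hq'B.2.1 k1 (by omega)).1)
      · intro q hq k1 hk1 _ hqX hqD ho hne
        exact absurd (by rw [hC q hq k1 (hX.xr hqX) ho, σ2 _ hqD hqX]) hne
      · intro j h1 h2
        have : j = k := by omega
        subst this; exact hk
    have hCY : G.Conf C (R \ X) σY := by
      intro p hp k hk ho
      rw [hC p hp k hk.1 ho, σ3 _ hk.2]
    have hBm : ∀ M, C.Null (Bm M) := by
      intro M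
      apply C.density (n + (0 + (K + 1)))
      intro p hp
      refine ⟨hp.1, ?_⟩
      refine (eventually_atTop.2 ⟨M, fun k hkM => ?_⟩).frequently
      by_cases hk : G.st p k ∈ X
      · exact C.nf_mono _ _ _ _ _ _ hp.1 (fun q _ _ h => h) (by omega) (hBX M p hp.1 k hkM hk)
      · have h1 := hY.a2 C hCY p hp.1 k ⟨(hp.2.1 k hkM).1, hk⟩
        refine C.nf_trans _ _ _ _ p k hp.1 h1 ?_
        intro q hq hag hqB hqn
        have : ¬ ∀ k' ≥ k, G.st q k' ∈ R \ X := fun hall => hqn (Or.inl ⟨hall, hqB.2.2⟩)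
        push Not at this
        obtain ⟨k', hk', hk'X⟩ := this
        refine ⟨k', hk', hBX M q hq k' (by omega) ?_⟩
        by_contra h
        exact hk'X ⟨(hqB.2.1 k' (by omega)).1, h⟩
    have hN := C.nf_null _ p0 k0 hp0 (C.null_iUnion Bm hBm)
    refine C.nf_mono _ _ _ _ _ _ hp0 ?_ le_rfl hN
    intro q hq _ hqB
    rcases hqB with ⟨h1, h2⟩ | ⟨k, _, h1, h2, _⟩
    · have : ¬ ∃ᶠ k in atTop, G.st q k ∈ T := fun h => hT q ⟨k0, h1⟩ h h2
      rw [not_frequently, eventually_atTop] at this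
      obtain ⟨M, hM⟩ := this
      refine Set.mem_iUnion.2 ⟨max M k0, hq, fun k hk => ⟨h1 k ?_, hM k ?_⟩, h2⟩
      · exact le_trans (le_max_right _ _) hk
      · exact le_trans (le_max_left _ _) hk
    · exact absurd h1 h2

/-- Removal step. -/
theorem stepA [Finite S] [Nonempty V] {R X D WE WA : Set S} {rk : S → ℕ} {K : ℕ}
    {σX σE σA : S → V} {n : ℕ}
    (hR : G.Sub R) (hX : G.IsAttr Player.E R D X rk K σX)
    (hY : G.IsSol (R \ X) WE WA σE σA n) (hne : WA.Nonempty)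
    (IH : ∀ R' : Set S, R' ⊂ R → G.Sub R' → G.Solv R') : G.Solv R := by
  classical
  have hWAY : WA ⊆ R \ X := by rw [← hY.un]; exact Set.subset_union_right
  obtain ⟨Z, rkZ, KZ, σZ, hZ⟩ := G.attr_ex Player.A R WA (fun s hs => (hWAY hs).1)
  have hR' : G.Sub (R \ Z) := hZ.sub hR
  obtain ⟨E', A', σE', σA', n', hS⟩ := IH (R \ Z) (by
    refine ⟨Set.sdiff_subset, fun h => ?_⟩
    obtain ⟨s, hs⟩ := hne
    exact (h (hWAY hs).1).2 (hZ.dx hs)) hR'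
  have hE'sub : E' ⊆ R \ Z := by rw [← hS.un]; exact Set.subset_union_left
  have hA'sub : A' ⊆ R \ Z := by rw [← hS.un]; exact Set.subset_union_right
  let σ : S → V := fun s => if s ∈ WA then σA s else if s ∈ Z then σZ s else σA' s
  have σ1 : ∀ s ∈ WA, σ s = σA s := fun s hs => by simp [σ, hs]
  have σ2 : ∀ s, s ∉ WA → s ∈ Z → σ s = σZ s := fun s hs hs' => by simp [σ, hs, hs']
  have σ3 : ∀ s, s ∉ Z → σ s = σA' s := fun s hs => by
    have : s ∉ WA := fun h => hs (hZ.dx h)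
    simp [σ, hs, this]
  have hsubR : Z ∪ A' ⊆ R := Set.union_subset hZ.xr (fun s hs => (hA'sub hs).1)
  -- certificate for WA in R
  have c0 : ∀ C : Ctx G.A, G.Conf C WA σA → ∀ p ∈ C.O, ∀ k, G.st p k ∈ WA →
      C.NF n (G.BB R WA k) p k := by
    intro C hC p hp k hk
    refine C.nf_mono _ _ _ _ _ _ hp ?_ le_rfl (hY.a2 C hC p hp k hk)
    intro q hq hag hqB
    rcases hqB with h | ⟨k1, hk1, h1, h2, h3⟩
    · exact Or.inl h
    · refine Or.inr ⟨k1, hk1, ⟨h1, ?_⟩, h2, h3⟩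
      intro hkX
      have hk0 : G.st q k ∈ WA := by rw [G.st_congr hag]; exact hk
      rcases k1 with _ | k2
      · have : k = 0 := by omega
        subst this; exact h2 hk0
      · have hlt : k ≤ k2 := by
          by_contra hlt
          have : k = k2 + 1 := by omega
          subst this; exact h2 hk0
        have hm := h3 k2 hlt (by omega)
        have hmY := hWAY hm
        rcases ow_cases (G := G) (G.st q k2) with ho | ho | ho
        · exact hX.out1 _ hmY.1 hmY.2 (Or.inl ho) _ (ed_st C hq k2) hkX
        · apply h2
          rw [st_succ, hC q hq k2 hm ho]
          exact (hY.a1 _ hm ho).2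
        · exact hX.out1 _ hmY.1 hmY.2 (Or.inr ho) _ (ed_st C hq k2) hkX
  -- certificate for Z in R
  have c1 : ∀ C : Ctx G.A, G.Conf C Z σ → ∀ p ∈ C.O, ∀ k, G.st p k ∈ Z →
      C.NF (n + (KZ + 1)) (G.BB R Z k) p k := by
    intro C hC p hp k hk
    have hC0 : G.Conf C WA σA := by
      intro q hq j hj ho
      rw [hC q hq j (hZ.dx hj) ho, σ1 _ hj]
    refine hZ.nf C _ n k ?_ ?_ ?_ p hp k le_rfl ?_
    · intro q hq k1 hk1 hj hqD
      refine C.nf_mono _ _ _ _ _ _ hq ?_ le_rfl (c0 C hC0 q hq k1 hqD)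
      intro q' hq' hag hB
      refine G.BB_sub hZ.dx hZ.xr hk1 hB (fun j h1 h2 => ?_)
      rw [G.st_congr (fun i hi => hag i (by omega))]; exact hj j h1 h2
    · intro q hq k1 hk1 hj hqR
      refine C.nf_mono 0 _ _ _ _ _ hq (fun _ _ _ h => h) (Nat.zero_le _) (C.nf_empty _ _ _ hq ?_)
      intro q' hq' hag hB
      have e : ∀ j ≤ k1, G.st q' j = G.st q j := fun j hj => G.st_congr (fun i hi => hag i (by omega))
      rcases hB with ⟨h1, _⟩ | ⟨k2, hk2, h1, h2, h3⟩
      · exact hqR (by rw [← e k1 le_rfl]; exact hZ.xr (h1 k1 hk1))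
      · rcases lt_trichotomy k2 k1 with h | h | h
        · exact h2 (by rw [e k2 h.le]; exact hj k2 hk2 h)
        · subst h; exact hqR (by rw [← e k2 le_rfl]; exact h1)
        · exact hqR (by rw [← e k1 le_rfl]; exact hZ.xr (h3 k1 hk1 h))
    · intro q hq k1 hk1 _ hqX hqD ho hne
      exact absurd (by rw [hC q hq k1 hqX ho, σ2 _ hqD hqX]) hne
    · intro j h1 h2
      have : j = k := by omega
      subst this; exact hk
  refine ⟨E', Z ∪ A', σE', σ, n' + (n + (KZ + 1)), ?_, ?_, hS.e1E, ?_, hS.e1N, hS.e2, ?_, ?_⟩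
  · have := hS.un
    ext s
    have h1 : s ∈ E' ∪ A' ↔ s ∈ R \ Z := by rw [this]
    have h2 : s ∈ Z → s ∈ R := fun h => hZ.xr h
    simp only [Set.mem_union, Set.mem_sdiff] at h1 ⊢
    tauto
  · intro s hs hs'
    rcases hs' with h | h
    · exact (hE'sub hs).2 h
    · exact hS.dj s hs h
  · intro s hs ho w hw hwR
    refine hS.e1A s hs ho w hw ⟨hwR, ?_⟩
    exact hZ.out1 s (hE'sub hs).1 (hE'sub hs).2 (Or.inl ho) w hw
  · intro s hs ho
    by_cases h1 : s ∈ WA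
    · rw [σ1 s h1]
      have := hY.a1 s h1 ho
      exact ⟨this.1, Or.inl (hZ.dx this.2)⟩
    · by_cases h2 : s ∈ Z
      · rw [σ2 s h1 h2]
        have := hZ.own s h2 h1 ho
        exact ⟨this.1, Or.inl this.2.1⟩
      · rw [σ3 s h2]
        have := hS.a1 s (hs.resolve_left h2) ho
        exact ⟨this.1, Or.inr this.2⟩
  · intro C hC p hp k hk
    have hCZ : G.Conf C Z σ := fun q hq j hj ho => hC q hq j (Or.inl hj) ho
    have hCA : G.Conf C A' σA' := by
      intro q hq j hj ho
      rw [hC q hq j (Or.inr hj) ho, σ3 _ (hA'sub hj).2]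
    have sub : ∀ q ∈ C.O, ∀ k' ≥ k, (∀ j, k ≤ j → j < k' → G.st q j ∈ Z ∪ A') → G.st q k' ∈ Z →
        C.NF (n + (KZ + 1)) (G.BB R (Z ∪ A') k) q k' := by
      intro q hq k' hk' hj hqZ
      refine C.nf_mono _ _ _ _ _ _ hq ?_ le_rfl (c1 C hCZ q hq k' hqZ)
      intro q' hq' hag hB
      refine G.BB_sub Set.subset_union_left hsubR hk' hB (fun j h1 h2 => ?_)
      rw [G.st_congr (fun i hi => hag i (by omega))]; exact hj j h1 h2
    by_cases hkZ : G.st p k ∈ Z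
    · exact C.nf_mono _ _ _ _ _ _ hp (fun _ _ _ h => h) (by omega)
        (sub p hp k le_rfl (fun j h1 h2 => by omega) hkZ)
    · have hkA := hk.resolve_left hkZ
      refine C.nf_trans _ _ _ _ p k hp (hS.a2 C hCA p hp k hkA) ?_
      intro q hq hag hqB hqn
      have hna : ¬ ∀ k' ≥ k, G.st q k' ∈ A' := by
        intro hall
        apply hqn
        rcases hqB with h | ⟨k2, hk2, h1, h2, h3⟩
        · exact Or.inl ⟨hall, h.2⟩
        · exact absurd (Or.inr (hall k2 hk2)) h2
      obtain ⟨k', hk', hk'A, hj⟩ := G.first_exit A' q k hna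
      refine ⟨k', hk', sub q hq k' hk' (fun j h1 h2 => Or.inr (hj j h1 h2)) ?_⟩
      rcases hqB with h | ⟨k2, hk2, h1, h2, h3⟩
      · exact (h.1 k' hk').resolve_right hk'A
      · rcases lt_trichotomy k' k2 with h | h | h
        · exact (h3 k' hk' h).resolve_right hk'A
        · subst h
          by_contra hcon
          exact hqn (Or.inr ⟨k', hk', ⟨h1, hcon⟩, hk'A, hj⟩)
        · exact absurd (Or.inr (hj k2 hk2 h)) h2

theorem solv_all [Finite S] [Nonempty V] : ∀ (N : ℕ) (R : Set S), R.ncard ≤ N → G.Sub R →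
    G.Solv R := by
  classical
  intro N
  induction N with
  | zero =>
    intro R hR _
    have : R = ∅ := by
      rw [← Set.ncard_eq_zero (Set.toFinite R)]; omega
    subst this
    refine ⟨∅, ∅, fun _ => Classical.arbitrary V, fun _ => Classical.arbitrary V, 0, by simp,
      by simp, by simp, by simp, by simp, ?_, by simp, ?_⟩
    · intro C
      refine C.null_mono _ _ ?_ (null_empty C)
      rintro p ⟨_, ⟨N, hN⟩, _⟩
      exact absurd (hN N le_rfl).1 (by simp)
    · intro C _ p _ k hk; exact absurd hk (by simp)
  | succ N ih =>
    intro R hRN hR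
    have IH : ∀ R' : Set S, R' ⊂ R → G.Sub R' → G.Solv R' := by
      intro R' h h'
      refine ih R' ?_ h'
      have := Set.ncard_lt_ncard h (Set.toFinite R)
      omega
    by_cases hRe : R.Nonempty
    swap
    · rw [Set.not_nonempty_iff_eq_empty] at hRe
      exact ih R (by simp [hRe]) hR
    -- the minimal colour
    have hex : ∃ n, ∃ s ∈ R, G.col s = n := by
      obtain ⟨s, hs⟩ := hRe; exact ⟨_, s, hs, rfl⟩
    obtain ⟨n, ⟨t, htR, htn⟩, hmin⟩ : ∃ n, (∃ s ∈ R, G.col s = n) ∧ ∀ s ∈ R, n ≤ G.col s :=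
      ⟨Nat.find hex, Nat.find_spec hex, fun s hs => Nat.find_min' hex ⟨s, hs, rfl⟩⟩
    let T : Set S := {s | s ∈ R ∧ G.col s = n}
    have hTR : T ⊆ R := fun s hs => hs.1
    have htT : t ∈ T := ⟨htR, htn⟩
    have hpar : ∀ p, (∃ N, ∀ k ≥ N, G.st p k ∈ R) → (∃ᶠ k in atTop, G.st p k ∈ T) →
        (p ∈ G.Om ↔ Even n) := by
      rintro p ⟨M, hM⟩ hT
      refine G.par p n (hT.mono fun k hk => hk.2) (eventually_atTop.2 ⟨M, fun k hk => hmin _ (hM k hk)⟩)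
    -- the main dichotomy given D
    have fin : ∀ (D : Set S) (σD : S → V), D ⊆ R → D.Nonempty →
        (∀ s ∈ D, G.ow s = Player.E → G.Ed s (σD s) ∧ G.nxt s (σD s) ∈ R) →
        (∀ C : Ctx G.A, C.Null {p | p ∈ C.O ∧ (∃ N, ∀ k ≥ N, G.st p k ∈ R ∧
          (G.st p k ∈ D → G.ow (G.st p k) = Player.E → p (k + 1) = σD (G.st p k))) ∧
          (∃ᶠ k in atTop, G.st p k ∈ D) ∧ p ∉ G.Om}) → G.Solv R := by
      intro D σD hDR hDne hD1 hD2
      obtain ⟨X, rk, K, σX, hX⟩ := G.attr_ex Player.E R D hDR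
      obtain ⟨WE, WA, σE, σA, m, hY⟩ := IH (R \ X) (by
        refine ⟨Set.sdiff_subset, fun h => ?_⟩
        obtain ⟨s, hs⟩ := hDne
        exact (h (hDR hs)).2 (hX.dx hs)) (hX.sub hR)
      by_cases hA : WA.Nonempty
      · exact stepA hR hX hY hA IH
      · rw [Set.not_nonempty_iff_eq_empty] at hA
        subst hA
        exact wholeE hR hX hY hD1 hD2
    obtain ⟨τ, hτ⟩ := succ_ex hR
    by_cases hev : Even n
    · refine fin T τ hTR ⟨t, htT⟩ (fun s hs ho => hτ s hs.1 (by rw [ho]; decide)) ?_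
      intro C
      refine C.null_mono _ _ ?_ (null_empty C)
      rintro p ⟨_, ⟨M, hM⟩, hT, hΩ⟩
      exact hΩ ((hpar p ⟨M, fun k hk => (hM k hk).1⟩ hT).2 hev)
    · obtain ⟨X, rk, K, σX, hX⟩ := G.attr_ex Player.A R T hTR
      obtain ⟨WE, WA, σE, σA, m, hY⟩ := IH (R \ X) (by
        refine ⟨Set.sdiff_subset, fun h => ?_⟩
        exact (h htR).2 (hX.dx htT)) (hX.sub hR)
      have hWEY : WE ⊆ R \ X := by rw [← hY.un]; exact Set.subset_union_left
      by_cases hE : WE.Nonempty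
      · refine fin WE σE (fun s hs => (hWEY hs).1) hE
          (fun s hs ho => ⟨(hY.e1E s hs ho).1, (hWEY (hY.e1E s hs ho).2).1⟩) ?_
        intro C
        refine C.null_mono _ _ ?_ (hY.e2 C)
        rintro p ⟨hp, ⟨M, hM⟩, hT, hΩ⟩
        refine ⟨hp, ?_, hΩ⟩
        obtain ⟨k1, hk1, hk1M⟩ := (hT.and_eventually (eventually_ge_atTop M)).exists
        have hst : ∀ i, G.st p (k1 + i) ∈ WE := by
          intro i
          induction i with
          | zero => exact hk1
          | succ i ihi =>
            have hed := ed_st C hp (k1 + i)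
            have hnR : G.nxt (G.st p (k1 + i)) (p (k1 + i + 1)) ∈ R :=
              (hM (k1 + i + 1) (by omega)).1
            show G.st p (k1 + i + 1) ∈ WE
            rcases ow_cases (G := G) (G.st p (k1 + i)) with ho | ho | ho
            · rw [st_succ, (hM (k1 + i) (by omega)).2 ihi ho]
              exact (hY.e1E _ ihi ho).2
            · refine hY.e1A _ ihi ho _ hed ⟨hnR, ?_⟩
              exact hX.out1 _ (hWEY ihi).1 (hWEY ihi).2 (Or.inl ho) _ hed
            · exact hY.e1N _ ihi ho _ hed
        refine ⟨k1, fun k hk => ?_⟩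
        have hk' : G.st p k ∈ WE := by
          have := hst (k - k1)
          rwa [Nat.add_sub_cancel' hk] at this
        exact ⟨hk', fun ho => (hM k (by omega)).2 hk' ho⟩
      · rw [Set.not_nonempty_iff_eq_empty] at hE
        subst hE
        exact wholeA hR hX hY (fun p h1 h2 h3 => hev ((hpar p h1 h2).1 h3))

end PGame

section Outc
open Filter

variable {V : Type}

theorem hist_length (p : ℕ → V) (k : ℕ) : (histUpTo p k).length = k + 1 := by
  simp [histUpTo]

theorem hist_get (p : ℕ → V) (k i : ℕ) (hi : i < (histUpTo p k).length) :
    (histUpTo p k)[i] = p i := by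
  exact List.getElem_ofFn hi

theorem bprefix_hist (p q : ℕ → V) (k : ℕ) :
    BPrefix q (histUpTo p k) ↔ ∀ j ≤ k, q j = p j := by
  constructor
  · intro h j hj
    have := h ⟨j, by rw [hist_length]; omega⟩
    rw [List.get_eq_getElem, hist_get] at this
    exact this
  · intro h i
    have hi : i.1 < k + 1 := lt_of_lt_of_eq i.2 (hist_length p k)
    rw [h i.1 (by omega), List.get_eq_getElem, hist_get]

theorem hist_succ (p : ℕ → V) (k : ℕ) : histUpTo p (k + 1) = histUpTo p k ++ [p (k + 1)] := by
  unfold histUpTo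
  rw [List.ofFn_succ_last]
  simp

theorem hist_zero (p : ℕ → V) : histUpTo p 0 = [p 0] := by
  simp [histUpTo]

theorem hist_congr {p q : ℕ → V} {k : ℕ} (h : ∀ j ≤ k, q j = p j) :
    histUpTo q k = histUpTo p k := by
  unfold histUpTo
  congr 1
  funext j
  exact h j.1 (by omega)

theorem hist_last (p : ℕ → V) (k : ℕ) : ∃ l, histUpTo p k = l ++ [p k] := by
  cases k with
  | zero => exact ⟨[], by simp [hist_zero]⟩
  | succ k => exact ⟨_, hist_succ p k⟩

theorem bprefix_prefix {p : ℕ → V} {l l' : List V} (h : BPrefix p l') (h' : l <+: l') :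
    BPrefix p l := by
  intro i
  have h1 := h ⟨i.1, lt_of_lt_of_le i.2 h'.length_le⟩
  rw [h1]
  simp only [List.get_eq_getElem]
  exact (h'.getElem i.2).symm

theorem bprefix_compar {p : ℕ → V} {l l' : List V} (h : BPrefix p l) (h' : BPrefix p l')
    (hl : l.length ≤ l'.length) : l <+: l' := by
  rw [List.prefix_iff_getElem]
  refine ⟨hl, fun i hi => ?_⟩
  have h1 := h ⟨i, hi⟩
  have h2 := h' ⟨i, lt_of_lt_of_le hi hl⟩
  simp only [List.get_eq_getElem] at h1 h2
  rw [← h1, ← h2]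

theorem rec_play (v0 : V) (g : ℕ → List V → V) :
    ∃ q : ℕ → V, q 0 = v0 ∧ ∀ i, q (i + 1) = g i (histUpTo q i) := by
  let H : ℕ → List V := fun n => Nat.rec [v0] (fun i l => l ++ [g i l]) n
  let q : ℕ → V := fun n => Nat.casesOn n v0 (fun i => g i (H i))
  have hH : ∀ i, histUpTo q i = H i := by
    intro i
    induction i with
    | zero => exact hist_zero q
    | succ i ih => rw [hist_succ, ih]
  exact ⟨q, rfl, fun i => by rw [hH]⟩

variable {A : Arena V} {v0 : V} {φE φA : List V → V}

theorem out_ext (hE : IsStrategyFor A Player.E φE) (hA : IsStrategyFor A Player.A φA)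
    (p : ℕ → V) (K : ℕ) (h0 : p 0 = v0) (he : ∀ i < K, A.Edge (p i) (p (i + 1)))
    (h1 : ∀ i < K, A.owner (p i) = Player.E → p (i + 1) = φE (histUpTo p i))
    (h2 : ∀ i < K, A.owner (p i) = Player.A → p (i + 1) = φA (histUpTo p i)) :
    ∃ q ∈ Outcomes A v0 φE φA, ∀ j ≤ K, q j = p j := by
  classical
  choose sc hsc using A.no_dead
  obtain ⟨q, hq0, hq⟩ := rec_play v0 (fun i l => if i < K then p (i + 1) else
    if A.owner (l.getLastD v0) = Player.E then φE l else
    if A.owner (l.getLastD v0) = Player.A then φA l else sc (l.getLastD v0))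
  have hag : ∀ j ≤ K, q j = p j := by
    intro j hj
    cases j with
    | zero => rw [hq0, h0]
    | succ j => rw [hq, if_pos (by omega)]
  have hlast : ∀ i, (histUpTo q i).getLastD v0 = q i := by
    intro i
    obtain ⟨l, hl⟩ := hist_last q i
    rw [hl]; simp
  refine ⟨q, ⟨⟨hq0, fun i => ?_⟩, fun i ho => ?_, fun i ho => ?_⟩, hag⟩
  · by_cases hi : i < K
    · rw [hag i hi.le, hag (i + 1) (by omega)]; exact he i hi
    · rw [hq, if_neg hi]
      simp only [hlast]
      obtain ⟨l, hl⟩ := hist_last q i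
      split_ifs with c1 c2
      · rw [hl]; exact hE l _ c1
      · rw [hl]; exact hA l _ c2
      · exact hsc _
  · by_cases hi : i < K
    · rw [hag (i + 1) (by omega), hist_congr (fun j hj => hag j (by omega))]
      exact h1 i hi (by rw [← hag i hi.le]; exact ho)
    · rw [hq, if_neg hi]
      simp only [hlast]
      rw [if_pos ho]
  · by_cases hi : i < K
    · rw [hag (i + 1) (by omega), hist_congr (fun j hj => hag j (by omega))]
      exact h2 i hi (by rw [← hag i hi.le]; exact ho)
    · rw [hq, if_neg hi]
      simp only [hlast]
      rw [if_neg (by rw [ho]; decide), if_pos ho]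

theorem out_branch (hE : IsStrategyFor A Player.E φE) (hA : IsStrategyFor A Player.A φA)
    (p : ℕ → V) (hp : p ∈ Outcomes A v0 φE φA) (k : ℕ) (ho : A.owner (p k) = Player.N) (w : V)
    (hw : A.Edge (p k) w) :
    ∃ q ∈ Outcomes A v0 φE φA, (∀ j ≤ k, q j = p j) ∧ q (k + 1) = w := by
  classical
  let p' : ℕ → V := fun j => if j ≤ k then p j else w
  have hp' : ∀ j ≤ k, p' j = p j := fun j hj => by simp [p', hj]
  have hw' : p' (k + 1) = w := by simp [p']
  have hh : ∀ i ≤ k, histUpTo p' i = histUpTo p i := fun i hi =>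
    hist_congr (fun j hj => hp' j (by omega))
  obtain ⟨q, hq, hag⟩ := out_ext hE hA p' (k + 1) (v0 := v0) (by rw [hp' 0 (by omega)]; exact hp.1.1)
    (by
      intro i hi
      rcases Nat.lt_or_ge i k with h | h
      · rw [hp' i h.le, hp' (i + 1) h]; exact hp.1.2 i
      · have : i = k := by omega
        subst this
        rw [hp' i le_rfl, hw']; exact hw)
    (by
      intro i hi hoi
      rcases Nat.lt_or_ge i k with h | h
      · rw [hp' i h.le] at hoi
        rw [hp' (i + 1) h, hh i h.le]; exact hp.2.1 i hoi
      · have : i = k := by omega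
        subst this
        rw [hp' i le_rfl, ho] at hoi; exact absurd hoi (by decide))
    (by
      intro i hi hoi
      rcases Nat.lt_or_ge i k with h | h
      · rw [hp' i h.le] at hoi
        rw [hp' (i + 1) h, hh i h.le]; exact hp.2.2 i hoi
      · have : i = k := by omega
        subst this
        rw [hp' i le_rfl, ho] at hoi; exact absurd hoi (by decide))
  exact ⟨q, hq, fun j hj => by rw [hag j (by omega), hp' j hj], by rw [hag _ le_rfl, hw']⟩

theorem out_nonempty (hE : IsStrategyFor A Player.E φE) (hA : IsStrategyFor A Player.A φA) :
    ∃ p, p ∈ Outcomes A v0 φE φA := by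
  obtain ⟨q, hq, _⟩ := out_ext hE hA (fun _ => v0) 0 (v0 := v0) rfl (by simp) (by simp) (by simp)
  exact ⟨q, hq⟩

theorem out_closed (p : ℕ → V)
    (h : ∀ k, ∃ q ∈ Outcomes A v0 φE φA, ∀ j ≤ k, q j = p j) : p ∈ Outcomes A v0 φE φA := by
  refine ⟨⟨?_, fun i => ?_⟩, fun i ho => ?_, fun i ho => ?_⟩
  · obtain ⟨q, hq, hag⟩ := h 0
    rw [← hag 0 le_rfl]; exact hq.1.1
  · obtain ⟨q, hq, hag⟩ := h (i + 1)
    rw [← hag i (by omega), ← hag (i + 1) le_rfl]; exact hq.1.2 i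
  · obtain ⟨q, hq, hag⟩ := h (i + 1)
    rw [← hag (i + 1) le_rfl, ← hist_congr (fun j hj => hag j (by omega))]
    exact hq.2.1 i (by rw [hag i (by omega)]; exact ho)
  · obtain ⟨q, hq, hag⟩ := h (i + 1)
    rw [← hag (i + 1) le_rfl, ← hist_congr (fun j hj => hag j (by omega))]
    exact hq.2.2 i (by rw [hag i (by omega)]; exact ho)

/-! topological side -/

theorem nwd_iff (O f : Set (ℕ → V)) : NowhereDenseIn O f ↔
    ∀ p ∈ O, ∀ k, ∃ q ∈ O, ∃ j ≥ k, (∀ i ≤ k, q i = p i) ∧ ∀ b ∈ f, ¬ ∀ i ≤ j, b i = q i := by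
  constructor
  · intro h p hp k
    obtain ⟨v, ⟨q, hq, hqv⟩, huv, hb⟩ := h (histUpTo p k) ⟨p, hp, (bprefix_hist p p k).2 fun _ _ => rfl⟩
    refine ⟨q, hq, max k v.length, le_max_left _ _,
      (bprefix_hist p q k).1 (bprefix_prefix hqv huv), fun b hbf hbq => hb b hbf ?_⟩
    intro i
    rw [hbq i.1 (le_trans i.2.le (le_max_right _ _))]; exact hqv i
  · rintro h u ⟨p, hp, hpu⟩
    obtain ⟨q, hq, j, hj, hag, hb⟩ := h p hp u.length
    refine ⟨histUpTo q j, ⟨q, hq, (bprefix_hist q q j).2 fun _ _ => rfl⟩, ?_, ?_⟩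
    · have h1 : BPrefix q u := fun i => by rw [hag i.1 i.2.le]; exact hpu i
      exact bprefix_compar h1 ((bprefix_hist q q j).2 fun _ _ => rfl) (by rw [hist_length]; omega)
    · intro b hbf hbq
      exact hb b hbf ((bprefix_hist q b j).1 hbq)

theorem meager_mono {O B B' : Set (ℕ → V)} (h : B ⊆ B') (h' : MeagerIn O B') : MeagerIn O B := by
  obtain ⟨f, hf, hB⟩ := h'
  exact ⟨f, hf, h.trans hB⟩

theorem nwd_empty (O : Set (ℕ → V)) : NowhereDenseIn O ∅ := by
  rw [nwd_iff]
  intro p hp k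
  exact ⟨p, hp, k, le_rfl, fun _ _ => rfl, by simp⟩

theorem nwd_meager {O B : Set (ℕ → V)} (h : NowhereDenseIn O B) : MeagerIn O B :=
  ⟨fun _ => B, fun _ => h, fun _ hb => Set.mem_iUnion.2 ⟨0, hb⟩⟩

theorem meager_iUnion {O : Set (ℕ → V)} (F : ℕ → Set (ℕ → V)) (h : ∀ i, MeagerIn O (F i)) :
    MeagerIn O (⋃ i, F i) := by
  choose f hf hB using h
  refine ⟨fun n => f (Nat.unpair n).1 (Nat.unpair n).2, fun n => hf _ _, ?_⟩
  intro b hb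
  obtain ⟨i, hi⟩ := Set.mem_iUnion.1 hb
  obtain ⟨j, hj⟩ := Set.mem_iUnion.1 (hB i hi)
  exact Set.mem_iUnion.2 ⟨Nat.pair i j, by simpa using hj⟩

theorem meager_iUnion_list [Countable V] {O : Set (ℕ → V)} (F : List V → Set (ℕ → V))
    (h : ∀ i, MeagerIn O (F i)) : MeagerIn O (⋃ i, F i) := by
  obtain ⟨e, he⟩ := exists_surjective_nat (List V)
  refine meager_mono ?_ (meager_iUnion (fun n => F (e n)) (fun n => h _))
  intro b hb
  obtain ⟨i, hi⟩ := Set.mem_iUnion.1 hb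
  obtain ⟨n, rfl⟩ := he i
  exact Set.mem_iUnion.2 ⟨n, hi⟩

theorem meager_union {O B B' : Set (ℕ → V)} (h : MeagerIn O B) (h' : MeagerIn O B') :
    MeagerIn O (B ∪ B') := by
  refine meager_mono ?_ (meager_iUnion (fun i => if i = 0 then B else B') ?_)
  · rintro p (hp | hp)
    · exact Set.mem_iUnion.2 ⟨0, by simpa using hp⟩
    · exact Set.mem_iUnion.2 ⟨1, by simpa using hp⟩
  · intro i
    by_cases hi : i = 0
    · simpa [hi] using h
    · simpa [hi] using h'

def topCtx [Countable V] (hE : IsStrategyFor A Player.E φE) (hA : IsStrategyFor A Player.A φA)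
    (v0 : V) : Ctx A where
  O := Outcomes A v0 φE φA
  edge := fun p hp k => hp.1.2 k
  branch := out_branch hE hA
  Null := fun B => MeagerIn (Outcomes A v0 φE φA) (B ∩ Outcomes A v0 φE φA)
  NF := fun _ B p k => ∃ q ∈ Outcomes A v0 φE φA, ∃ j ≥ k, (∀ i ≤ k, q i = p i) ∧
    MeagerIn (Outcomes A v0 φE φA) {b | b ∈ B ∧ b ∈ Outcomes A v0 φE φA ∧ ∀ i ≤ j, b i = q i}
  null_mono := fun _ _ h h' => meager_mono (Set.inter_subset_inter_left _ h) h'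
  null_iUnion := by
    intro f hf
    refine meager_mono ?_ (meager_iUnion _ hf)
    rintro b ⟨hb, hbO⟩
    obtain ⟨i, hi⟩ := Set.mem_iUnion.1 hb
    exact Set.mem_iUnion.2 ⟨i, hi, hbO⟩
  density := by
    classical
    intro n B h
    set O := Outcomes A v0 φE φA with hO
    let F : List V → Set (ℕ → V) := fun l =>
      if MeagerIn O {b | b ∈ B ∧ b ∈ O ∧ BPrefix b l} then {b | b ∈ B ∧ b ∈ O ∧ BPrefix b l} else ∅
    have hF : ∀ l, MeagerIn O (F l) := by
      intro l
      by_cases hl : MeagerIn O {b | b ∈ B ∧ b ∈ O ∧ BPrefix b l}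
      · simp only [F, if_pos hl]; exact hl
      · simp only [F, if_neg hl]; exact nwd_meager (nwd_empty O)
    have h1 := meager_iUnion_list F hF
    have h2 : NowhereDenseIn O (B \ ⋃ l, F l) := by
      rw [nwd_iff]
      intro p hp k
      by_cases hb : ∃ b ∈ B, ∀ i ≤ k, b i = p i
      · obtain ⟨b, hbB, hbp⟩ := hb
        obtain ⟨k', ⟨q, hq, j, hj, hag, hm⟩, hk'⟩ :=
          ((h b hbB).2.and_eventually (eventually_ge_atTop k)).exists
        refine ⟨q, hq, j, by omega, fun i hi => by rw [hag i (by omega), hbp i hi], ?_⟩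
        rintro c ⟨hcB, hcF⟩ hcq
        apply hcF
        have e : {b | b ∈ B ∧ b ∈ O ∧ BPrefix b (histUpTo q j)} =
            {b | b ∈ B ∧ b ∈ O ∧ ∀ i ≤ j, b i = q i} := by
          ext x; simp only [Set.mem_ofPred_eq, bprefix_hist]
        refine Set.mem_iUnion.2 ⟨histUpTo q j, ?_⟩
        have hm' : MeagerIn O {b | b ∈ B ∧ b ∈ O ∧ BPrefix b (histUpTo q j)} := by rw [e]; exact hm
        simp only [F, if_pos hm']
        exact ⟨hcB, (h c hcB).1, (bprefix_hist q c j).2 hcq⟩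
      · push Not at hb
        refine ⟨p, hp, k, le_rfl, fun _ _ => rfl, fun b hbB hcon => ?_⟩
        obtain ⟨i, hi, hne⟩ := hb b hbB.1
        exact hne (hcon i hi)
    refine meager_mono ?_ (meager_union h1 (nwd_meager h2))
    rintro b ⟨hb, _⟩
    by_cases hbF : b ∈ ⋃ l, F l
    · exact Or.inl hbF
    · exact Or.inr ⟨hb, hbF⟩
  nf_mono := by
    rintro n m B B' p k hp h _ ⟨q, hq, j, hj, hag, hm⟩
    refine ⟨q, hq, j, hj, hag, meager_mono ?_ hm⟩
    rintro b ⟨hb, hbO, hbq⟩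
    exact ⟨h b hbO (fun i hi => by rw [hbq i (by omega), hag i hi]) hb, hbO, hbq⟩
  nf_empty := by
    intro B p k hp h
    refine ⟨p, hp, k, le_rfl, fun _ _ => rfl, meager_mono ?_ (nwd_meager (nwd_empty _))⟩
    rintro b ⟨hb, hbO, hbq⟩
    exact absurd hb (h b hbO hbq)
  nf_step := by
    rintro n B p q k hp hq hag ⟨q', hq', j, hj, hag', hm⟩
    exact ⟨q', hq', j, by omega, fun i hi => by rw [hag' i (by omega), hag i hi], hm⟩
  nf_trans := by
    rintro n m B B1 p k hp ⟨q, hq, j, hj, hag, hm⟩ h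
    by_cases hb : ∃ b ∈ Outcomes A v0 φE φA, (∀ i ≤ j, b i = q i) ∧ b ∈ B ∧ b ∉ B1
    · obtain ⟨b, hbO, hbq, hbB, hbB1⟩ := hb
      obtain ⟨k', hk', q', hq', j', hj', hag', hm'⟩ := h b hbO
        (fun i hi => by rw [hbq i (by omega), hag i hi]) hbB hbB1
      exact ⟨q', hq', j', by omega, fun i hi => by
        rw [hag' i (by omega), hbq i (by omega), hag i hi], hm'⟩
    · push Not at hb
      refine ⟨q, hq, j, hj, hag, meager_mono ?_ hm⟩
      rintro b ⟨hbB, hbO, hbq⟩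
      exact ⟨hb b hbO hbq hbB, hbO, hbq⟩
  nf_null := by
    intro B p k hp h
    refine ⟨p, hp, k, le_rfl, fun _ _ => rfl, meager_mono ?_ h⟩
    rintro b ⟨hb, hbO, _⟩
    exact ⟨hb, hbO⟩

/-- Baire category for the outcome tree. -/
theorem baire_out (p0 : ℕ → V) (hp0 : p0 ∈ Outcomes A v0 φE φA) (k0 : ℕ)
    (h : MeagerIn (Outcomes A v0 φE φA)
      {b | b ∈ Outcomes A v0 φE φA ∧ ∀ i ≤ k0, b i = p0 i}) : False := by
  set O := Outcomes A v0 φE φA with hO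
  obtain ⟨f, hf, hB⟩ := h
  have hf' := fun n => (nwd_iff O (f n)).1 (hf n)
  choose! Q hQ J hJ hag hav using hf'
  -- nodes
  let N : ℕ → (ℕ → V) × ℕ := fun n => Nat.rec (p0, k0) (fun n x => (Q n x.1 x.2, J n x.1 x.2 + 1)) n
  have hN : ∀ n, N (n + 1) = (Q n (N n).1 (N n).2, J n (N n).1 (N n).2 + 1) := fun n => rfl
  have hNO : ∀ n, (N n).1 ∈ O := by
    intro n
    induction n with
    | zero => exact hp0
    | succ n ih => rw [hN]; exact hQ n _ ih _
  have hlt : ∀ n, (N n).2 < (N (n + 1)).2 := by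
    intro n
    rw [hN]
    have := hJ n _ (hNO n) (N n).2
    simp only; omega
  have hagN : ∀ n, ∀ i ≤ (N n).2, (N (n + 1)).1 i = (N n).1 i := by
    intro n i hi
    rw [hN]; exact hag n _ (hNO n) _ i hi
  have hmono : ∀ n m, n ≤ m → (N n).2 ≤ (N m).2 := by
    intro n m hnm
    exact (strictMono_nat_of_lt_succ (f := fun n => (N n).2) hlt).monotone hnm
  have hagm : ∀ n m, n ≤ m → ∀ i ≤ (N n).2, (N m).1 i = (N n).1 i := by
    intro n m hnm
    induction m, hnm using Nat.le_induction with
    | base => intro i _; rfl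
    | succ m hnm ih =>
      intro i hi
      rw [hagN m i (le_trans hi (hmono n m hnm)), ih i hi]
  have hge : ∀ n, n ≤ (N n).2 := fun n =>
    (strictMono_nat_of_lt_succ (f := fun n => (N n).2) hlt).le_apply
  let b : ℕ → V := fun i => (N i).1 i
  have hb : ∀ n, ∀ i ≤ (N n).2, b i = (N n).1 i := by
    intro n i hi
    rcases Nat.le_total i n with h | h
    · exact (hagm i n h i (hge i)).symm
    · exact hagm n i h i hi
  have hbO : b ∈ O := by
    apply out_closed
    intro k
    exact ⟨(N k).1, hNO k, fun j hj => (hb k j (le_trans hj (hge k))).symm⟩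
  obtain ⟨n, hn⟩ := Set.mem_iUnion.1 (hB ⟨hbO, hb 0⟩)
  refine hav n _ (hNO n) (N n).2 b hn ?_
  intro i hi
  have := hb (n + 1) i (by rw [hN]; simp only; omega)
  rw [this, hN]

end Outc

section Meas
open Filter MeasureTheory

variable {V : Type}

def cyl (l : List V) : Set (ℕ → V) := {p | BPrefix p l}

theorem mem_cyl_hist (p q : ℕ → V) (k : ℕ) : q ∈ cyl (histUpTo p k) ↔ ∀ j ≤ k, q j = p j :=
  bprefix_hist p q k

theorem cyl_meas [MeasurableSpace V] (hdisc : ∀ s : Set V, MeasurableSet s) (l : List V) :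
    MeasurableSet (cyl l) := by
  have : cyl l = ⋂ i : Fin l.length, (fun p : ℕ → V => p i.1) ⁻¹' {l.get i} := by
    ext p; simp [cyl, BPrefix]
  rw [this]
  exact MeasurableSet.iInter (fun i => (measurable_pi_apply i.1) (hdisc _))

theorem cover_lemma [Countable V] [MeasurableSpace V] (hdisc : ∀ s : Set V, MeasurableSet s)
    (ν : Measure (ℕ → V)) (B B0 : Set (ℕ → V)) (c : ENNReal) (L : Set (List V))
    (h : ∀ l ∈ L, ν (B ∩ cyl l) ≤ c * ν (cyl l)) (hB0 : ∀ p ∈ B0, ∃ l ∈ L, p ∈ cyl l) :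
    ∃ C, MeasurableSet C ∧ B0 ⊆ C ∧ (∀ p ∈ C, ∃ l ∈ L, p ∈ cyl l) ∧ ν (B ∩ C) ≤ c * ν C := by
  classical
  let Lm : Set (List V) := {l | l ∈ L ∧ ∀ l' ∈ L, l' <+: l → l' = l}
  have hLm : ∀ l : Lm, (l : List V) ∈ L := fun l => l.2.1
  refine ⟨⋃ l : Lm, cyl l.1, MeasurableSet.iUnion (fun l => cyl_meas hdisc _), ?_, ?_, ?_⟩
  · intro p hp
    have hex : ∃ n, ∃ l ∈ L, p ∈ cyl l ∧ l.length = n := by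
      obtain ⟨l, hl, hpl⟩ := hB0 p hp; exact ⟨_, l, hl, hpl, rfl⟩
    obtain ⟨l, hl, hpl, hn⟩ := Nat.find_spec hex
    refine Set.mem_iUnion.2 ⟨⟨l, hl, fun l' hl' hpre => ?_⟩, hpl⟩
    have h1 := Nat.find_min' hex ⟨l', hl', bprefix_prefix hpl hpre, rfl⟩
    exact hpre.eq_of_length_le (by omega)
  · intro p hp
    obtain ⟨l, hl⟩ := Set.mem_iUnion.1 hp
    exact ⟨l.1, hLm l, hl⟩
  · have hdisj : Pairwise (Function.onFun Disjoint fun l : Lm => cyl l.1) := by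
      intro l l' hne
      rw [Function.onFun, Set.disjoint_left]
      intro p hp hp'
      apply hne
      apply Subtype.ext
      rcases Nat.le_total l.1.length l'.1.length with hh | hh
      · exact l'.2.2 l.1 l.2.1 (bprefix_compar hp hp' hh)
      · exact (l.2.2 l'.1 l'.2.1 (bprefix_compar hp' hp hh)).symm
    rw [Set.inter_iUnion, measure_iUnion hdisj (fun l => cyl_meas hdisc _), ← ENNReal.tsum_mul_left]
    refine (measure_iUnion_le _).trans (ENNReal.tsum_le_tsum fun l => h _ (hLm l))

theorem open_cyl [TopologicalSpace V] [DiscreteTopology V] {U : Set (ℕ → V)} (hU : IsOpen U)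
    {p : ℕ → V} (hp : p ∈ U) : ∃ k0, ∀ k ≥ k0, cyl (histUpTo p k) ⊆ U := by
  rw [isOpen_pi_iff] at hU
  obtain ⟨I, u, hu, hsub⟩ := hU p hp
  refine ⟨I.sup id, fun k hk q hq => hsub ?_⟩
  intro i hi
  rw [mem_cyl_hist] at hq
  have : i ≤ I.sup id := Finset.le_sup (f := id) hi
  rw [hq i (by omega)]
  exact (hu i hi).2

theorem density_meas [Finite V] [MeasurableSpace V] (hdisc : ∀ s : Set V, MeasurableSet s)
    (ν : Measure (ℕ → V)) [IsProbabilityMeasure ν] (B : Set (ℕ → V)) (ε : ℝ) (hε : 0 < ε)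
    (hε1 : ε ≤ 1)
    (h : ∀ p ∈ B, ∃ᶠ k in atTop, ν (B ∩ cyl (histUpTo p k)) ≤
      ENNReal.ofReal (1 - ε) * ν (cyl (histUpTo p k))) : ν B = 0 := by
  letI : TopologicalSpace V := ⊥
  haveI : DiscreteTopology V := ⟨rfl⟩
  haveI : BorelSpace V := ⟨by
    rw [borel_eq_top_of_discrete]
    ext s
    simp [hdisc s]⟩
  have key : ∀ U, IsOpen U → B ⊆ U → ν B ≤ ENNReal.ofReal (1 - ε) * ν U := by
    intro U hU hBU
    obtain ⟨C, hCm, hBC, hCU, hC⟩ := cover_lemma hdisc ν B B (ENNReal.ofReal (1 - ε))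
      {l | cyl l ⊆ U ∧ ν (B ∩ cyl l) ≤ ENNReal.ofReal (1 - ε) * ν (cyl l)} (fun l hl => hl.2) (by
        intro p hp
        obtain ⟨k0, hk0⟩ := open_cyl hU (hBU hp)
        obtain ⟨k, hk, hkk⟩ := ((h p hp).and_eventually (eventually_ge_atTop k0)).exists
        exact ⟨_, ⟨hk0 k hkk, hk⟩, (mem_cyl_hist p p k).2 fun _ _ => rfl⟩)
    have e : B ∩ C = B := Set.inter_eq_left.2 hBC
    rw [e] at hC
    refine hC.trans ?_
    gcongr
    intro p hp
    obtain ⟨l, hl, hpl⟩ := hCU p hp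
    exact hl.1 hpl
  by_contra hne
  have hfin : ν B ≠ ⊤ := measure_ne_top ν B
  have hpos : 0 < (ν B).toReal := ENNReal.toReal_pos hne hfin
  set b := (ν B).toReal with hb
  have hlt : ν B < ν B + ENNReal.ofReal (ε * b / 2) := by
    apply ENNReal.lt_add_right hfin
    simp only [ne_eq, ENNReal.ofReal_eq_zero, not_le]; positivity
  obtain ⟨U, hBU, hU, hUlt⟩ := Set.exists_isOpen_lt_of_lt B _ hlt
  have h1 := key U hU hBU
  have h2 : b ≤ (1 - ε) * (ν U).toReal := by
    have := ENNReal.toReal_mono (by finiteness) h1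
    rwa [ENNReal.toReal_mul, ENNReal.toReal_ofReal (by linarith)] at this
  have h3 : (ν U).toReal ≤ b + ε * b / 2 := by
    have := ENNReal.toReal_mono (by finiteness) hUlt.le
    rwa [ENNReal.toReal_add hfin (by finiteness), ENNReal.toReal_ofReal (by positivity)] at this
  have h4 : (1 - ε) * (ν U).toReal ≤ (1 - ε) * (b + ε * b / 2) :=
    mul_le_mul_of_nonneg_left h3 (by linarith)
  nlinarith [mul_pos hε hpos, mul_pos hε (mul_pos hε hpos)]

theorem conv_iff [MeasurableSpace V] (ν : Measure (ℕ → V)) [IsProbabilityMeasure ν]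
    (X Y : Set (ℕ → V)) (c : ℝ) (hc : 0 ≤ c) :
    ν X ≤ ENNReal.ofReal c * ν Y ↔ ν.real X ≤ c * ν.real Y := by
  unfold Measure.real
  rw [← ENNReal.toReal_le_toReal (by finiteness) (by finiteness), ENNReal.toReal_mul,
    ENNReal.toReal_ofReal hc]

variable {A : Arena V} {v0 : V} {φE φA : List V → V}

def measCtx [Finite V] [MeasurableSpace V] (hdisc : ∀ s : Set V, MeasurableSet s)
    (hE : IsStrategyFor A Player.E φE) (hA : IsStrategyFor A Player.A φA)
    (v0 : V) (ν : Measure (ℕ → V)) (hν : IsProbabilityMeasure ν)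
    (η : ℝ) (hη : 0 < η) (hη1 : η ≤ 1)
    (hstep : ∀ p ∈ Outcomes A v0 φE φA, ∀ k,
      η * ν.real (cyl (histUpTo p k)) ≤ ν.real (cyl (histUpTo p (k + 1)))) : Ctx A where
  O := Outcomes A v0 φE φA
  edge := fun p hp k => hp.1.2 k
  branch := out_branch hE hA
  Null := fun B => ν (B ∩ Outcomes A v0 φE φA) = 0
  NF := fun n B p k => ν ((B ∩ Outcomes A v0 φE φA) ∩ cyl (histUpTo p k)) ≤
    ENNReal.ofReal (1 - η ^ n) * ν (cyl (histUpTo p k))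
  null_mono := fun _ _ h h' => measure_mono_null (Set.inter_subset_inter_left _ h) h'
  null_iUnion := by
    intro f hf
    rw [Set.iUnion_inter]
    exact measure_iUnion_null hf
  density := by
    intro n B h
    have e : B ∩ Outcomes A v0 φE φA = B := Set.inter_eq_left.2 (fun p hp => (h p hp).1)
    rw [e] at h ⊢
    exact density_meas hdisc ν B (η ^ n) (by positivity) (pow_le_one₀ hη.le hη1)
      (fun p hp => (h p hp).2)
  nf_mono := by
    intro n m B B' p k hp h hnm hN
    refine (measure_mono ?_).trans (hN.trans ?_)
    · rintro q ⟨⟨hq, hqO⟩, hqc⟩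
      exact ⟨⟨h q hqO ((mem_cyl_hist p q k).1 hqc) hq, hqO⟩, hqc⟩
    · gcongr ENNReal.ofReal ?_ * _
      have := pow_le_pow_of_le_one hη.le hη1 hnm
      linarith
  nf_empty := by
    intro B p k hp h
    have : (B ∩ Outcomes A v0 φE φA) ∩ cyl (histUpTo p k) = ∅ := by
      rw [Set.eq_empty_iff_forall_notMem]
      rintro q ⟨⟨hq, hqO⟩, hqc⟩
      exact h q hqO ((mem_cyl_hist p q k).1 hqc) hq
    rw [this]; simp
  nf_step := by
    intro n B p q k hp hq hag h
    have h0 : η ^ n ≤ 1 := pow_le_one₀ hη.le hη1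
    have h0' : η ^ (n + 1) ≤ 1 := pow_le_one₀ hη.le hη1
    rw [conv_iff ν _ _ _ (by linarith)] at h ⊢
    have hs := hstep q hq k
    rw [hist_congr hag] at hs
    have hsub : cyl (histUpTo q (k + 1)) ⊆ cyl (histUpTo p k) := by
      intro b hb
      rw [mem_cyl_hist] at hb ⊢
      intro j hj
      rw [hb j (by omega), hag j hj]
    set O := Outcomes A v0 φE φA
    have h1 : ν.real ((B ∩ O) ∩ cyl (histUpTo p k)) ≤ ν.real ((B ∩ O) ∩ cyl (histUpTo q (k + 1))) +
        ν.real (cyl (histUpTo p k) \ cyl (histUpTo q (k + 1))) := by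
      refine (measureReal_mono ?_).trans (measureReal_union_le _ _)
      rintro b ⟨hb, hbc⟩
      by_cases hc : b ∈ cyl (histUpTo q (k + 1))
      · exact Or.inl ⟨hb, hc⟩
      · exact Or.inr ⟨hbc, hc⟩
    rw [measureReal_sdiff hsub (cyl_meas hdisc _)] at h1
    have h2 : η ^ n * (η * ν.real (cyl (histUpTo p k))) ≤
      η ^ n * ν.real (cyl (histUpTo q (k + 1))) := mul_le_mul_of_nonneg_left hs (by positivity)
    rw [pow_succ]
    nlinarith
  nf_trans := by
    intro n m B B1 p k hp h1 h2
    set O := Outcomes A v0 φE φA with hO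
    have hn1 : η ^ n ≤ 1 := pow_le_one₀ hη.le hη1
    have hm1 : η ^ m ≤ 1 := pow_le_one₀ hη.le hη1
    have hnm1 : η ^ (n + m) ≤ 1 := pow_le_one₀ hη.le hη1
    obtain ⟨C, hCm, hBC, hCU, hC⟩ := cover_lemma hdisc ν (B ∩ O)
      (((B ∩ O) ∩ cyl (histUpTo p k)) \ B1) (ENNReal.ofReal (1 - η ^ m))
      {l | cyl l ⊆ cyl (histUpTo p k) ∧
        ν ((B ∩ O) ∩ cyl l) ≤ ENNReal.ofReal (1 - η ^ m) * ν (cyl l)} (fun l hl => hl.2) (by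
        rintro q ⟨⟨⟨hqB, hqO⟩, hqc⟩, hq1⟩
        rw [mem_cyl_hist] at hqc
        obtain ⟨k', hk', hk'N⟩ := h2 q hqO hqc hqB hq1
        refine ⟨histUpTo q k', ⟨?_, hk'N⟩, (mem_cyl_hist q q k').2 fun _ _ => rfl⟩
        intro b hb
        rw [mem_cyl_hist] at hb ⊢
        intro j hj
        rw [hb j (by omega), hqc j hj])
    rw [conv_iff ν _ _ _ (by linarith)] at h1 hC ⊢
    have hCsub : C ⊆ cyl (histUpTo p k) := by
      intro b hb
      obtain ⟨l, hl, hbl⟩ := hCU b hb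
      exact hl.1 hbl
    set K := cyl (histUpTo p k)
    have a1 : ν.real ((B ∩ O) ∩ K) ≤ ν.real ((B ∩ O) ∩ C) + ν.real (((B1 ∩ O) ∩ K) \ C) := by
      refine (measureReal_mono ?_).trans (measureReal_union_le _ _)
      rintro b ⟨hb, hbc⟩
      by_cases hc : b ∈ C
      · exact Or.inl ⟨hb, hc⟩
      · refine Or.inr ⟨⟨⟨?_, hb.2⟩, hbc⟩, hc⟩
        by_contra hb1
        exact hc (hBC ⟨⟨hb, hbc⟩, hb1⟩)
    have a2 : ν.real (((B1 ∩ O) ∩ K) \ C) ≤ ν.real ((B1 ∩ O) ∩ K) := measureReal_mono Set.sdiff_subset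
    have a3 : ν.real (((B1 ∩ O) ∩ K) \ C) ≤ ν.real K - ν.real C := by
      rw [← measureReal_sdiff hCsub hCm]
      exact measureReal_mono (Set.sdiff_subset_sdiff_left Set.inter_subset_right)
    rw [pow_add]
    set x := ν.real (((B1 ∩ O) ∩ K) \ C)
    set z := η ^ m
    set e := η ^ n
    have hz : 0 ≤ z := by positivity
    have a4 : x ≤ (1 - e) * ν.real K := a2.trans h1
    nlinarith [mul_le_mul_of_nonneg_left a4 hz,
      mul_le_mul_of_nonneg_left a3 (show 0 ≤ 1 - z by linarith)]
  nf_null := by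
    intro B p k hp h
    rw [measure_mono_null Set.inter_subset_left h]
    exact zero_le

theorem out_meas [Countable V] [MeasurableSpace V] (hdisc : ∀ s : Set V, MeasurableSet s) :
    MeasurableSet (Outcomes A v0 φE φA) := by
  classical
  have : Outcomes A v0 φE φA = ⋂ l : {l : List V // l ∉ PrefixesOf (Outcomes A v0 φE φA)},
      (cyl l.1)ᶜ := by
    ext p
    simp only [Set.mem_iInter, Set.mem_compl_iff]
    constructor
    · intro hp l hl
      exact l.2 ⟨p, hp, hl⟩
    · intro h
      apply out_closed
      intro k
      by_contra hcon
      refine h ⟨histUpTo p k, ?_⟩ ((mem_cyl_hist p p k).2 fun _ _ => rfl)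
      rintro ⟨q, hq, hqp⟩
      exact hcon ⟨q, hq, (bprefix_hist p q k).1 hqp⟩
  rw [this]
  exact MeasurableSet.iInter (fun l => (cyl_meas hdisc _).compl)

theorem coneWeight_succ (d : V → V → ENNReal) (p : ℕ → V) (k : ℕ) :
    coneWeight A d v0 (histUpTo p (k + 1)) = coneWeight A d v0 (histUpTo p k) *
      (if A.owner (p k) = Player.N then d (p k) (p (k + 1)) else 1) := by
  have hg : ∀ (m i : ℕ), i ≤ m → (histUpTo p m).getD i v0 = p i := by
    intro m i hi
    have hl : i < (histUpTo p m).length := by rw [hist_length]; omega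
    rw [List.getD_eq_getElem _ _ hl, hist_get]
  unfold coneWeight
  simp only [hist_length, Nat.add_sub_cancel]
  rw [Finset.prod_range_succ]
  congr 1
  · apply Finset.prod_congr rfl
    intro i hi
    rw [Finset.mem_range] at hi
    rw [hg _ _ (by omega), hg _ _ (by omega), hg _ _ (by omega), hg _ _ (by omega)]
  · rw [hg _ _ (by omega), hg _ _ (by omega)]

theorem eta_ex [Fintype V] (A : Arena V) (d : V → V → ENNReal)
    (hd1 : ∀ v, A.owner v = Player.N → (∑' w : V, d v w) = 1)
    (hdpos : ∀ v, A.owner v = Player.N → ∀ w, A.Edge v w → 0 < d v w) :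
    ∃ η : ℝ, 0 < η ∧ η ≤ 1 ∧ ∀ v, A.owner v = Player.N → ∀ w, A.Edge v w → η ≤ (d v w).toReal := by
  classical
  let f : V × V → ℝ := fun x => if A.owner x.1 = Player.N ∧ A.Edge x.1 x.2 then
    (d x.1 x.2).toReal else 1
  have hf : ∀ x, 0 < f x := by
    intro x
    by_cases hx : A.owner x.1 = Player.N ∧ A.Edge x.1 x.2
    · simp only [f, if_pos hx]
      refine ENNReal.toReal_pos (hdpos _ hx.1 _ hx.2).ne' ?_
      have := (ENNReal.le_tsum x.2).trans_eq (hd1 x.1 hx.1)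
      exact ne_top_of_le_ne_top ENNReal.one_ne_top this
    · simp [f, if_neg hx]
  by_cases hV : Nonempty (V × V)
  · obtain ⟨x, hx⟩ := Finite.exists_min f
    refine ⟨min (f x) 1, lt_min (hf x) one_pos, min_le_right _ _, fun v ho w hw => ?_⟩
    refine (min_le_left _ _).trans ((hx (v, w)).trans_eq ?_)
    simp [f, ho, hw]
  · exact ⟨1, one_pos, le_rfl, fun v _ w _ => absurd ⟨(v, w)⟩ hV⟩

end Meas

section Final
open Filter MeasureTheory

def gameOf {V D : Type} (A : Arena V) (Ω : Set (ℕ → V)) (d0 : D) (upd : D → V → D)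
    (c : D → V → ℕ)
    (h : ∀ (w : ℕ → V) (r : ℕ → D), r 0 = d0 → (∀ k, r (k+1) = upd (r k) (w k)) → ∀ n : ℕ,
      (∃ᶠ k in atTop, c (r k) (w k) = n) → (∀ᶠ k in atTop, n ≤ c (r k) (w k)) →
      (w ∈ Ω ↔ Even n)) : PGame V (D × V) where
  A := A
  s0 := fun v => (d0, v)
  nxt := fun s w => (upd s.1 s.2, w)
  lab := Prod.snd
  lab_s0 := fun _ => rfl
  lab_nxt := fun _ _ => rfl
  col := fun s => c s.1 s.2
  Om := Ω
  par := by
    intro p n h1 h2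
    set f := stOf (fun v : V => (d0, v)) (fun s w => (upd s.1 s.2, w)) p with hf
    have e : ∀ k, (f k).2 = p k := by
      intro k; cases k <;> rfl
    refine h p (fun k => (f k).1) rfl (fun k => ?_) n ?_ ?_
    · show upd (f k).1 (f k).2 = _
      rw [e]
    · exact h1.mono fun k hk => by rw [← e k]; exact hk
    · exact h2.mono fun k hk => by rw [← e k]; exact hk

variable {V S : Type}

def stL (G : PGame V S) (v0 : V) : List V → S
  | [] => G.s0 v0
  | v :: t => t.foldl G.nxt (G.s0 v)

theorem stL_hist (G : PGame V S) (v0 : V) (p : ℕ → V) (k : ℕ) :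
    stL G v0 (histUpTo p k) = G.st p k := by
  induction k with
  | zero => rw [hist_zero]; rfl
  | succ k ih =>
    rw [hist_succ, PGame.st_succ, ← ih]
    have hne : histUpTo p k ≠ [] := by
      intro h
      have := hist_length p k
      rw [h] at this; simp at this
    cases hl : histUpTo p k with
    | nil => exact absurd hl hne
    | cons v t => simp [stL, List.foldl_append]

theorem strat_ex (G : PGame V S) (v0 : V) (σ : S → V) :
    ∃ φ : List V → V, (∀ P, IsStrategyFor G.A P φ) ∧
      ∀ p k, G.Ed (G.st p k) (σ (G.st p k)) → φ (histUpTo p k) = σ (G.st p k) := by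
  classical
  choose sc hsc using G.A.no_dead
  refine ⟨fun l => if G.A.Edge (l.getLastD v0) (σ (stL G v0 l)) then σ (stL G v0 l) else
    sc (l.getLastD v0), fun P l v _ => ?_, fun p k h => ?_⟩
  · have : (l ++ [v]).getLastD v0 = v := by simp
    simp only [this]
    split_ifs with h
    · exact h
    · exact hsc v
  · have hl : (histUpTo p k).getLastD v0 = p k := by
      obtain ⟨l, hl⟩ := hist_last p k
      rw [hl]; simp
    simp only [hl, stL_hist]
    unfold PGame.Ed at h
    rw [G.lab_st] at h
    rw [if_pos h]

theorem winE {G : PGame V S} {v0 : V} {WE WA : Set S} {σE σA : S → V} {n : ℕ}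
    (h : G.IsSol Set.univ WE WA σE σA n) (h0 : G.s0 v0 ∈ WE) {φE φA : List V → V}
    (hφ : ∀ p k, G.Ed (G.st p k) (σE (G.st p k)) → φE (histUpTo p k) = σE (G.st p k))
    {p : ℕ → V} (hp : p ∈ Outcomes G.A v0 φE φA) (k : ℕ) :
    G.st p k ∈ WE ∧ (G.ow (G.st p k) = Player.E → p (k + 1) = σE (G.st p k)) := by
  have ho : ∀ k, G.ow (G.st p k) = G.A.owner (p k) := fun k => by
    unfold PGame.ow; rw [G.lab_st]
  have hed : ∀ k, G.Ed (G.st p k) (p (k + 1)) := fun k => by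
    unfold PGame.Ed; rw [G.lab_st]; exact hp.1.2 k
  have mv : ∀ k, G.st p k ∈ WE → G.ow (G.st p k) = Player.E → p (k + 1) = σE (G.st p k) := by
    intro k hk hok
    rw [hp.2.1 k (by rw [← ho]; exact hok)]
    exact hφ p k (h.e1E _ hk hok).1
  have hst : G.st p k ∈ WE := by
    induction k with
    | zero =>
      show G.s0 (p 0) ∈ WE
      rw [hp.1.1]; exact h0
    | succ k ih =>
      rcases PGame.ow_cases (G := G) (G.st p k) with hok | hok | hok
      · rw [PGame.st_succ, mv k ih hok]
        exact (h.e1E _ ih hok).2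
      · exact h.e1A _ ih hok _ (hed k) (Set.mem_univ _)
      · exact h.e1N _ ih hok _ (hed k)
  exact ⟨hst, mv k hst⟩

end Final

/-- In a game with Nature on a finite arena with an ω-regular
winning condition, where each Nature vertex carries a probability distribution
over its successors giving positive probability to each of them (and `μ` denotes
the induced probability measures on plays, characterised by their values on
cones), Éloïse has an almost-surely winning strategy iff she has a
topologically-good strategy. -/
theorem stmt9 {V : Type} [Fintype V] [MeasurableSpace V]
    (hdisc : ∀ s : Set V, MeasurableSet s)
    (A : Arena V) (v0 : V) (Ω : Set (ℕ → V)) (hΩ : OmegaRegularWC Ω)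
    (d : V → V → ENNReal)
    (hd1 : ∀ v, A.owner v = Player.N → (∑' w : V, d v w) = 1)
    (hdpos : ∀ v, A.owner v = Player.N → ∀ w, A.Edge v w → 0 < d v w)
    (hdsupp : ∀ v, A.owner v = Player.N → ∀ w, ¬ A.Edge v w → d v w = 0)
    (μ : (List V → V) → (List V → V) → MeasureTheory.Measure (ℕ → V))
    (hμprob : ∀ φE φA, IsStrategyFor A Player.E φE → IsStrategyFor A Player.A φA →
      MeasureTheory.IsProbabilityMeasure (μ φE φA) ∧
      μ φE φA (Outcomes A v0 φE φA) = 1)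
    (hμcone : ∀ φE φA, IsStrategyFor A Player.E φE → IsStrategyFor A Player.A φA →
      ∀ l ∈ PrefixesOf (Outcomes A v0 φE φA),
        μ φE φA {p | BPrefix p l} = coneWeight A d v0 l) :
    (∃ φE, IsStrategyFor A Player.E φE ∧
      (⨅ φA : AStrat A, μ φE φA.1 Ω) = 1) ↔
    (∃ φE, IsStrategyFor A Player.E φE ∧ TopGood A v0 Ω φE) := by
  classical
  obtain ⟨D, hDfin, d0, upd, c, hpar⟩ := wc_det Ω hΩ
  obtain ⟨η, hη, hη1, hηd⟩ := eta_ex A d hd1 hdpos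
  have hVne : Nonempty V := ⟨v0⟩
  let G : PGame V (D × V) := gameOf A Ω d0 upd c hpar
  have hsub : G.Sub Set.univ := by
    intro s _
    refine ⟨fun _ => ?_, fun _ _ _ => Set.mem_univ _⟩
    obtain ⟨w, hw⟩ := A.no_dead (G.lab s)
    exact ⟨w, hw, Set.mem_univ _⟩
  obtain ⟨WE, WA, σE, σA, n, hsol⟩ := PGame.solv_all (G := G) _ Set.univ le_rfl hsub
  -- measure steps
  have hstep : ∀ φE φA, IsStrategyFor A Player.E φE → IsStrategyFor A Player.A φA →
      ∀ p ∈ Outcomes A v0 φE φA, ∀ k, η * (μ φE φA).real (cyl (histUpTo p k)) ≤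
        (μ φE φA).real (cyl (histUpTo p (k + 1))) := by
    intro φE φA hE hA p hp k
    have hc : ∀ j, (μ φE φA) (cyl (histUpTo p j)) = coneWeight A d v0 (histUpTo p j) := fun j =>
      hμcone φE φA hE hA _ ⟨p, hp, (bprefix_hist p p j).2 fun _ _ => rfl⟩
    unfold MeasureTheory.Measure.real
    rw [hc, hc, coneWeight_succ, ENNReal.toReal_mul, mul_comm]
    refine mul_le_mul_of_nonneg_left ?_ ENNReal.toReal_nonneg
    split_ifs with ho
    · exact hηd _ ho _ (hp.1.2 k)
    · simpa using hη1
  have hs0 : G.s0 v0 ∈ WE ∪ WA := by rw [hsol.un]; exact Set.mem_univ _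
  rcases hs0 with h0 | h0
  · -- Éloïse wins
    obtain ⟨φE, hφE, hφ⟩ := strat_ex G v0 σE
    have hE : IsStrategyFor A Player.E φE := hφE _
    have hbad : ∀ (φA : List V → V) (C : Ctx A), C.O = Outcomes A v0 φE φA →
        Outcomes A v0 φE φA \ Ω ⊆ G.badE C WE σE := by
      rintro φA C hC p ⟨hp, hpΩ⟩
      refine ⟨by rw [hC]; exact hp, ⟨0, fun k _ => winE hsol h0 hφ (φA := φA) hp k⟩, hpΩ⟩
    refine ⟨fun _ => ⟨φE, hE, fun φA hA => ?_⟩, fun _ => ⟨φE, hE, ?_⟩⟩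
    · have h1 := hsol.e2 (topCtx hE hA v0)
      refine meager_mono (Set.subset_inter (hbad φA (topCtx hE hA v0) rfl) ?_) h1
      exact Set.sdiff_subset
    · have hall : ∀ φA : AStrat A, μ φE φA.1 Ω = 1 := by
        rintro ⟨φA, hA⟩
        obtain ⟨hpr, hO⟩ := hμprob φE φA hE hA
        let C := measCtx hdisc hE hA v0 (μ φE φA) hpr η hη hη1 (hstep φE φA hE hA)
        have h1 : μ φE φA (G.badE C WE σE ∩ Outcomes A v0 φE φA) = 0 := hsol.e2 C
        have h2 : μ φE φA (Outcomes A v0 φE φA \ Ω) = 0 :=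
          MeasureTheory.measure_mono_null (Set.subset_inter (hbad φA C rfl) Set.sdiff_subset) h1
        apply le_antisymm MeasureTheory.prob_le_one
        calc (1 : ENNReal) = μ φE φA (Outcomes A v0 φE φA) := hO.symm
          _ ≤ μ φE φA (Ω ∪ (Outcomes A v0 φE φA \ Ω)) := by
              apply MeasureTheory.measure_mono
              intro p hp
              by_cases hpΩ : p ∈ Ω
              · exact Or.inl hpΩ
              · exact Or.inr ⟨hp, hpΩ⟩
          _ ≤ μ φE φA Ω + μ φE φA (Outcomes A v0 φE φA \ Ω) := MeasureTheory.measure_union_le _ _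
          _ = μ φE φA Ω := by rw [h2, add_zero]
      have : Nonempty (AStrat A) := ⟨⟨φE, hφE _⟩⟩
      simp only [hall]
      exact ciInf_const
  · -- Abélard wins
    obtain ⟨φA, hφA, hφ⟩ := strat_ex G v0 σA
    have hA : IsStrategyFor A Player.A φA := hφA _
    have hconf : ∀ (φE : List V → V) (C : Ctx A), C.O = Outcomes A v0 φE φA →
        G.Conf C WA σA := by
      intro φE C hC p hp k hk ho
      rw [hC] at hp
      rw [hp.2.2 k (by unfold PGame.ow at ho; rw [G.lab_st] at ho; exact ho)]
      exact hφ p k (hsol.a1 _ hk ho).1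
    have hnf : ∀ (φE : List V → V) (C : Ctx A), C.O = Outcomes A v0 φE φA →
        ∀ p ∈ Outcomes A v0 φE φA, C.NF n Ω p 0 := by
      intro φE C hC p hp
      have hst : G.st p 0 ∈ WA := by
        show G.s0 (p 0) ∈ WA
        rw [hp.1.1]; exact h0
      have hpC : p ∈ C.O := by rw [hC]; exact hp
      refine C.nf_mono _ _ _ _ _ _ hpC ?_ le_rfl (hsol.a2 C (hconf φE C hC) p hpC 0 hst)
      intro q hq _ hqΩ
      by_cases hall : ∀ k ≥ 0, G.st q k ∈ WA
      · exact Or.inl ⟨hall, hqΩ⟩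
      · obtain ⟨k, hk, hk1, hk2⟩ := G.first_exit WA q 0 hall
        exact Or.inr ⟨k, hk, Set.mem_univ _, hk1, hk2⟩
    constructor
    · rintro ⟨φE, hE, hinf⟩
      exfalso
      obtain ⟨hpr, hO⟩ := hμprob φE φA hE hA
      obtain ⟨p, hp⟩ := out_nonempty (v0 := v0) hE hA
      let C := measCtx hdisc hE hA v0 (μ φE φA) hpr η hη hη1 (hstep φE φA hE hA)
      have h1 : μ φE φA ((Ω ∩ Outcomes A v0 φE φA) ∩ cyl (histUpTo p 0)) ≤
        ENNReal.ofReal (1 - η ^ n) * μ φE φA (cyl (histUpTo p 0)) := hnf φE C rfl p hp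
      have h2 : (1 : ENNReal) ≤ μ φE φA Ω := by
        rw [← hinf]; exact iInf_le (fun φA : AStrat A => μ φE φA.1 Ω) ⟨φA, hA⟩
      have h3 : μ φE φA (Outcomes A v0 φE φA)ᶜ = 0 := by
        rw [MeasureTheory.prob_compl_eq_zero_iff (out_meas hdisc)]; exact hO
      have h4 : μ φE φA Ω ≤ ENNReal.ofReal (1 - η ^ n) := by
        calc μ φE φA Ω ≤ μ φE φA (((Ω ∩ Outcomes A v0 φE φA) ∩ cyl (histUpTo p 0)) ∪
              (Outcomes A v0 φE φA)ᶜ) := by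
              apply MeasureTheory.measure_mono
              intro q hq
              by_cases hqO : q ∈ Outcomes A v0 φE φA
              · refine Or.inl ⟨⟨hq, hqO⟩, ?_⟩
                rw [mem_cyl_hist]
                intro j hj
                have : j = 0 := by omega
                subst this
                rw [hqO.1.1, hp.1.1]
              · exact Or.inr hqO
          _ ≤ _ := MeasureTheory.measure_union_le _ _
          _ ≤ ENNReal.ofReal (1 - η ^ n) * μ φE φA (cyl (histUpTo p 0)) := by
              rw [h3, add_zero]; exact h1
          _ ≤ ENNReal.ofReal (1 - η ^ n) * 1 := by
              gcongr
              exact MeasureTheory.prob_le_one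
          _ = _ := mul_one _
      have h5 := h2.trans h4
      have h6 : ENNReal.ofReal (1 - η ^ n) < 1 := by
        rw [ENNReal.ofReal_lt_one]
        have : 0 < η ^ n := by positivity
        linarith
      exact absurd h5 (not_le.2 h6)
    · rintro ⟨φE, hE, hgood⟩
      exfalso
      obtain ⟨p, hp⟩ := out_nonempty (v0 := v0) hE hA
      obtain ⟨q, hq, j, _, _, hm⟩ := hnf φE (topCtx hE hA v0) rfl p hp
      refine baire_out q hq j (meager_mono ?_ (meager_union hm (hgood φA hA)))
      rintro b ⟨hb, hbq⟩
      by_cases hbΩ : b ∈ Ω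
      · exact Or.inl ⟨hbΩ, hb, hbq⟩
      · exact Or.inr ⟨hb, hbΩ⟩
end

section
/- For any parity tree automaton A over A-labelled complete binary trees, both the language L_{unc}(A) of trees admitting a run with uncountably many accepting branches and the language L_{cocount}(A) of trees admitting a run with at most countably many rejecting branches are regular tree languages. -/
/-- A parity tree automaton over the alphabet `Alph`: finitely many states, an
initial state, a transition relation and a colouring of the states. -/
structure PTA (Alph : Type) : Type 1 where
  Q : Type
  finQ : Finite Q
  qini : Q
  delta : Set (Q × Alph × Q × Q)
  col : Q → ℕ

/-- The prefix of length `n` of the branch `π` of the complete binary tree. -/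
def prefList (π : ℕ → Bool) (n : ℕ) : List Bool :=
  List.ofFn (fun j : Fin n => π j.1)

/-- `ρ` is a run of the automaton `M` over the complete binary tree `t`. -/
def IsRun {Alph : Type} (M : PTA Alph) (t : List Bool → Alph) (ρ : List Bool → M.Q) : Prop :=
  ρ [] = M.qini ∧ ∀ u : List Bool, (ρ u, t u, ρ (u ++ [false]), ρ (u ++ [true])) ∈ M.delta

/-- The branch `π` is accepting in the run `ρ`: the least colour occurring
infinitely often along it is even. -/
def AcceptingBranch {Alph : Type} (M : PTA Alph) (ρ : List Bool → M.Q) (π : ℕ → Bool) : Prop :=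
  Even (sInf {c | {n | M.col (ρ (prefList π n)) = c}.Infinite})

/-- The (classical) language of `M`: trees admitting a run all of whose branches are
accepting. -/
def PTALang {Alph : Type} (M : PTA Alph) : Set (List Bool → Alph) :=
  {t | ∃ ρ, IsRun M t ρ ∧ ∀ π, AcceptingBranch M ρ π}

/-- A regular tree language: the language of some parity tree automaton. -/
def RegularTreeLang {Alph : Type} (L : Set (List Bool → Alph)) : Prop :=
  ∃ M : PTA Alph, L = PTALang M

/-- `L_{unc}(M)`: trees admitting a run with uncountably many accepting branches. -/
def LUnc {Alph : Type} (M : PTA Alph) : Set (List Bool → Alph) :=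
  {t | ∃ ρ, IsRun M t ρ ∧ ¬ (Set.Countable {π : ℕ → Bool | AcceptingBranch M ρ π})}

/-- `L_{cocount}(M)`: trees admitting a run with at most countably many rejecting
branches. -/
def LCoCount {Alph : Type} (M : PTA Alph) : Set (List Bool → Alph) :=
  {t | ∃ ρ, IsRun M t ρ ∧ Set.Countable {π : ℕ → Bool | ¬ AcceptingBranch M ρ π}}

/-! ## helper lemmas -/

open Filter

theorem pl_succ (π : ℕ → Bool) (n : ℕ) : prefList π (n+1) = prefList π n ++ [π n] := by
  unfold prefList
  rw [List.ofFn_succ']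
  simp

theorem pl_len (π : ℕ → Bool) (n : ℕ) : (prefList π n).length = n := by
  simp [prefList]

theorem pl_inj {π π' : ℕ → Bool} {n : ℕ} (h : prefList π n = prefList π' n) :
    ∀ k < n, π k = π' k := by
  intro k hk
  have := List.ofFn_injective h
  exact congrFun this ⟨k, hk⟩

theorem pl_congr {π π' : ℕ → Bool} {n : ℕ} (h : ∀ k < n, π k = π' k) :
    prefList π n = prefList π' n := by
  unfold prefList
  congr 1
  funext j
  exact h j.1 j.2

theorem pl_zero (π : ℕ → Bool) : prefList π 0 = [] := by simp [prefList]

theorem exists_follow (P : List Bool → Prop) (R : List Bool → Bool → Prop) (u : List Bool)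
    (hu : P u) (h : ∀ u, P u → ∃ b, P (u ++ [b]) ∧ R u b) :
    ∃ π, prefList π u.length = u ∧
      ∀ n ≥ u.length, P (prefList π n) ∧ R (prefList π n) (π n) := by
  have h' : ∀ u, ∃ b, P u → P (u ++ [b]) ∧ R u b := by
    intro u
    by_cases hP : P u
    · obtain ⟨b, hb⟩ := h u hP
      exact ⟨b, fun _ => hb⟩
    · exact ⟨true, fun h => absurd h hP⟩
  choose g hg using h'
  let s : ℕ → List Bool := fun k => Nat.rec u (fun _ l => l ++ [g l]) k
  have s0 : s 0 = u := rfl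
  have ss : ∀ k, s (k+1) = s k ++ [g (s k)] := fun k => rfl
  let π : ℕ → Bool := fun n => if h : n < u.length then u[n] else g (s (n - u.length))
  have hπ0 : prefList π u.length = u := by
    apply List.ext_getElem
    · simp [prefList]
    · intro i h1 h2
      simp [prefList, π]
  have hπ : ∀ k, prefList π (u.length + k) = s k := by
    intro k
    induction k with
    | zero => exact hπ0
    | succ k ih =>
      rw [← add_assoc, pl_succ, ih, ss]
      simp [π]
  have hP : ∀ k, P (s k) := by
    intro k
    induction k with
    | zero => exact hu
    | succ k ih => rw [ss]; exact (hg _ ih).1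
  refine ⟨π, hπ0, fun n hn => ?_⟩
  obtain ⟨k, rfl⟩ := Nat.exists_eq_add_of_le hn
  rw [hπ]
  refine ⟨hP k, ?_⟩
  have : π (u.length + k) = g (s k) := by simp [π]
  rw [this]
  exact (hg _ (hP k)).2

theorem exists_label {S : Type} (Inv : List Bool → S → Prop)
    (R : List Bool → S → (Bool → S) → Prop) (x0 : S) (h0 : Inv [] x0)
    (h : ∀ u x, Inv u x → ∃ m' : Bool → S, (∀ b, Inv (u ++ [b]) (m' b)) ∧ R u x m') :
    ∃ F : List Bool → S, F [] = x0 ∧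
      ∀ u, Inv u (F u) ∧ R u (F u) (fun b => F (u ++ [b])) := by
  have h' : ∀ u x, ∃ m' : Bool → S, Inv u x → (∀ b, Inv (u ++ [b]) (m' b)) ∧ R u x m' := by
    intro u x
    by_cases hP : Inv u x
    · obtain ⟨b, hb⟩ := h u x hP
      exact ⟨b, fun _ => hb⟩
    · exact ⟨fun _ => x, fun h => absurd h hP⟩
  choose g hg using h'
  let G : List Bool → S := fun l => List.rec x0 (fun b r y => g r.reverse y b) l
  let F : List Bool → S := fun u => G u.reverse
  have F0 : F [] = x0 := rfl
  have Fs : ∀ u b, F (u ++ [b]) = g u (F u) b := by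
    intro u b
    have : F (u ++ [b]) = G (b :: u.reverse) := by simp [F]
    rw [this]
    change g u.reverse.reverse (G u.reverse) b = _
    rw [List.reverse_reverse]
  have hInv : ∀ u, Inv u (F u) := by
    intro u
    induction u using List.reverseRecOn with
    | nil => exact h0
    | append_singleton u b ih => rw [Fs]; exact (hg u _ ih).1 b
  refine ⟨F, F0, fun u => ⟨hInv u, ?_⟩⟩
  have : (fun b => F (u ++ [b])) = g u (F u) := by funext b; exact Fs u b
  rw [this]
  exact (hg u _ (hInv u)).2

theorem countable_follow (δ : List Bool → Bool) :
    Set.Countable {π : ℕ → Bool | ∀ᶠ n in atTop, π n = δ (prefList π n)} := by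
  have : {π : ℕ → Bool | ∀ᶠ n in atTop, π n = δ (prefList π n)} ⊆
      ⋃ u : List Bool, {π | prefList π u.length = u ∧ ∀ n ≥ u.length, π n = δ (prefList π n)} := by
    intro π hπ
    obtain ⟨N, hN⟩ := eventually_atTop.1 hπ
    refine Set.mem_iUnion.2 ⟨prefList π N, ?_⟩
    simp only [Set.mem_ofPred_eq, pl_len]
    exact ⟨trivial, hN⟩
  refine Set.Countable.mono this (Set.countable_iUnion fun u => ?_)
  apply Set.Subsingleton.countable
  rintro π ⟨h1, h2⟩ π' ⟨h1', h2'⟩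
  have key : ∀ k, prefList π (u.length + k) = prefList π' (u.length + k) := by
    intro k
    induction k with
    | zero => simp [h1, h1']
    | succ k ih =>
      rw [← add_assoc, pl_succ, pl_succ, h2 _ (by omega), h2' _ (by omega), ih]
  funext n
  exact pl_inj (key (n+1)) n (by omega)

theorem exists_delta {Y : Set (ℕ → Bool)} (hY : Y.Countable) :
    ∃ δ : List Bool → Bool, ∀ π ∈ Y, ∀ᶠ n in atTop, π n = δ (prefList π n) := by
  classical
  obtain ⟨f, hf⟩ := Set.countable_iff_exists_subset_range.1 hY
  refine ⟨fun u => f (sInf {i | prefList (f i) u.length = u}) u.length, fun π hπ => ?_⟩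
  have hex : ∃ i, f i = π := hf hπ
  let i := Nat.find hex
  have hi : f i = π := Nat.find_spec hex
  have hlt : ∀ j ∈ Finset.range i, ∀ᶠ n in atTop, prefList (f j) n ≠ prefList π n := by
    intro j hj
    have hne : f j ≠ π := Nat.find_min hex (Finset.mem_range.1 hj)
    obtain ⟨k, hk⟩ := Function.ne_iff.1 hne
    filter_upwards [eventually_gt_atTop k] with n hn h
    exact hk (pl_inj h k hn)
  filter_upwards [(eventually_all_finset _).2 hlt] with n hn
  have : sInf {j | prefList (f j) (prefList π n).length = prefList π n} = i := by
    rw [pl_len]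
    apply le_antisymm
    · apply Nat.sInf_le
      simp [hi]
    · by_contra hcon
      push Not at hcon
      have hm : sInf {j | prefList (f j) n = prefList π n} ∈
          {j | prefList (f j) n = prefList π n} := Nat.sInf_mem ⟨i, by simp [hi]⟩
      exact hn _ (Finset.mem_range.2 hcon) hm
  rw [this, pl_len, hi]

theorem pta_lim_eq {a : ℕ → ℕ} {c : ℕ} (h1 : ∃ᶠ n in atTop, a n = c) (h2 : ∀ᶠ n in atTop, c ≤ a n) :
    sInf {c | {n | a n = c}.Infinite} = c := by
  apply le_antisymm
  · exact Nat.sInf_le (Nat.frequently_atTop_iff_infinite.1 h1)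
  · apply le_csInf ⟨c, Nat.frequently_atTop_iff_infinite.1 h1⟩
    intro d hd
    obtain ⟨n, hn, hn'⟩ := ((Nat.frequently_atTop_iff_infinite.2 hd).and_eventually h2).exists
    have hn : a n = d := hn
    omega

theorem lim_exists {a : ℕ → ℕ} {K : ℕ} (hK : ∀ n, a n ≤ K) :
    ∃ c, (∃ᶠ n in atTop, a n = c) ∧ (∀ᶠ n in atTop, c ≤ a n) := by
  classical
  have hex : ∃ c, ∃ᶠ n in atTop, a n = c := by
    by_contra hcon
    push Not at hcon
    have : ∀ c ∈ Finset.range (K+1), ∀ᶠ n in atTop, a n ≠ c := fun c _ => by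
      simpa using hcon c
    obtain ⟨n, hn⟩ := ((eventually_all_finset _).2 this).exists
    exact hn (a n) (Finset.mem_range.2 (Nat.lt_succ_of_le (hK n))) rfl
  refine ⟨Nat.find hex, Nat.find_spec hex, ?_⟩
  have : ∀ c ∈ Finset.range (Nat.find hex), ∀ᶠ n in atTop, a n ≠ c := fun c hc => by
    have := Nat.find_min hex (Finset.mem_range.1 hc)
    simpa using this
  filter_upwards [(eventually_all_finset _).2 this] with n hn
  by_contra hcon
  exact hn (a n) (Finset.mem_range.2 (by omega)) rfl

theorem window {a m : ℕ → ℕ} {d : ℕ → Bool} {K : ℕ} (hK : ∀ n, a n ≤ K)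
    (hm : ∀ n, m (n+1) = if d n then a (n+1) else min (m n) (a (n+1)))
    (hd : ∃ᶠ n in atTop, d n = true) :
    sInf {c | {n | (if d n then m n else 2 * K) = c}.Infinite} =
      sInf {c | {n | a n = c}.Infinite} := by
  classical
  obtain ⟨c, h1, h2⟩ := lim_exists hK
  rw [pta_lim_eq h1 h2]
  have hcK : c ≤ K := by
    obtain ⟨n, hn⟩ := h1.exists
    exact hn ▸ hK n
  obtain ⟨N, hN⟩ := eventually_atTop.1 h2
  obtain ⟨n1, hn1, hdn1⟩ := frequently_atTop.1 hd N
  have hmc : ∀ k, c ≤ m (n1 + 1 + k) := by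
    intro k
    induction k with
    | zero =>
      have := hm n1
      rw [if_pos hdn1] at this
      simp only [add_zero, this]
      exact hN _ (by omega)
    | succ k ih =>
      rw [← add_assoc, hm]
      have := hN (n1 + 1 + k + 1) (by omega)
      split_ifs
      · exact this
      · exact le_min ih this
  apply pta_lim_eq
  · rw [frequently_atTop]
    intro L
    obtain ⟨n, hn, han⟩ := frequently_atTop.1 h1 (max L (n1 + 2))
    have hn2 : n1 + 2 ≤ n := le_trans (le_max_right _ _) hn
    have hnL : L ≤ n := le_trans (le_max_left _ _) hn
    have hex : ∃ k, d (n + k) = true := by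
      obtain ⟨k, hk, hdk⟩ := frequently_atTop.1 hd n
      exact ⟨k - n, by rwa [Nat.add_sub_cancel' hk]⟩
    have hle : ∀ k ≤ Nat.find hex, m (n + k) ≤ c := by
      intro k
      induction k with
      | zero =>
        intro _
        obtain ⟨n', rfl⟩ : ∃ n', n = n' + 1 := ⟨n - 1, by omega⟩
        rw [add_zero, hm, han]
        split_ifs
        · exact le_rfl
        · exact min_le_right _ _
      | succ k ih =>
        intro hk
        rw [← add_assoc, hm, if_neg (Nat.find_min hex (by omega))]
        exact le_trans (min_le_left _ _) (ih (by omega))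
    refine ⟨n + Nat.find hex, by omega, ?_⟩
    rw [if_pos (Nat.find_spec hex)]
    apply le_antisymm (hle _ le_rfl)
    have := hmc (n + Nat.find hex - (n1 + 1))
    rwa [show n1 + 1 + (n + Nat.find hex - (n1 + 1)) = n + Nat.find hex by omega] at this
  · filter_upwards [eventually_ge_atTop (n1+1)] with n hn
    obtain ⟨k, rfl⟩ := Nat.exists_eq_add_of_le hn
    split_ifs
    · exact hmc k
    · omega

theorem col_bdd {Alph : Type} (M : PTA Alph) : ∃ K, ∀ q, M.col q ≤ K := by
  have := M.finQ
  obtain ⟨K, hK⟩ := (Set.finite_range M.col).bddAbove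
  exact ⟨K, fun q => hK ⟨q, rfl⟩⟩

/-! ## co-countable -/

open Classical in
noncomputable def updMem {Alph : Type} (M : PTA Alph) (x : M.Q × M.Q × Bool) (q' : M.Q) : M.Q :=
  if x.2.2 then q' else if M.col x.2.1 ≤ M.col q' then x.2.1 else q'

theorem updMem_col {Alph : Type} (M : PTA Alph) (x : M.Q × M.Q × Bool) (q' : M.Q) :
    M.col (updMem M x q') = if x.2.2 then M.col q' else min (M.col x.2.1) (M.col q') := by
  unfold updMem
  split_ifs with h1 h2
  · rfl
  · exact (min_eq_left h2).symm
  · exact (min_eq_right (by omega)).symm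

noncomputable def coAut {Alph : Type} (M : PTA Alph) (K : ℕ) : PTA Alph where
  Q := M.Q × M.Q × Bool
  finQ := by have := M.finQ; infer_instance
  qini := (M.qini, M.qini, false)
  delta := {x | (x.1.1, x.2.1, x.2.2.1.1, x.2.2.2.1) ∈ M.delta ∧
    x.2.2.1.2.1 = updMem M x.1 x.2.2.1.1 ∧ x.2.2.2.2.1 = updMem M x.1 x.2.2.2.1 ∧
    x.2.2.1.2.2 = !x.2.2.2.2.2}
  col := fun x => if x.2.2 then M.col x.2.1 else 2 * K

theorem co_branch {Alph : Type} (M : PTA Alph) (K : ℕ) (hK : ∀ q, M.col q ≤ K)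
    (F : List Bool → M.Q × M.Q × Bool) (δ : List Bool → Bool)
    (hmem : ∀ u b, (F (u ++ [b])).2.1 = updMem M (F u) (F (u ++ [b])).1)
    (hδ : ∀ u b, (F (u ++ [b])).2.2 = false ↔ b = δ u) (π : ℕ → Bool) :
    AcceptingBranch (coAut M K) F π ↔
      (AcceptingBranch M (fun u => (F u).1) π ∨ ∀ᶠ n in atTop, π n = δ (prefList π n)) := by
  have hEq : (∀ᶠ n in atTop, π n = δ (prefList π n)) ↔
      ∀ᶠ n in atTop, (F (prefList π n)).2.2 = false := by
    constructor
    · intro h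
      obtain ⟨N, hN⟩ := eventually_atTop.1 h
      refine eventually_atTop.2 ⟨N+1, fun n hn => ?_⟩
      obtain ⟨n, rfl⟩ : ∃ n', n = n' + 1 := ⟨n - 1, by omega⟩
      rw [pl_succ, hδ]
      exact hN n (by omega)
    · intro h
      obtain ⟨N, hN⟩ := eventually_atTop.1 h
      refine eventually_atTop.2 ⟨N, fun n hn => ?_⟩
      rw [← hδ, ← pl_succ]
      exact hN _ (by omega)
  by_cases hev : ∀ᶠ n in atTop, (F (prefList π n)).2.2 = false
  · have hlim : sInf {c | {n | (coAut M K).col (F (prefList π n)) = c}.Infinite} = 2 * K := by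
      have : ∀ᶠ n in atTop, (coAut M K).col (F (prefList π n)) = 2 * K := by
        filter_upwards [hev] with n hn
        simp [coAut, hn]
      exact pta_lim_eq this.frequently (this.mono fun n hn => hn.ge)
    constructor
    · intro _; exact Or.inr (hEq.2 hev)
    · intro _
      unfold AcceptingBranch
      rw [hlim]
      exact even_two_mul K
  · have hfr : ∃ᶠ n in atTop, (F (prefList π n)).2.2 = true := by
      simpa [Filter.Frequently] using hev
    have := window (a := fun n => M.col (F (prefList π n)).1)
      (m := fun n => M.col (F (prefList π n)).2.1) (d := fun n => (F (prefList π n)).2.2)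
      (K := K) (fun n => hK _)
      (by intro n; simp only [pl_succ, hmem]; rw [updMem_col]) hfr
    rw [hEq]
    unfold AcceptingBranch
    rw [← this]
    simp only [hev, or_false]
    rfl

theorem cocount_regular {Alph : Type} (M : PTA Alph) : RegularTreeLang (LCoCount M) := by
  obtain ⟨K, hK⟩ := col_bdd M
  refine ⟨coAut M K, ?_⟩
  ext t
  constructor
  · rintro ⟨ρ, ⟨hρ0, hρ⟩, hc⟩
    obtain ⟨δ, hδ⟩ := exists_delta hc
    obtain ⟨F, F0, hF⟩ := exists_label (S := M.Q × M.Q × Bool) (fun u x => x.1 = ρ u)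
      (fun u x m' => ∀ b, m' b = (ρ (u ++ [b]), updMem M x (ρ (u ++ [b])), b != δ u))
      (M.qini, M.qini, false) hρ0.symm
      (fun u x _ => ⟨fun b => (ρ (u ++ [b]), updMem M x (ρ (u ++ [b])), b != δ u),
        fun b => rfl, fun b => rfl⟩)
    have hF1 : ∀ u, (F u).1 = ρ u := fun u => (hF u).1
    have hF2 : ∀ u b, F (u ++ [b]) = (ρ (u ++ [b]), updMem M (F u) (ρ (u ++ [b])), b != δ u) :=
      fun u => (hF u).2
    refine ⟨F, ⟨F0, fun u => ?_⟩, fun π => ?_⟩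
    · refine ⟨?_, ?_, ?_, ?_⟩
      · simpa [hF1] using hρ u
      · simp [hF2]
      · simp [hF2]
      · simp [hF2]
    · rw [co_branch M K hK F δ (by intro u b; simp [hF2]) (by intro u b; simp [hF2])]
      have : (fun u => (F u).1) = ρ := funext hF1
      rw [this]
      by_cases hacc : AcceptingBranch M ρ π
      · exact Or.inl hacc
      · exact Or.inr (hδ π hacc)
  · rintro ⟨F, ⟨F0, hF⟩, hacc⟩
    change List Bool → M.Q × M.Q × Bool at F
    refine ⟨fun u => (F u).1, ⟨?_, fun u => (hF u).1⟩, ?_⟩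
    · change (F []).1 = _
      rw [F0]; rfl
    · let δ : List Bool → Bool := fun u => !(F (u ++ [true])).2.2
      have hmem : ∀ u b, (F (u ++ [b])).2.1 = updMem M (F u) (F (u ++ [b])).1 := by
        intro u b
        cases b
        · exact (hF u).2.1
        · exact (hF u).2.2.1
      have hδ : ∀ u b, (F (u ++ [b])).2.2 = false ↔ b = δ u := by
        intro u b
        have h4 : (F (u ++ [false])).2.2 = !(F (u ++ [true])).2.2 := (hF u).2.2.2
        cases b
        · rw [h4]; simp [δ]
        · simp [δ]
      refine (countable_follow δ).mono fun π hπ => ?_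
      exact ((co_branch M K hK F δ hmem hδ π).1 (hacc π)).resolve_left hπ


/-! ## uncountable -/

abbrev UMode (Q : Type) : Type := Option (Option (Q × Bool × Bool))

def UStep {Alph : Type} (M : PTA Alph) (q : M.Q) : UMode M.Q → (Bool → UMode M.Q) → Prop
  | none, m' => ∀ b, m' b = none
  | some none, m' => ∃ b, m' (!b) = none ∧
      (m' b = some none ∨ ∃ c, Even (M.col c) ∧ m' b = some (some (c, false, false)))
  | some (some (c, i, _)), m' => M.col c ≤ M.col q ∧
      ((i = true ∧ ∀ b, m' b = some (some (c, false, true))) ∨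
       ∃ b, m' (!b) = none ∧ (m' b = some (some (c, i, false)) ∨
        (i = false ∧ M.col q = M.col c ∧ m' b = some (some (c, true, false)))))

def UCol {Q : Type} : UMode Q → ℕ
  | none => 0
  | some none => 1
  | some (some (_, _, f)) => if f then 0 else 1

def uAut {Alph : Type} (M : PTA Alph) : PTA Alph where
  Q := M.Q × UMode M.Q
  finQ := by have := M.finQ; infer_instance
  qini := (M.qini, some none)
  delta := {x | (x.1.1, x.2.1, x.2.2.1.1, x.2.2.2.1) ∈ M.delta ∧
    UStep M x.1.1 x.1.2 (fun b => cond b x.2.2.2.2 x.2.2.1.2)}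
  col := fun x => UCol x.2

theorem UCol_le {Q : Type} (m : UMode Q) : UCol m ≤ 1 := by
  rcases m with _ | _ | ⟨c, i, f⟩
  · simp [UCol]
  · simp [UCol]
  · cases f <;> simp [UCol]

theorem u_branch {Alph : Type} (M : PTA Alph) (F : List Bool → M.Q × UMode M.Q) (π : ℕ → Bool) :
    AcceptingBranch (uAut M) F π ↔ ∃ᶠ n in atTop, UCol (F (prefList π n)).2 = 0 := by
  obtain ⟨c, h1, h2⟩ := lim_exists (a := fun n => UCol (F (prefList π n)).2) (fun n => UCol_le _)
  constructor
  · intro h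
    have hc : Even c := by
      have h' : Even (sInf {c | {n | UCol (F (prefList π n)).2 = c}.Infinite}) := h
      rwa [pta_lim_eq h1 h2] at h'
    obtain ⟨n, hn⟩ := h1.exists
    have hle := UCol_le (F (prefList π n)).2
    have : c = 0 := by
      obtain ⟨k, hk⟩ := hc
      have hn : UCol (F (prefList π n)).2 = c := hn
      omega
    subst this
    exact h1
  · intro h
    change Even (sInf {c | {n | UCol (F (prefList π n)).2 = c}.Infinite})
    rw [pta_lim_eq h (Eventually.of_forall fun n => Nat.zero_le _)]
    exact Even.zero

theorem unc_back {Alph : Type} (M : PTA Alph) (q : List Bool → M.Q) (μ : List Bool → UMode M.Q)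
    (h0 : μ [] = some none) (hstep : ∀ u, UStep M (q u) (μ u) (fun b => μ (u ++ [b])))
    (hacc : ∀ π, ∃ᶠ n in atTop, UCol (μ (prefList π n)) = 0) :
    ¬ (Set.Countable {π : ℕ → Bool | AcceptingBranch M q π}) := by
  intro hcount
  obtain ⟨δ, hδ⟩ := exists_delta hcount
  have hv : ∃ v c, Even (M.col c) ∧ μ v = some (some (c, false, false)) := by
    by_contra hcon
    push Not at hcon
    obtain ⟨π, -, hπ⟩ := exists_follow (fun u => μ u = some none) (fun _ _ => True) [] h0 (by
      intro u hu
      have := hstep u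
      rw [hu] at this
      obtain ⟨b, -, hb | ⟨c, hc, hb⟩⟩ := this
      · exact ⟨b, hb, trivial⟩
      · exact absurd hb (hcon _ _ hc))
    obtain ⟨n, hn⟩ := (hacc π).exists
    have := (hπ n (Nat.zero_le _)).1
    rw [this] at hn
    simp [UCol] at hn
  obtain ⟨v, c, hc, hv⟩ := hv
  obtain ⟨π, -, hπ⟩ := exists_follow (fun u => ∃ x : Bool × Bool, μ u = some (some (c, x)))
    (fun u b => μ (u ++ [!b]) ≠ none → b = !δ u) v ⟨_, hv⟩ (by
      rintro u ⟨⟨i, f⟩, hu⟩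
      have := hstep u
      rw [hu] at this
      obtain ⟨-, ⟨-, h⟩ | ⟨b, h, hb | ⟨-, -, hb⟩⟩⟩ := this
      · exact ⟨!δ u, ⟨_, h _⟩, fun _ => rfl⟩
      · exact ⟨b, ⟨_, hb⟩, fun h' => absurd h h'⟩
      · exact ⟨b, ⟨_, hb⟩, fun h' => absurd h h'⟩)
  have hx : ∀ n, ∃ x : Bool × Bool, v.length ≤ n → μ (prefList π n) = some (some (c, x)) := by
    intro n
    by_cases hn : v.length ≤ n
    · obtain ⟨x, hx⟩ := (hπ n hn).1
      exact ⟨x, fun _ => hx⟩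
    · exact ⟨(true, true), fun h => absurd h hn⟩
  choose x hx using hx
  have facts : ∀ n ≥ v.length, M.col c ≤ M.col (q (prefList π n)) ∧
      ((x (n+1)).2 = true → (x n).1 = true ∧ (x (n+1)).1 = false ∧ π n = !δ (prefList π n)) ∧
      ((x n).1 = false → (x (n+1)).1 = true → M.col (q (prefList π n)) = M.col c) := by
    intro n hn
    have h1 := hx n hn
    have h2 := hx (n+1) (by omega)
    have hR := (hπ n hn).2
    have hs := hstep (prefList π n)
    rw [h1] at hs
    rw [pl_succ] at h2
    generalize x n = y at *
    generalize x (n+1) = z at *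
    obtain ⟨i, f⟩ := y
    obtain ⟨i', f'⟩ := z
    obtain ⟨hle, ⟨hi, h⟩ | ⟨b, h, hb⟩⟩ := hs
    · refine ⟨hle, ?_, ?_⟩
      · intro _
        have e1 := h (π n)
        simp only at e1
        rw [h2] at e1
        simp only [Option.some.injEq, Prod.mk.injEq, true_and] at e1
        refine ⟨hi, e1.1, hR ?_⟩
        have e2 := h (!π n)
        simp only at e2
        rw [e2]; simp
      · intro hi'
        simp only at hi'
        rw [hi] at hi'
        simp at hi'
    · have hbe : π n = b := by
        by_contra hne
        have : (!b) = π n := by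
          revert hne; cases b <;> cases π n <;> simp
        simp only at h
        rw [this, h2] at h
        simp at h
      subst hbe
      refine ⟨hle, ?_, ?_⟩
      · intro hf
        simp only at hf
        subst hf
        rcases hb with hb | ⟨-, -, hb⟩ <;>
        · simp only at hb
          rw [h2] at hb
          simp at hb
      · intro hi hi'
        simp only at hi hi'
        subst hi hi'
        rcases hb with hb | ⟨-, hcq, hb⟩
        · simp only at hb
          rw [h2] at hb
          simp at hb
        · exact hcq
  have fresh : ∀ L, ∃ n ≥ L, v.length ≤ n ∧ (x (n+1)).2 = true := by
    intro L
    obtain ⟨n, hn, hcol⟩ := frequently_atTop.1 (hacc π) (max L v.length + 1)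
    have hL : L ≤ max L v.length := le_max_left _ _
    have hV : v.length ≤ max L v.length := le_max_right _ _
    obtain ⟨n, rfl⟩ : ∃ n', n = n' + 1 := ⟨n - 1, by omega⟩
    refine ⟨n, by omega, by omega, ?_⟩
    rw [hx (n+1) (by omega)] at hcol
    by_contra hcon
    simp [UCol, hcon] at hcol
  have hAcc : AcceptingBranch M q π := by
    unfold AcceptingBranch
    rw [pta_lim_eq (c := M.col c)]
    · exact hc
    · rw [frequently_atTop]
      intro L
      obtain ⟨n1, hn1, hv1, hf1⟩ := fresh L
      obtain ⟨n2, hn2, hv2, hf2⟩ := fresh (n1 + 1)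
      by_contra hcon
      push Not at hcon
      have hi : ∀ k, (x (n1 + 1 + k)).1 = false := by
        intro k
        induction k with
        | zero => exact ((facts n1 hv1).2.1 hf1).2.1
        | succ k ih =>
          by_contra hne
          exact hcon (n1 + 1 + k) (by omega)
            ((facts (n1 + 1 + k) (by omega)).2.2 ih (by rw [← add_assoc] at hne; simpa using hne))
      obtain ⟨k, rfl⟩ := Nat.exists_eq_add_of_le hn2
      have h1 := ((facts _ hv2).2.1 hf2).1
      rw [hi] at h1
      simp at h1
    · exact eventually_atTop.2 ⟨v.length, fun n hn => (facts n hn).1⟩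
  obtain ⟨N, hN⟩ := eventually_atTop.1 (hδ π hAcc)
  obtain ⟨n, hn, hvn, hf⟩ := fresh N
  have h1 := ((facts n hvn).2.1 hf).2.2
  have h2 := hN n hn
  rw [← h2] at h1
  simp at h1

theorem pl_ext {π : ℕ → Bool} {u : List Bool} (h : prefList π u.length = u) {k : ℕ}
    (hk : u.length ≤ k) : ∃ z, prefList π k = u ++ z := by
  obtain ⟨j, rfl⟩ := Nat.exists_eq_add_of_le hk
  clear hk
  induction j with
  | zero => exact ⟨[], by simpa using h⟩
  | succ j ih =>
    obtain ⟨z, hz⟩ := ih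
    exact ⟨z ++ [π (u.length + j)], by rw [← add_assoc, pl_succ, hz, List.append_assoc]⟩

theorem pl_of_append {π : ℕ → Bool} {u z : List Bool}
    (h : prefList π (u ++ z).length = u ++ z) : prefList π u.length = u := by
  apply List.ext_getElem
  · simp [pl_len]
  · intro i h1 h2
    have e : (prefList π (u ++ z).length)[i]'(by rw [pl_len, List.length_append]; omega)
        = (u ++ z)[i]'(by rw [List.length_append]; omega) := by
      simp only [h]
    rw [List.getElem_append_left h2] at e
    rw [← e]
    simp [prefList]

def Good (X : Set (ℕ → Bool)) (u : List Bool) : Prop :=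
  ¬ Set.Countable {π | π ∈ X ∧ prefList π u.length = u}

theorem Good.of_append {X : Set (ℕ → Bool)} {u z : List Bool} (h : Good X (u ++ z)) : Good X u :=
  by
  intro hc
  refine h (Set.Countable.mono ?_ hc)
  rintro π ⟨h1, h2⟩
  exact ⟨h1, pl_of_append h2⟩

theorem Good.child {X : Set (ℕ → Bool)} {u : List Bool} (h : Good X u) :
    ∃ b, Good X (u ++ [b]) := by
  by_contra hcon
  simp only [Good, not_exists, not_not] at hcon
  refine h ((Set.countable_iUnion hcon).mono ?_)
  rintro π ⟨h1, h2⟩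
  refine Set.mem_iUnion.2 ⟨π u.length, h1, ?_⟩
  rw [List.length_append, List.length_singleton, pl_succ, h2]

theorem Good.exists_mem {X : Set (ℕ → Bool)} {u : List Bool} (h : Good X u) :
    ∃ π ∈ X, prefList π u.length = u := by
  by_contra hcon
  push Not at hcon
  apply h
  have : {π | π ∈ X ∧ prefList π u.length = u} = ∅ := by
    ext π
    constructor
    · rintro ⟨h1, h2⟩
      exact hcon π h1 h2
    · intro h; exact absurd h (Set.notMem_empty _)
  rw [this]
  exact Set.countable_empty

theorem Good.ext {X : Set (ℕ → Bool)} {u : List Bool} (h : Good X u) (T : List Bool → Prop)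
    (E : Set.Countable {π | π ∈ X ∧
      ∀ k ≥ u.length, Good X (prefList π k) ∧ ¬ T (prefList π k)}) :
    ∃ z, Good X (u ++ z) ∧ T (u ++ z) := by
  by_contra hcon
  push Not at hcon
  have hU : Set.Countable (⋃ w : {w : List Bool // ¬ Good X w},
      {π | π ∈ X ∧ prefList π w.1.length = w.1}) :=
    Set.countable_iUnion fun w => not_not.1 w.2
  refine h ((E.union hU).mono ?_)
  rintro π ⟨h1, h2⟩
  by_cases hall : ∀ k ≥ u.length, Good X (prefList π k)
  · left
    refine ⟨h1, fun k hk => ⟨hall k hk, ?_⟩⟩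
    obtain ⟨z, hz⟩ := pl_ext h2 hk
    have := hall k hk
    rw [hz] at this ⊢
    exact hcon z this
  · right
    push Not at hall
    obtain ⟨k, -, hk⟩ := hall
    exact Set.mem_iUnion.2 ⟨⟨_, hk⟩, h1, by simp [pl_len]⟩

theorem exists_rank (X : Set (ℕ → Bool)) (T : List Bool → Prop)
    (h : ∀ u, Good X u → ∃ z, Good X (u ++ z) ∧ T (u ++ z)) :
    ∃ r : List Bool → ℕ, ∀ u, Good X u → ¬ T u →
      ∃ b, Good X (u ++ [b]) ∧ r (u ++ [b]) < r u := by
  refine ⟨fun u => sInf {k | ∃ z : List Bool, z.length = k ∧ Good X (u ++ z) ∧ T (u ++ z)},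
    fun u hu hT => ?_⟩
  obtain ⟨z, hz⟩ := h u hu
  obtain ⟨z, hzl, hzg, hzT⟩ := Nat.sInf_mem
    (s := {k | ∃ z : List Bool, z.length = k ∧ Good X (u ++ z) ∧ T (u ++ z)}) ⟨_, z, rfl, hz⟩
  cases z with
  | nil => simp at hzT; exact absurd hzT hT
  | cons b z =>
    have e : u ++ b :: z = (u ++ [b]) ++ z := by simp
    rw [e] at hzg hzT
    refine ⟨b, hzg.of_append, ?_⟩
    simp only
    rw [← hzl]
    refine lt_of_le_of_lt (Nat.sInf_le ⟨z, rfl, hzg, hzT⟩) (by simp)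

def uInv {Q : Type} (X : Set (ℕ → Bool)) (n : ℕ) (c0 : Q) (u : List Bool) : UMode Q → Prop
  | none => True
  | some none => Good X u ∧ u.length ≤ n
  | some (some (c, _, _)) => c = c0 ∧ Good X u ∧ n < u.length

def uRank {Q : Type} (n : ℕ) (r0 r1 : List Bool → ℕ) (u : List Bool) : UMode Q → ℕ ×ₗ ℕ
  | none => toLex (0, 0)
  | some none => toLex (2, n - u.length)
  | some (some (_, false, _)) => toLex (1, r0 u)
  | some (some (_, true, _)) => toLex (0, r1 u)

theorem unc_fwd {Alph : Type} (M : PTA Alph) (ρ : List Bool → M.Q)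
    (hu : ¬ (Set.Countable {π : ℕ → Bool | AcceptingBranch M ρ π})) :
    ∃ μ : List Bool → UMode M.Q, μ [] = some none ∧
      (∀ u, UStep M (ρ u) (μ u) (fun b => μ (u ++ [b]))) ∧
      ∀ π, ∃ᶠ n in atTop, UCol (μ (prefList π n)) = 0 := by
  classical
  obtain ⟨K, hK⟩ := col_bdd M
  let X : ℕ × ℕ → Set (ℕ → Bool) := fun p => {π | Even p.1 ∧
    (∃ᶠ k in atTop, M.col (ρ (prefList π k)) = p.1) ∧ ∀ k ≥ p.2, p.1 ≤ M.col (ρ (prefList π k))}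
  have hX : ∃ p, ¬ (X p).Countable := by
    by_contra hcon
    push Not at hcon
    refine hu ((Set.countable_iUnion hcon).mono ?_)
    intro π hπ
    obtain ⟨c, h1, h2⟩ := lim_exists (a := fun n => M.col (ρ (prefList π n))) (fun n => hK _)
    obtain ⟨N, hN⟩ := eventually_atTop.1 h2
    refine Set.mem_iUnion.2 ⟨(c, N), ?_, h1, hN⟩
    have h' : Even (sInf {c | {n | M.col (ρ (prefList π n)) = c}.Infinite}) := hπ
    rwa [pta_lim_eq h1 h2] at h'
  obtain ⟨⟨c, n⟩, hXc⟩ := hX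
  generalize hXX : X (c, n) = Y at hXc
  have hY : ∀ π ∈ Y, Even c ∧ (∃ᶠ k in atTop, M.col (ρ (prefList π k)) = c) ∧
      ∀ k ≥ n, c ≤ M.col (ρ (prefList π k)) := by
    intro π hπ
    rw [← hXX] at hπ
    exact hπ
  have hroot : Good Y [] := by
    intro h
    refine hXc (Set.Countable.mono ?_ h)
    intro π hπ
    exact ⟨hπ, by simp [pl_zero]⟩
  obtain ⟨hce, c0, hc0⟩ : Even c ∧ ∃ c0, M.col c0 = c := by
    obtain ⟨π, hπ, -⟩ := hroot.exists_mem
    obtain ⟨k, hk⟩ := (hY π hπ).2.1.exists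
    exact ⟨(hY π hπ).1, _, hk⟩
  have hgc : ∀ u, Good Y u → n < u.length → c ≤ M.col (ρ u) := by
    intro u hu hn
    obtain ⟨π, hπ, hπu⟩ := hu.exists_mem
    have := (hY π hπ).2.2 u.length hn.le
    rwa [hπu] at this
  obtain ⟨r0, hr0⟩ := exists_rank Y (fun u => M.col (ρ u) = c) (by
    intro u hu
    apply hu.ext (fun u => M.col (ρ u) = c)
    convert Set.countable_empty
    ext π
    constructor
    · rintro ⟨h1, h2⟩
      obtain ⟨k, hk, hkc⟩ := frequently_atTop.1 (hY π h1).2.1 u.length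
      exact absurd hkc (h2 k hk).2
    · intro h; exact absurd h (Set.notMem_empty _))
  obtain ⟨r1, hr1⟩ := exists_rank Y (fun u => ∀ b, Good Y (u ++ [b])) (by
    intro u hu
    apply hu.ext (fun u => ∀ b, Good Y (u ++ [b]))
    refine (countable_follow (fun w => decide (Good Y (w ++ [true])))).mono ?_
    rintro π ⟨h1, h2⟩
    refine eventually_atTop.2 ⟨u.length, fun k hk => ?_⟩
    have hg := (h2 (k+1) (by omega)).1
    have hn := (h2 k hk).2
    rw [pl_succ] at hg
    by_cases ht : Good Y (prefList π k ++ [true])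
    · simp only [ht, decide_true]
      by_contra hne
      have hf : π k = false := by simpa using hne
      rw [hf] at hg
      exact hn (fun b => by cases b <;> assumption)
    · simp only [ht, decide_false]
      by_contra hne
      have hf : π k = true := by simpa using hne
      rw [hf] at hg
      exact ht hg)
  obtain ⟨μ, hμ0, hμ⟩ := exists_label (uInv Y n c0)
    (fun u m m' => UStep M (ρ u) m m' ∧
      ∀ b, UCol (m' b) ≠ 0 → uRank n r0 r1 (u ++ [b]) (m' b) < uRank n r0 r1 u m)
    (some none) ⟨hroot, Nat.zero_le _⟩ (by
    have one : ∀ (u : List Bool) (b : Bool) (m : UMode M.Q) (y : ℕ ×ₗ ℕ),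
        uInv Y n c0 (u ++ [b]) m → uRank n r0 r1 (u ++ [b]) m < y →
        ∃ m' : Bool → UMode M.Q, m' b = m ∧ m' (!b) = none ∧
          (∀ b, uInv Y n c0 (u ++ [b]) (m' b)) ∧
          ∀ b, UCol (m' b) ≠ 0 → uRank n r0 r1 (u ++ [b]) (m' b) < y := by
      intro u b m y h1 h2
      refine ⟨fun x => if x = b then m else none, by simp, by simp, ?_, ?_⟩
      · intro x
        by_cases hx : x = b
        · subst hx; simpa using h1
        · simp [hx, uInv]
      · intro x
        by_cases hx : x = b
        · subst hx; simpa using fun _ => h2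
        · simp [hx, UCol]
    intro u m hm
    rcases m with _ | _ | ⟨c', i, f⟩
    · exact ⟨fun _ => none, fun b => trivial, fun b => rfl, fun b h => absurd rfl h⟩
    · obtain ⟨hg, hl⟩ := hm
      obtain ⟨b, hb⟩ := hg.child
      rcases hl.lt_or_eq with hl | hl
      · obtain ⟨m', e1, e2, e3, e4⟩ := one u b (some none) (uRank n r0 r1 u (some none : UMode M.Q))
          ⟨hb, by simp; omega⟩ (by
            refine Prod.Lex.toLex_lt_toLex.2 (Or.inr ⟨rfl, ?_⟩)
            simp only [List.length_append, List.length_singleton]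
            omega)
        exact ⟨m', e3, ⟨b, e2, Or.inl e1⟩, e4⟩
      · obtain ⟨m', e1, e2, e3, e4⟩ := one u b (some (some (c0, false, false)))
          (uRank n r0 r1 u (some none : UMode M.Q))
          ⟨rfl, hb, by simp; omega⟩ (by
            simp only [uRank, Prod.Lex.toLex_lt_toLex]
            omega)
        exact ⟨m', e3, ⟨b, e2, Or.inr ⟨c0, hc0 ▸ hce, e1⟩⟩, e4⟩
    · obtain ⟨rfl, hg, hl⟩ := hm
      have hcol : M.col c' ≤ M.col (ρ u) := hc0 ▸ hgc u hg hl
      cases i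
      · by_cases hT : M.col (ρ u) = c
        · obtain ⟨b, hb⟩ := hg.child
          obtain ⟨m', e1, e2, e3, e4⟩ := one u b (some (some (c', true, false)))
            (uRank n r0 r1 u (some (some (c', false, f))))
            ⟨rfl, hb, by simp; omega⟩ (by
              simp only [uRank, Prod.Lex.toLex_lt_toLex]
              omega)
          exact ⟨m', e3, ⟨hcol, Or.inr ⟨b, e2, Or.inr ⟨rfl, hT.trans hc0.symm, e1⟩⟩⟩, e4⟩
        · obtain ⟨b, hb, hlt⟩ := hr0 u hg hT
          obtain ⟨m', e1, e2, e3, e4⟩ := one u b (some (some (c', false, false)))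
            (uRank n r0 r1 u (some (some (c', false, f))))
            ⟨rfl, hb, by simp; omega⟩ (by
              exact Prod.Lex.toLex_lt_toLex.2 (Or.inr ⟨rfl, hlt⟩))
          exact ⟨m', e3, ⟨hcol, Or.inr ⟨b, e2, Or.inl e1⟩⟩, e4⟩
      · by_cases hT : ∀ b, Good Y (u ++ [b])
        · refine ⟨fun _ => some (some (c', false, true)), fun b => ⟨rfl, hT b, by simp; omega⟩,
            ⟨hcol, Or.inl ⟨rfl, fun _ => rfl⟩⟩, fun b h => absurd rfl h⟩
        · obtain ⟨b, hb, hlt⟩ := hr1 u hg hT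
          obtain ⟨m', e1, e2, e3, e4⟩ := one u b (some (some (c', true, false)))
            (uRank n r0 r1 u (some (some (c', true, f))))
            ⟨rfl, hb, by simp; omega⟩ (by
              exact Prod.Lex.toLex_lt_toLex.2 (Or.inr ⟨rfl, hlt⟩))
          exact ⟨m', e3, ⟨hcol, Or.inr ⟨b, e2, Or.inl e1⟩⟩, e4⟩)
  refine ⟨μ, hμ0, fun u => (hμ u).2.1, fun π => ?_⟩
  by_contra hcon
  rw [not_frequently] at hcon
  obtain ⟨N, hN⟩ := eventually_atTop.1 hcon
  let s : ℕ → ℕ ×ₗ ℕ := fun k => uRank n r0 r1 (prefList π (N + k)) (μ (prefList π (N + k)))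
  have hs : StrictAnti s := by
    apply strictAnti_nat_of_succ_lt
    intro k
    have h1 := (hμ (prefList π (N + k))).2.2 (π (N + k))
    have h2 := hN (N + k + 1) (by omega)
    simp only [← pl_succ] at h1
    exact h1 h2
  exact not_strictAnti_of_wellFoundedLT s hs

theorem unc_regular {Alph : Type} (M : PTA Alph) : RegularTreeLang (LUnc M) := by
  refine ⟨uAut M, ?_⟩
  ext t
  constructor
  · rintro ⟨ρ, ⟨hρ0, hρ⟩, hc⟩
    obtain ⟨μ, h0, h1, h2⟩ := unc_fwd M ρ hc
    refine ⟨fun u => (ρ u, μ u), ⟨?_, fun u => ⟨hρ u, ?_⟩⟩, fun π => ?_⟩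
    · change (ρ [], μ []) = (M.qini, some none)
      rw [hρ0, h0]
    · have e : (fun b => cond b (μ (u ++ [true])) (μ (u ++ [false]))) = fun b => μ (u ++ [b]) := by
        funext b; cases b <;> rfl
      change UStep M (ρ u) (μ u) (fun b => cond b (μ (u ++ [true])) (μ (u ++ [false])))
      rw [e]
      exact h1 u
    · exact (u_branch M (fun u => (ρ u, μ u)) π).2 (h2 π)
  · rintro ⟨F, ⟨F0, hF⟩, hacc⟩
    change List Bool → M.Q × UMode M.Q at F
    refine ⟨fun u => (F u).1, ⟨?_, fun u => (hF u).1⟩, ?_⟩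
    · change (F []).1 = _
      rw [F0]; rfl
    · apply unc_back M (fun u => (F u).1) (fun u => (F u).2)
      · rw [F0]; rfl
      · intro u
        have e : (fun b => cond b (F (u ++ [true])).2 (F (u ++ [false])).2) =
            fun b => (F (u ++ [b])).2 := by
          funext b; cases b <;> rfl
        have := (hF u).2
        change UStep M (F u).1 (F u).2
          (fun b => cond b (F (u ++ [true])).2 (F (u ++ [false])).2) at this
        rwa [e] at this
      · intro π
        exact (u_branch M F π).1 (hacc π)

/-- For any parity tree automaton `M` over `Alph`-labelled
complete binary trees, the language of trees admitting a run with uncountably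
many accepting branches and the language of trees admitting a run with at most
countably many rejecting branches are both regular. -/
theorem stmt10 {Alph : Type} [Finite Alph] (M : PTA Alph) :
    RegularTreeLang (LUnc M) ∧ RegularTreeLang (LCoCount M) := by
  exact ⟨unc_regular M, cocount_regular M⟩
end
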